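/- arXiv:2302.06408 — 2 statements merged into one kernel-verified Lean document; each statement's English description precedes it below -/
import Mathlib

section
/- Let f be holomorphic and injective on 𝔻 with f(𝔻) bounded. Then ∬_𝔻 (1−|z|²)²|S(f)(z)|² dA(z) < ∞ if and only if ∬_𝔻 |f''(z)/f'(z)|² dA(z) < ∞. (This is the equivalence between the Schwarzian-derivative and pre-Schwarzian-derivative characterizations of the Weil–Petersson class of univalent maps, due to Cui and Takhtajan–Teo.) -/
/-!
STATEMENT 1 (Cui; Takhtajan–Teo): for `f` holomorphic and injective on the unit disk with
bounded image, `∬_𝔻 (1−|z|²)²|S(f)(z)|² dA < ∞  ↔  ∬_𝔻 |f''(z)/f'(z)|² dA < ∞`.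
-/

open MeasureTheory Metric

/-- The Schwarzian derivative `S(f) = f'''/f' - (3/2)(f''/f')²`. -/
noncomputable def schwarzian (f : ℂ → ℂ) (z : ℂ) : ℂ :=
  deriv (deriv (deriv f)) z / deriv f z - (3 / 2) * (deriv (deriv f) z / deriv f z) ^ 2

/-- A holomorphic function that is injective on an open set has nonvanishing derivative there. -/
theorem deriv_ne_zero_of_injOn {f : ℂ → ℂ} {U : Set ℂ} (hU : IsOpen U)
    (hf : DifferentiableOn ℂ f U) (hinj : Set.InjOn f U) {z₀ : ℂ} (hz₀ : z₀ ∈ U) :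
    deriv f z₀ ≠ 0 := by
  intro hd
  have hUn : U ∈ nhds z₀ := hU.mem_nhds hz₀
  have han : AnalyticAt ℂ f z₀ := hf.analyticAt hUn
  have hF : AnalyticAt ℂ (fun z => f z - f z₀) z₀ := han.sub analyticAt_const
  rcases hF.eventually_eq_zero_or_eventually_ne_zero with h0 | h0
  · have h1 : ∀ᶠ z in nhdsWithin z₀ {z₀}ᶜ, z ∈ U ∧ f z - f z₀ = 0 ∧ z ≠ z₀ := by
      filter_upwards [nhdsWithin_le_nhds hUn, nhdsWithin_le_nhds h0, self_mem_nhdsWithin]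
        with z h1 h2 h3 using ⟨h1, h2, h3⟩
    obtain ⟨z, h1, h2, h3⟩ := h1.exists
    exact h3 (hinj h1 hz₀ (sub_eq_zero.mp h2))
  obtain ⟨n, g, hg, hg0, hfg⟩ := (hF.exists_eventuallyEq_pow_smul_nonzero_iff).mpr (by
    intro h
    obtain ⟨z, h1, h2⟩ := ((Filter.Eventually.filter_mono nhdsWithin_le_nhds h).and h0).exists
    exact h2 h1)
  have hn0 : n ≠ 0 := by
    rintro rfl
    have := hfg.self_of_nhds
    simp at this
    exact hg0 this.symm
  have hn1 : n ≠ 1 := by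
    rintro rfl
    have h1 : HasDerivAt (fun z => (z - z₀) ^ 1 • g z) (g z₀) z₀ := by
      have h2 : HasDerivAt (fun z => z - z₀) 1 z₀ := (hasDerivAt_id z₀).sub_const z₀
      simpa using h2.fun_mul hg.differentiableAt.hasDerivAt
    have h2 := (h1.congr_of_eventuallyEq hfg).deriv
    rw [deriv_sub_const, hd] at h2
    exact hg0 h2.symm
  have hlog : AnalyticAt ℂ (fun z => Complex.exp (Complex.log (g z / g z₀) / n)) z₀ := by
    refine ((AnalyticAt.clog (hg.div analyticAt_const hg0) ?_).div analyticAt_const ?_).cexp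
    · simp [hg0]
    · exact_mod_cast hn0
  set k : ℂ → ℂ := fun z => Complex.exp (Complex.log (g z / g z₀) / n) with hk
  have hk0 : k z₀ = 1 := by simp [hk, hg0]
  have hkn : ∀ᶠ z in nhds z₀, k z ^ n = g z / g z₀ := by
    filter_upwards [hg.continuousAt.eventually_ne hg0] with z hz
    rw [hk]
    simp only
    rw [← Complex.exp_nat_mul, mul_div_cancel₀ _ (by exact_mod_cast hn0),
      Complex.exp_log (div_ne_zero hz hg0)]
  have hh : HasStrictDerivAt (fun z => (z - z₀) * k z) 1 z₀ := by
    have h1 : HasStrictDerivAt (fun z => z - z₀) 1 z₀ := (hasStrictDerivAt_id z₀).sub_const z₀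
    simpa [hk0] using h1.fun_mul hlog.hasStrictDerivAt
  have hmap := hh.map_nhds_eq one_ne_zero
  simp only [sub_self, zero_mul] at hmap
  have hV : ∀ᶠ z in nhds z₀, z ∈ U ∧ f z - f z₀ = g z₀ * ((z - z₀) * k z) ^ n := by
    filter_upwards [hUn, hfg, hkn] with z h1 h2 h3
    refine ⟨h1, ?_⟩
    rw [h2, mul_pow, h3, smul_eq_mul]
    field_simp
  have himg : (fun z => (z - z₀) * k z) '' {z | z ∈ U ∧ f z - f z₀ = g z₀ * ((z - z₀) * k z) ^ n}
      ∈ nhds (0 : ℂ) := by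
    rw [← hmap]; exact Filter.image_mem_map hV
  obtain ⟨ε, hε, hball⟩ := Metric.mem_nhds_iff.mp himg
  have hζ := Complex.isPrimitiveRoot_exp n hn0
  set ζ := Complex.exp (2 * Real.pi * Complex.I / n) with hζdef
  have hζn : ‖ζ‖ = 1 := hζ.norm'_eq_one hn0
  obtain ⟨a, ⟨haU, haf⟩, ha⟩ := hball (show ((ε / 2 : ℝ) : ℂ) ∈ ball (0 : ℂ) ε by
    simp [abs_of_pos hε, hε])
  obtain ⟨b, ⟨hbU, hbf⟩, hb⟩ := hball (show ζ * ((ε / 2 : ℝ) : ℂ) ∈ ball (0 : ℂ) ε by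
    simp [abs_of_pos hε, hε, hζn])
  simp only at ha hb
  rw [ha] at haf
  rw [hb, mul_pow, hζ.pow_eq_one, one_mul, ← haf] at hbf
  have hab : b = a := hinj hbU haU (sub_left_injective hbf)
  rw [hab, ha] at hb
  have : ζ = 1 := by
    have h2 : ((ε / 2 : ℝ) : ℂ) ≠ 0 := by exact_mod_cast (by positivity)
    exact (mul_right_cancel₀ h2 (by rw [one_mul]; exact hb)).symm
  exact hζ.ne_one (by omega) this

/-- Integration over a disk centred at the origin in polar coordinates. -/
theorem lintegral_ball_zero_eq_polar {F : ℂ → ENNReal} (hF : Measurable F) (R : ℝ) :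
    ∫⁻ z in ball (0 : ℂ) R, F z = ∫⁻ θ in Set.Ioo (-Real.pi) Real.pi, ∫⁻ r in Set.Ioo 0 R,
      ENNReal.ofReal r * F (circleMap 0 r θ) := by
  rw [← lintegral_indicator measurableSet_ball, ← Complex.lintegral_comp_polarCoord_symm,
    polarCoord_target, Measure.volume_eq_prod, setLIntegral_prod_symm]
  · refine lintegral_congr fun θ => ?_
    rw [← lintegral_indicator measurableSet_Ioi, ← lintegral_indicator measurableSet_Ioo]
    refine lintegral_congr fun r => ?_
    by_cases hr : 0 < r
    · by_cases hR : r < R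
      · simp [hr, hR, abs_of_pos hr, circleMap, Complex.exp_mul_I, Set.indicator]
      · simp [hr, hR, abs_of_pos hr, Set.indicator]
    · simp [hr, Set.indicator]
  · refine Measurable.aemeasurable ?_
    have h1 : Measurable fun p : ℝ × ℝ => Complex.polarCoord.symm p := by
      simp only [Complex.polarCoord_symm_apply]
      fun_prop
    exact (measurable_fst.ennreal_ofReal).mul ((hF.indicator measurableSet_ball).comp h1)

/-- The area form of the sub-mean value property for `‖g‖ ^ 2`, `g` holomorphic. -/
theorem norm_sq_mul_le_lintegral_ball {g : ℂ → ℂ} (hgm : Measurable g) {c : ℂ} {R : ℝ}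
    (hR : 0 ≤ R) (hg : DifferentiableOn ℂ g (ball c R)) :
    ENNReal.ofReal (Real.pi * R ^ 2 * ‖g c‖ ^ 2) ≤
      ∫⁻ z in ball c R, ENNReal.ofReal (‖g z‖ ^ 2) := by
  have hcirc : ∀ r ∈ Set.Ioo 0 R, ENNReal.ofReal (2 * Real.pi * ‖g c‖ ^ 2) ≤
      ∫⁻ θ in Set.Ioo (-Real.pi) Real.pi, ENNReal.ofReal (‖g (circleMap c r θ)‖ ^ 2) := by
    intro r hr
    have hsub : closedBall c r ⊆ ball c R := closedBall_subset_ball hr.2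
    have hd : DiffContOnCl ℂ (fun z => g z ^ 2) (ball c |r|) := by
      rw [abs_of_pos hr.1]
      exact ((hg.mono hsub).pow 2).diffContOnCl_ball subset_rfl
    have hav := hd.circleAverage
    have hcont : Continuous fun θ => g (circleMap c r θ) := by
      refine hg.continuousOn.comp_continuous (continuous_circleMap c r) fun θ => hsub ?_
      exact sphere_subset_closedBall (circleMap_mem_sphere c hr.1.le θ)
    rw [Real.circleAverage_eq_integral_add (-Real.pi),
      intervalIntegral.integral_comp_add_right (fun θ => g (circleMap c r θ) ^ 2)] at hav
    have h3 : 2 * Real.pi * ‖g c‖ ^ 2 ≤ ∫ θ in (-Real.pi)..Real.pi, ‖g (circleMap c r θ)‖ ^ 2 := by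
      have h4 : ‖g c‖ ^ 2 ≤ (2 * Real.pi)⁻¹ * ∫ θ in (-Real.pi)..Real.pi,
          ‖g (circleMap c r θ)‖ ^ 2 := by
        rw [← norm_pow, ← hav, norm_smul, Real.norm_of_nonneg (by positivity)]
        refine mul_le_mul_of_nonneg_left ?_ (by positivity)
        have h5 : -Real.pi ≤ Real.pi := by linarith [Real.pi_pos]
        have e1 : (0 : ℝ) + -Real.pi = -Real.pi := by ring
        have e2 : 2 * Real.pi + -Real.pi = Real.pi := by ring
        rw [e1, e2]
        refine (intervalIntegral.norm_integral_le_integral_norm h5).trans_eq ?_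
        simp only [norm_pow]
      rwa [inv_mul_eq_div, le_div_iff₀ (by positivity), mul_comm] at h4
    refine (ENNReal.ofReal_le_ofReal h3).trans ?_
    rw [intervalIntegral.integral_of_le (by linarith [Real.pi_pos]),
      integral_Ioc_eq_integral_Ioo, ofReal_integral_eq_lintegral_ofReal]
    · have : Continuous fun θ => ‖g (circleMap c r θ)‖ ^ 2 := hcont.norm.pow 2
      exact (this.integrableOn_Icc).mono_set Set.Ioo_subset_Icc_self
    · exact Filter.Eventually.of_forall fun _ => by positivity
  have hshift : ∫⁻ z in ball c R, ENNReal.ofReal (‖g z‖ ^ 2) =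
      ∫⁻ z in ball (0 : ℂ) R, ENNReal.ofReal (‖g (c + z)‖ ^ 2) := by
    rw [← lintegral_indicator measurableSet_ball, ← lintegral_indicator measurableSet_ball,
      ← lintegral_add_left_eq_self _ c]
    refine lintegral_congr fun z => ?_
    simp [Set.indicator]
  have hm : Measurable fun z => ENNReal.ofReal (‖g (c + z)‖ ^ 2) :=
    ((hgm.comp (measurable_const_add c)).norm.pow_const 2).ennreal_ofReal
  rw [hshift, lintegral_ball_zero_eq_polar hm, lintegral_lintegral_swap]
  · calc ENNReal.ofReal (Real.pi * R ^ 2 * ‖g c‖ ^ 2)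
        = ∫⁻ r in Set.Ioo 0 R, ENNReal.ofReal r * ENNReal.ofReal (2 * Real.pi * ‖g c‖ ^ 2) := by
          have h1 : ∫ r in (0 : ℝ)..R, r * (2 * Real.pi * ‖g c‖ ^ 2) =
              Real.pi * R ^ 2 * ‖g c‖ ^ 2 := by
            rw [intervalIntegral.integral_mul_const, integral_id]; ring
          rw [← h1, intervalIntegral.integral_of_le hR, integral_Ioc_eq_integral_Ioo,
            ofReal_integral_eq_lintegral_ofReal]
          · refine setLIntegral_congr_fun measurableSet_Ioo fun r hr => ?_
            exact ENNReal.ofReal_mul hr.1.le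
          · have : Continuous fun r : ℝ => r * (2 * Real.pi * ‖g c‖ ^ 2) := by fun_prop
            exact (this.integrableOn_Icc).mono_set Set.Ioo_subset_Icc_self
          · refine (ae_restrict_iff' measurableSet_Ioo).mpr (Filter.Eventually.of_forall ?_)
            intro r hr
            have := hr.1
            simp only [Pi.zero_apply]
            positivity
      _ ≤ _ := by
          refine setLIntegral_mono' measurableSet_Ioo fun r hr => ?_
          rw [lintegral_const_mul' _ _ ENNReal.ofReal_ne_top]
          refine mul_le_mul_right ((hcirc r hr).trans_eq ?_) _
          refine lintegral_congr fun θ => ?_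
          simp [circleMap]
  · refine Measurable.aemeasurable ?_
    have h1 : Measurable fun p : ℝ × ℝ => circleMap 0 p.2 p.1 := by
      unfold circleMap; fun_prop
    exact (measurable_snd.ennreal_ofReal).mul (hm.comp h1)

/-- Cauchy's estimate for the derivative in terms of the area integral of `‖g‖ ^ 2`. -/
theorem norm_deriv_sq_mul_le_lintegral_ball {g : ℂ → ℂ} (hgm : Measurable g) {c : ℂ} {R : ℝ}
    (hR : 0 < R) (hg : DifferentiableOn ℂ g (ball c R)) :
    ENNReal.ofReal (Real.pi * R ^ 4 / 16 * ‖deriv g c‖ ^ 2) ≤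
      ∫⁻ z in ball c R, ENNReal.ofReal (‖g z‖ ^ 2) := by
  rcases eq_or_ne (∫⁻ z in ball c R, ENNReal.ofReal (‖g z‖ ^ 2)) ⊤ with h | h
  · rw [h]; exact le_top
  set I := (∫⁻ z in ball c R, ENNReal.ofReal (‖g z‖ ^ 2)).toReal with hI
  have hI0 : 0 ≤ I := ENNReal.toReal_nonneg
  rw [← ENNReal.ofReal_toReal h]
  refine ENNReal.ofReal_le_ofReal ?_
  rw [← hI]
  have hpt : ∀ w ∈ sphere c (R / 2), ‖g w‖ ≤ √(4 * I / (Real.pi * R ^ 2)) := by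
    intro w hw
    have hsub : ball w (R / 2) ⊆ ball c R := by
      refine ball_subset_ball' ?_
      rw [mem_sphere.mp hw]; linarith
    have h1 := (norm_sq_mul_le_lintegral_ball hgm (by positivity) (hg.mono hsub)).trans
      (lintegral_mono_set hsub)
    rw [← ENNReal.ofReal_toReal h, ENNReal.ofReal_le_ofReal_iff hI0] at h1
    refine Real.le_sqrt_of_sq_le ?_
    rw [le_div_iff₀ (by positivity)]
    linarith
  have hd : DiffContOnCl ℂ g (ball c (R / 2)) :=
    (hg.mono (closedBall_subset_ball (by linarith))).diffContOnCl_ball subset_rfl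
  have h2 := Complex.norm_deriv_le_of_forall_mem_sphere_norm_le (by positivity) hd hpt
  have h3 : ‖deriv g c‖ ^ 2 ≤ (√(4 * I / (Real.pi * R ^ 2)) / (R / 2)) ^ 2 := by gcongr
  rw [div_pow, Real.sq_sqrt (by positivity)] at h3
  calc Real.pi * R ^ 4 / 16 * ‖deriv g c‖ ^ 2
      ≤ Real.pi * R ^ 4 / 16 * (4 * I / (Real.pi * R ^ 2) / (R / 2) ^ 2) := by gcongr
    _ = I := by field_simp; ring

/-- If `φ` is square integrable and holomorphic on the disk, then `(1 - ‖z‖²) φ'` is square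
integrable. -/
theorem lintegral_weighted_deriv_lt_top {φ : ℂ → ℂ} (hφm : Measurable φ)
    (hφ : DifferentiableOn ℂ φ (ball 0 1))
    (h : ∫⁻ z in ball (0 : ℂ) 1, ENNReal.ofReal (‖φ z‖ ^ 2) < ⊤) :
    ∫⁻ z in ball (0 : ℂ) 1, ENNReal.ofReal ((1 - ‖z‖ ^ 2) ^ 2 * ‖deriv φ z‖ ^ 2) < ⊤ := by
  set A : Set (ℂ × ℂ) := {p | ‖p.2 - p.1‖ < (1 - ‖p.1‖) / 2} with hA
  have hAm : MeasurableSet A := by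
    refine measurableSet_lt ?_ ?_ <;> fun_prop
  set k : ℂ × ℂ → ENNReal := A.indicator fun p => ENNReal.ofReal
    (1024 / Real.pi * ((1 - ‖p.1‖) ^ 2)⁻¹) with hk
  have hkm : Measurable k := by
    refine Measurable.indicator ?_ hAm
    fun_prop
  have hpt : ∀ z ∈ ball (0 : ℂ) 1, ENNReal.ofReal ((1 - ‖z‖ ^ 2) ^ 2 * ‖deriv φ z‖ ^ 2) ≤
      ∫⁻ w in ball (0 : ℂ) 1, k (z, w) * ENNReal.ofReal (‖φ w‖ ^ 2) := by
    intro z hz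
    have hz1 : ‖z‖ < 1 := by simpa using hz
    have hz0 := norm_nonneg z
    set d := 1 - ‖z‖ with hd
    have hd0 : 0 < d := by linarith
    have hsub : ball z (d / 2) ⊆ ball 0 1 := by
      refine ball_subset_ball' ?_
      rw [dist_zero_right]; linarith
    have h1 := norm_deriv_sq_mul_le_lintegral_ball hφm (c := z) (R := d / 2) (by positivity)
      (hφ.mono hsub)
    calc ENNReal.ofReal ((1 - ‖z‖ ^ 2) ^ 2 * ‖deriv φ z‖ ^ 2)
        ≤ ENNReal.ofReal ((1024 / Real.pi * (d ^ 2)⁻¹) *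
            (Real.pi * (d / 2) ^ 4 / 16 * ‖deriv φ z‖ ^ 2)) := by
          refine ENNReal.ofReal_le_ofReal ?_
          have e : (1024 / Real.pi * (d ^ 2)⁻¹) * (Real.pi * (d / 2) ^ 4 / 16 * ‖deriv φ z‖ ^ 2)
              = (2 * d) ^ 2 * ‖deriv φ z‖ ^ 2 := by
            field_simp; ring
          rw [e]
          have : 0 ≤ 1 - ‖z‖ ^ 2 := by nlinarith
          gcongr
          nlinarith
      _ ≤ ENNReal.ofReal (1024 / Real.pi * (d ^ 2)⁻¹) *
            ∫⁻ w in ball z (d / 2), ENNReal.ofReal (‖φ w‖ ^ 2) := by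
          rw [ENNReal.ofReal_mul (by positivity)]
          gcongr
      _ = ∫⁻ w in ball z (d / 2), k (z, w) * ENNReal.ofReal (‖φ w‖ ^ 2) := by
          rw [← lintegral_const_mul' _ _ ENNReal.ofReal_ne_top]
          refine setLIntegral_congr_fun measurableSet_ball fun w hw => ?_
          have : (z, w) ∈ A := by
            simpa [hA, dist_eq_norm] using hw
          simp only [hk, Set.indicator_of_mem this, hd]
      _ ≤ _ := lintegral_mono_set hsub
  refine (setLIntegral_mono' measurableSet_ball hpt).trans_lt ?_
  rw [lintegral_lintegral_swap]
  · have hin : ∀ w ∈ ball (0 : ℂ) 1, ∫⁻ z in ball (0 : ℂ) 1, k (z, w) * ENNReal.ofReal (‖φ w‖ ^ 2)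
        ≤ ENNReal.ofReal 2304 * ENNReal.ofReal (‖φ w‖ ^ 2) := by
      intro w hw
      have hw1 : ‖w‖ < 1 := by simpa using hw
      rw [lintegral_mul_const' _ _ ENNReal.ofReal_ne_top]
      gcongr
      have hdw : 0 < 1 - ‖w‖ := by linarith
      calc ∫⁻ z in ball (0 : ℂ) 1, k (z, w)
          ≤ ∫⁻ z in ball (0 : ℂ) 1, (ball w (1 - ‖w‖)).indicator
              (fun _ => ENNReal.ofReal (2304 / Real.pi * ((1 - ‖w‖) ^ 2)⁻¹)) z := by
            refine setLIntegral_mono' measurableSet_ball fun z hz => ?_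
            have hz1 : ‖z‖ < 1 := by simpa using hz
            by_cases hzw : (z, w) ∈ A
            · have h1 : ‖w - z‖ < (1 - ‖z‖) / 2 := hzw
              have h2 : ‖z‖ ≤ ‖w‖ + ‖w - z‖ := by
                have := norm_sub_le w (w - z); simpa using this
              have h3 : ‖w‖ ≤ ‖z‖ + ‖w - z‖ := by
                have := norm_add_le z (w - z); simpa using this
              have h4 : z ∈ ball w (1 - ‖w‖) := by
                rw [mem_ball, dist_comm, dist_eq_norm]; linarith
              simp only [hk, Set.indicator_of_mem hzw, Set.indicator_of_mem h4]
              refine ENNReal.ofReal_le_ofReal ?_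
              have h5 : 2 / 3 * (1 - ‖w‖) ≤ 1 - ‖z‖ := by linarith
              calc 1024 / Real.pi * ((1 - ‖z‖) ^ 2)⁻¹
                  ≤ 1024 / Real.pi * ((2 / 3 * (1 - ‖w‖)) ^ 2)⁻¹ := by gcongr
                _ = _ := by field_simp; ring
            · simp only [hk, Set.indicator_of_notMem hzw]; exact zero_le
        _ ≤ ∫⁻ z, (ball w (1 - ‖w‖)).indicator
              (fun _ => ENNReal.ofReal (2304 / Real.pi * ((1 - ‖w‖) ^ 2)⁻¹)) z :=
            setLIntegral_le_lintegral _ _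
        _ = ENNReal.ofReal 2304 := by
            rw [lintegral_indicator_const measurableSet_ball, Complex.volume_ball,
              ← ENNReal.ofReal_pow hdw.le, ← ENNReal.ofReal_coe_nnreal, NNReal.coe_real_pi,
              ← ENNReal.ofReal_mul (by positivity), ← ENNReal.ofReal_mul (by positivity)]
            congr 1
            field_simp
    refine (setLIntegral_mono' measurableSet_ball hin).trans_lt ?_
    rw [lintegral_const_mul' _ _ ENNReal.ofReal_ne_top]
    exact ENNReal.mul_lt_top ENNReal.ofReal_lt_top h
  · exact (hkm.mul ((hφm.comp measurable_snd).norm.pow_const 2).ennreal_ofReal).aemeasurable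

/-- The Schwarzian built from a square integrable pre-Schwarzian has finite weighted norm. -/
theorem lintegral_schwarzian_lt_top_of_preSchwarzian {φ : ℂ → ℂ} (hφm : Measurable φ)
    (hφ : DifferentiableOn ℂ φ (ball 0 1))
    (h : ∫⁻ z in ball (0 : ℂ) 1, ENNReal.ofReal (‖φ z‖ ^ 2) < ⊤) :
    ∫⁻ z in ball (0 : ℂ) 1, ENNReal.ofReal
      ((1 - ‖z‖ ^ 2) ^ 2 * ‖deriv φ z - φ z ^ 2 / 2‖ ^ 2) < ⊤ := by
  set I := (∫⁻ z in ball (0 : ℂ) 1, ENNReal.ofReal (‖φ z‖ ^ 2)).toReal with hI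
  have hI0 : 0 ≤ I := ENNReal.toReal_nonneg
  have hpt : ∀ z ∈ ball (0 : ℂ) 1, ENNReal.ofReal
      ((1 - ‖z‖ ^ 2) ^ 2 * ‖deriv φ z - φ z ^ 2 / 2‖ ^ 2) ≤
      ENNReal.ofReal 2 * ENNReal.ofReal ((1 - ‖z‖ ^ 2) ^ 2 * ‖deriv φ z‖ ^ 2) +
        ENNReal.ofReal (2 * I / Real.pi) * ENNReal.ofReal (‖φ z‖ ^ 2) := by
    intro z hz
    have hz1 : ‖z‖ < 1 := by simpa using hz
    have hz0 := norm_nonneg z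
    have hsub : ball z (1 - ‖z‖) ⊆ ball 0 1 := by
      refine ball_subset_ball' ?_
      rw [dist_zero_right]; linarith
    have h1 := (norm_sq_mul_le_lintegral_ball hφm (by linarith) (hφ.mono hsub)).trans
      (lintegral_mono_set hsub)
    rw [← ENNReal.ofReal_toReal h.ne, ENNReal.ofReal_le_ofReal_iff hI0] at h1
    rw [← ENNReal.ofReal_mul (by positivity), ← ENNReal.ofReal_mul (by positivity),
      ← ENNReal.ofReal_add (by positivity) (by positivity)]
    refine ENNReal.ofReal_le_ofReal ?_
    have h2 : ‖deriv φ z - φ z ^ 2 / 2‖ ≤ ‖deriv φ z‖ + ‖φ z‖ ^ 2 / 2 := by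
      refine (norm_sub_le _ _).trans_eq ?_
      simp
    have h3 : ‖deriv φ z - φ z ^ 2 / 2‖ ^ 2 ≤ 2 * ‖deriv φ z‖ ^ 2 + ‖φ z‖ ^ 4 / 2 := by
      calc _ ≤ (‖deriv φ z‖ + ‖φ z‖ ^ 2 / 2) ^ 2 := by gcongr
        _ ≤ _ := by nlinarith [sq_nonneg (‖deriv φ z‖ - ‖φ z‖ ^ 2 / 2)]
    have h4 : (1 - ‖z‖ ^ 2) ^ 2 ≤ 4 * (1 - ‖z‖) ^ 2 := by
      have : 0 ≤ 1 - ‖z‖ ^ 2 := by nlinarith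
      calc (1 - ‖z‖ ^ 2) ^ 2 ≤ (2 * (1 - ‖z‖)) ^ 2 := by gcongr; nlinarith
        _ = _ := by ring
    have h5 : (1 - ‖z‖) ^ 2 * ‖φ z‖ ^ 2 ≤ I / Real.pi := by
      rw [le_div_iff₀ Real.pi_pos]; linarith
    calc (1 - ‖z‖ ^ 2) ^ 2 * ‖deriv φ z - φ z ^ 2 / 2‖ ^ 2
        ≤ (1 - ‖z‖ ^ 2) ^ 2 * (2 * ‖deriv φ z‖ ^ 2 + ‖φ z‖ ^ 4 / 2) := by gcongr
      _ = 2 * ((1 - ‖z‖ ^ 2) ^ 2 * ‖deriv φ z‖ ^ 2) +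
            (1 - ‖z‖ ^ 2) ^ 2 * (‖φ z‖ ^ 4 / 2) := by ring
      _ ≤ 2 * ((1 - ‖z‖ ^ 2) ^ 2 * ‖deriv φ z‖ ^ 2) +
            4 * (1 - ‖z‖) ^ 2 * (‖φ z‖ ^ 4 / 2) := by gcongr
      _ = 2 * ((1 - ‖z‖ ^ 2) ^ 2 * ‖deriv φ z‖ ^ 2) +
            2 * ((1 - ‖z‖) ^ 2 * ‖φ z‖ ^ 2) * ‖φ z‖ ^ 2 := by ring
      _ ≤ 2 * ((1 - ‖z‖ ^ 2) ^ 2 * ‖deriv φ z‖ ^ 2) +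
            2 * (I / Real.pi) * ‖φ z‖ ^ 2 := by gcongr
      _ = _ := by ring
  refine (setLIntegral_mono' measurableSet_ball hpt).trans_lt ?_
  rw [lintegral_add_right, lintegral_const_mul' _ _ ENNReal.ofReal_ne_top,
    lintegral_const_mul' _ _ ENNReal.ofReal_ne_top]
  · exact ENNReal.add_lt_top.mpr ⟨ENNReal.mul_lt_top ENNReal.ofReal_lt_top
      (lintegral_weighted_deriv_lt_top hφm hφ h), ENNReal.mul_lt_top ENNReal.ofReal_lt_top h⟩
  · exact ((hφm.norm.pow_const 2).ennreal_ofReal).const_mul _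

/-- A holomorphic function with `(1 - ‖z‖²) g` square integrable is `o((1 - ‖z‖²)⁻²)` at the
boundary. -/
theorem exists_weighted_norm_le_of_lintegral_lt_top {g : ℂ → ℂ} (hgm : Measurable g)
    (hg : DifferentiableOn ℂ g (ball 0 1))
    (h : ∫⁻ z in ball (0 : ℂ) 1, ENNReal.ofReal ((1 - ‖z‖ ^ 2) ^ 2 * ‖g z‖ ^ 2) < ⊤)
    {ε : ℝ} (hε : 0 < ε) :
    ∃ ρ < 1, ∀ z : ℂ, ρ < ‖z‖ → ‖z‖ < 1 → (1 - ‖z‖ ^ 2) ^ 2 * ‖g z‖ ≤ ε := by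
  have hη : 0 < Real.pi * ε ^ 2 / 256 := by positivity
  obtain ⟨δ, hδ, hδ'⟩ := exists_pos_setLIntegral_lt_of_measure_lt h.ne
    (ENNReal.ofReal_pos.mpr hη).ne'
  have htend : Filter.Tendsto (fun ρ : ℝ => ENNReal.ofReal (Real.pi - ρ ^ 2 * Real.pi))
      (nhdsWithin 1 (Set.Iio 1)) (nhds 0) := by
    have h1 : Filter.Tendsto (fun ρ : ℝ => ENNReal.ofReal (Real.pi - ρ ^ 2 * Real.pi))
      (nhds 1) (nhds (ENNReal.ofReal (Real.pi - 1 ^ 2 * Real.pi))) := by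
      refine (ENNReal.continuous_ofReal.comp ?_).tendsto 1
      fun_prop
    simp only [one_pow, one_mul, sub_self, ENNReal.ofReal_zero] at h1
    exact h1.mono_left nhdsWithin_le_nhds
  have hev : ∀ᶠ ρ : ℝ in nhdsWithin 1 (Set.Iio 1), ρ < 1 ∧ 0 < ρ := by
    filter_upwards [self_mem_nhdsWithin, nhdsWithin_le_nhds (lt_mem_nhds (zero_lt_one' ℝ))]
      with ρ h1 h2 using ⟨h1, h2⟩
  obtain ⟨ρ, hρδ, hρ1', hρ0⟩ := ((htend.eventually_lt_const hδ).and hev).exists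
  refine ⟨(1 + ρ) / 2, by linarith, fun z hzρ hz1 => ?_⟩
  set d := 1 - ‖z‖ with hd
  have hd0 : 0 < d := by linarith
  have hmem : ∀ w ∈ ball z (d / 2), d / 2 < 1 - ‖w‖ ∧ ρ ≤ ‖w‖ := by
    intro w hw
    rw [mem_ball, dist_eq_norm] at hw
    have h2 : ‖w‖ ≤ ‖z‖ + ‖w - z‖ := by simpa using norm_add_le z (w - z)
    have h3 : ‖z‖ ≤ ‖w‖ + ‖w - z‖ := by simpa using norm_sub_le w (w - z)
    constructor <;> linarith
  have hsub : ball z (d / 2) ⊆ ball 0 1 := by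
    intro w hw
    have := (hmem w hw).1
    rw [mem_ball_zero_iff]; linarith
  have h1 := norm_sq_mul_le_lintegral_ball hgm (by positivity) (hg.mono hsub)
  have hvol : (volume.restrict (ball (0 : ℂ) 1)) (ball z (d / 2)) < δ := by
    rw [Measure.restrict_apply measurableSet_ball]
    refine lt_of_le_of_lt (measure_mono (?_ : _ ⊆ ball (0 : ℂ) 1 \ ball 0 ρ)) ?_
    · rintro w ⟨hw, hw1⟩
      refine ⟨hw1, ?_⟩
      simpa using (hmem w hw).2
    · rw [measure_sdiff (ball_subset_ball hρ1'.le) measurableSet_ball.nullMeasurableSet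
        measure_ball_lt_top.ne, Complex.volume_ball, Complex.volume_ball,
        ← ENNReal.ofReal_pow hρ0.le, ← ENNReal.ofReal_coe_nnreal, NNReal.coe_real_pi,
        ← ENNReal.ofReal_mul (by positivity), ENNReal.ofReal_one, one_pow, one_mul,
        ← ENNReal.ofReal_sub _ (by positivity)]
      exact hρδ
  have h2 := hδ' (ball z (d / 2)) hvol
  rw [Measure.restrict_restrict measurableSet_ball, Set.inter_eq_left.mpr hsub] at h2
  have h3 : ∫⁻ w in ball z (d / 2), ENNReal.ofReal (‖g w‖ ^ 2) ≤ ENNReal.ofReal (4 / d ^ 2) *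
      ∫⁻ w in ball z (d / 2), ENNReal.ofReal ((1 - ‖w‖ ^ 2) ^ 2 * ‖g w‖ ^ 2) := by
    rw [← lintegral_const_mul' _ _ ENNReal.ofReal_ne_top]
    refine setLIntegral_mono' measurableSet_ball fun w hw => ?_
    rw [← ENNReal.ofReal_mul (by positivity)]
    refine ENNReal.ofReal_le_ofReal ?_
    have h4 : d / 2 ≤ 1 - ‖w‖ ^ 2 := by
      have := (hmem w hw).1
      nlinarith [norm_nonneg w]
    calc ‖g w‖ ^ 2 = 4 / d ^ 2 * ((d / 2) ^ 2 * ‖g w‖ ^ 2) := by field_simp; norm_num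
      _ ≤ _ := by gcongr
  have h4 : ENNReal.ofReal (Real.pi * (d / 2) ^ 2 * ‖g z‖ ^ 2) ≤
      ENNReal.ofReal (4 / d ^ 2 * (Real.pi * ε ^ 2 / 256)) := by
    refine h1.trans (h3.trans ?_)
    rw [ENNReal.ofReal_mul (p := 4 / d ^ 2) (by positivity)]
    gcongr
  rw [ENNReal.ofReal_le_ofReal_iff (by positivity)] at h4
  have h5 : (4 * d ^ 2 * ‖g z‖) ^ 2 ≤ ε ^ 2 := by
    have : 64 * d ^ 2 / Real.pi * (Real.pi * (d / 2) ^ 2 * ‖g z‖ ^ 2) ≤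
        64 * d ^ 2 / Real.pi * (4 / d ^ 2 * (Real.pi * ε ^ 2 / 256)) := by gcongr
    calc (4 * d ^ 2 * ‖g z‖) ^ 2
        = 64 * d ^ 2 / Real.pi * (Real.pi * (d / 2) ^ 2 * ‖g z‖ ^ 2) := by field_simp; ring
      _ ≤ _ := this
      _ = ε ^ 2 := by field_simp; norm_num
  have h6 := (pow_le_pow_iff_left₀ (by positivity) hε.le two_ne_zero).mp h5
  refine le_trans ?_ h6
  gcongr
  have : 0 ≤ 1 - ‖z‖ ^ 2 := by nlinarith [norm_nonneg z]
  calc (1 - ‖z‖ ^ 2) ^ 2 ≤ (2 * d) ^ 2 := by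
        gcongr; nlinarith [norm_nonneg z]
    _ = _ := by ring

theorem riccati_cone_estimate {P Q r ε X Y Z : ℝ} (hP : 0 ≤ P) (hQ : 0 ≤ Q) (hr : 9 / 10 ≤ r)
    (hr1 : r ≤ 1) (hrε : 1 - r ≤ ε / 10) (hε : 0 < ε) (hε1 : ε ≤ 1)
    (hX : X ≤ P * (ε / 10 * ((P + Q) / 4))) (hY : Y ≤ Q * (ε / 10 * ((P + Q) / 4)))
    (hZ : Z ≤ Q * P) :
    2 * (-(2 * r) * P ^ 2 + X) - ε ^ 2 * (2 * (-(2 * (1 - r)) * Z - Y)) ≤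
      -(3 / 2 * (1 + r)) * (P ^ 2 - ε ^ 2 * Q ^ 2) := by
  have a2 : (1 - r) * Z ≤ ε / 10 * (Q * P) := by
    calc (1 - r) * Z ≤ (1 - r) * (Q * P) := mul_le_mul_of_nonneg_left hZ (by linarith)
      _ ≤ ε / 10 * (Q * P) := by gcongr
  have a3 : ε ^ 2 * (4 * ((1 - r) * Z) + 2 * Y) ≤
      ε ^ 2 * (4 * (ε / 10 * (Q * P)) + 2 * (Q * (ε / 10 * ((P + Q) / 4)))) := by
    gcongr
  have b1 : ε * P ^ 2 ≤ 1 * P ^ 2 := by gcongr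
  have b2 : ε * (P * Q) ≤ (P ^ 2 + ε ^ 2 * Q ^ 2) / 2 := by nlinarith [sq_nonneg (P - ε * Q)]
  have hε2 : ε ^ 2 ≤ 1 := by nlinarith
  have b3 : ε ^ 2 * (ε * (P * Q)) ≤ 1 * (ε * (P * Q)) := by gcongr
  have b4 : ε * (ε ^ 2 * Q ^ 2) ≤ 1 * (ε ^ 2 * Q ^ 2) := by gcongr
  have b5 : 9 / 10 * P ^ 2 ≤ r * P ^ 2 := by gcongr
  have b6 : 0 ≤ ε ^ 2 * Q ^ 2 := by positivity
  have b7 : 9 / 10 * (ε ^ 2 * Q ^ 2) ≤ r * (ε ^ 2 * Q ^ 2) := by gcongr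
  have b8 := sq_nonneg P
  linarith

/-- Monotonicity of a weighted quadratic form along solutions of `y'' = -(S/2) y`, where
`v = -2 y'/y`; it expresses that `v (1 - r²)` is attracted to `0` away from the repelling
value `4`. -/
theorem riccati_cone_antitone {y v S : ℝ → ℂ} {r₀ ε : ℝ} (hr₀ : 9 / 10 ≤ r₀)
    (hε : 0 < ε) (hε1 : ε ≤ 1) (hr₀ε : 1 - r₀ ≤ ε / 10)
    (hy : ∀ r ∈ Set.Ico r₀ 1, HasDerivAt y (-(v r * y r / 2)) r)
    (hv : ∀ r ∈ Set.Ico r₀ 1, HasDerivAt v (S r + v r ^ 2 / 2) r)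
    (hS : ∀ r ∈ Set.Ico r₀ 1, (1 - r ^ 2) ^ 2 * ‖S r‖ ≤ ε / 10) :
    AntitoneOn (fun r : ℝ => ‖y r‖ ^ 2 * (‖(1 - r ^ 2) * v r‖ ^ 2 -
      ε ^ 2 * ‖4 - (1 - r ^ 2) * v r‖ ^ 2) * (1 - r) ^ (-(3 / 2) : ℝ)) (Set.Ico r₀ 1) := by
  set p : ℝ → ℂ := fun r => (1 - (r : ℂ) ^ 2) * v r * y r with hp
  set q : ℝ → ℂ := fun r => 4 * y r - p r with hq
  set N : ℝ → ℝ := fun r => ‖p r‖ ^ 2 - ε ^ 2 * ‖q r‖ ^ 2 with hN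
  set p' : ℝ → ℂ := fun r => -2 * r * v r * y r + (1 - (r : ℂ) ^ 2) * S r * y r with hp'
  set q' : ℝ → ℂ := fun r => 4 * (-(v r * y r / 2)) - p' r with hq'
  have hpd : ∀ r ∈ Set.Ico r₀ 1, HasDerivAt p (p' r) r := by
    intro r hr
    have h1 : HasDerivAt (fun r : ℝ => (1 - (r : ℂ) ^ 2 : ℂ)) (-(2 * r) : ℂ) r := by
      have := ((hasDerivAt_id (r : ℂ)).pow 2).comp_ofReal.const_sub 1
      simpa using this
    refine ((h1.fun_mul (hv r hr)).fun_mul (hy r hr)).congr_deriv ?_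
    simp only [hp']; ring
  have hqd : ∀ r ∈ Set.Ico r₀ 1, HasDerivAt q (q' r) r := fun r hr =>
    ((hy r hr).const_mul 4).sub (hpd r hr)
  have hNd : ∀ r ∈ Set.Ico r₀ 1, HasDerivAt N
      (2 * inner ℝ (p r) (p' r) - ε ^ 2 * (2 * inner ℝ (q r) (q' r))) r := fun r hr =>
    (hpd r hr).norm_sq.sub ((hqd r hr).norm_sq.const_mul _)
  have hWd : ∀ r ∈ Set.Ico r₀ 1, HasDerivAt (fun r : ℝ => (1 - r) ^ (-(3 / 2) : ℝ))
      (3 / 2 * (1 - r) ^ (-(3 / 2) : ℝ) / (1 - r)) r := by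
    intro r hr
    have h0 : 0 < 1 - r := by linarith [hr.2]
    have h1 : HasDerivAt (fun r : ℝ => 1 - r) (-1) r := (hasDerivAt_id r).const_sub 1
    refine (h1.rpow_const (Or.inl h0.ne')).congr_deriv ?_
    rw [Real.rpow_sub_one h0.ne']
    ring
  have hEq : (fun r : ℝ => ‖y r‖ ^ 2 * (‖(1 - r ^ 2) * v r‖ ^ 2 -
      ε ^ 2 * ‖4 - (1 - r ^ 2) * v r‖ ^ 2) * (1 - r) ^ (-(3 / 2) : ℝ)) =
      fun r => N r * (1 - r) ^ (-(3 / 2) : ℝ) := by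
    funext r
    simp only [hN, hp, hq]
    have : 4 * y r - (1 - (r : ℂ) ^ 2) * v r * y r = (4 - (1 - (r : ℂ) ^ 2) * v r) * y r := by
      ring
    rw [this, norm_mul _ (y r), norm_mul _ (y r)]
    ring
  rw [hEq]
  have hder := fun r hr => (hNd r hr).fun_mul (hWd r hr)
  refine antitoneOn_of_deriv_nonpos (convex_Ico _ _)
    (fun r hr => (hder r hr).continuousAt.continuousWithinAt)
    (fun r hr => (hder r (interior_subset hr)).differentiableAt.differentiableWithinAt) ?_
  intro r hr
  replace hr := interior_subset hr
  rw [(hder r hr).deriv]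
  have hr0 := hr.1
  have hr1 : 0 < 1 - r := by linarith [hr.2]
  have hW : 0 < (1 - r) ^ (-(3 / 2) : ℝ) := Real.rpow_pos_of_pos hr1 _
  have hr2 : 0 < 1 - r ^ 2 := by nlinarith
  set P := ‖p r‖ with hP
  set Q := ‖q r‖ with hQ
  have hP0 : 0 ≤ P := norm_nonneg _
  have hQ0 : 0 ≤ Q := norm_nonneg _
  set s : ℂ := (1 - (r : ℂ) ^ 2) ^ 2 * S r with hs
  have hsn : ‖s‖ ≤ ε / 10 := by
    refine le_trans (le_of_eq ?_) (hS r hr)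
    rw [hs, norm_mul, norm_pow]
    congr 2
    rw [show (1 - (r : ℂ) ^ 2) = ((1 - r ^ 2 : ℝ) : ℂ) by push_cast; ring, Complex.norm_real,
      Real.norm_of_nonneg hr2.le]
  have hyn : ‖y r‖ ≤ (P + Q) / 4 := by
    have h1 : y r = (p r + q r) / 4 := by simp only [hq]; ring
    rw [h1, norm_div]
    have := norm_add_le (p r) (q r)
    norm_num
    linarith
  have e1 : (1 - r ^ 2) * inner ℝ (p r) (p' r) = -(2 * r) * P ^ 2 + inner ℝ (p r) (s * y r) := by
    rw [← real_inner_self_eq_norm_sq, ← real_inner_smul_right, ← real_inner_smul_right,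
      ← inner_add_right]
    congr 1
    simp only [hp', hs, hp, Complex.real_smul]
    push_cast; ring
  have e2 : (1 - r ^ 2) * inner ℝ (q r) (q' r) = -(2 * (1 - r)) * inner ℝ (q r) (p r) -
      inner ℝ (q r) (s * y r) := by
    rw [← real_inner_smul_right, ← real_inner_smul_right, ← inner_sub_right]
    congr 1
    simp only [hq', hp', hs, hp, Complex.real_smul]
    push_cast; ring
  have hsy : ‖s * y r‖ ≤ ε / 10 * ((P + Q) / 4) := by
    rw [norm_mul]; gcongr
  have i1 : inner ℝ (p r) (s * y r) ≤ P * (ε / 10 * ((P + Q) / 4)) :=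
    (real_inner_le_norm _ _).trans (by gcongr)
  have i2 : inner ℝ (q r) (s * y r) ≤ Q * (ε / 10 * ((P + Q) / 4)) :=
    (real_inner_le_norm _ _).trans (by gcongr)
  have i3 : inner ℝ (q r) (p r) ≤ Q * P := real_inner_le_norm _ _
  have key : (1 - r ^ 2) * (2 * inner ℝ (p r) (p' r) - ε ^ 2 * (2 * inner ℝ (q r) (q' r))) ≤
      -(3 / 2 * (1 + r)) * N r := by
    have a1 : (1 - r ^ 2) * (2 * inner ℝ (p r) (p' r) - ε ^ 2 * (2 * inner ℝ (q r) (q' r))) =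
        2 * ((1 - r ^ 2) * inner ℝ (p r) (p' r)) -
        ε ^ 2 * (2 * ((1 - r ^ 2) * inner ℝ (q r) (q' r))) := by ring
    rw [a1, e1, e2]
    have hNr : N r = P ^ 2 - ε ^ 2 * Q ^ 2 := rfl
    rw [hNr]
    exact riccati_cone_estimate hP0 hQ0 (hr₀.trans hr0) (by linarith) (by linarith) hε hε1
      i1 i2 i3
  have hD : 2 * inner ℝ (p r) (p' r) - ε ^ 2 * (2 * inner ℝ (q r) (q' r)) ≤
      -(3 / 2) * N r / (1 - r) := by
    rw [le_div_iff₀ hr1]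
    have h1r : 0 < 1 + r := by linarith
    refine le_of_mul_le_mul_left ?_ h1r
    linarith
  calc _ ≤ (-(3 / 2) * N r / (1 - r)) * (1 - r) ^ (-(3 / 2) : ℝ) +
        N r * (3 / 2 * (1 - r) ^ (-(3 / 2) : ℝ) / (1 - r)) := by gcongr
    _ = 0 := by ring

/-- The restriction of `φ` to a ray solves a Riccati equation. -/
theorem hasDerivAt_ray {φ : ℂ → ℂ} (hφ : DifferentiableOn ℂ φ (ball 0 1)) {ω : ℂ} (hω : ‖ω‖ = 1)
    {r : ℝ} (hr0 : 0 ≤ r) (hr1 : r < 1) :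
    HasDerivAt (fun r : ℝ => ω * φ (r * ω))
      (ω ^ 2 * (deriv φ (r * ω) - φ (r * ω) ^ 2 / 2) + (ω * φ (r * ω)) ^ 2 / 2) r := by
  have hmem : (r : ℂ) * ω ∈ ball (0 : ℂ) 1 := by
    simp [hω, abs_of_nonneg hr0, hr1]
  have h1 : HasDerivAt (fun r : ℝ => (r : ℂ) * ω) ω r := by
    simpa using (hasDerivAt_id (r : ℂ)).comp_ofReal.mul_const ω
  have h2 := ((hφ.differentiableAt (isOpen_ball.mem_nhds hmem)).hasDerivAt.comp r h1).const_mul ω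
  exact h2.congr_deriv (by ring)

set_option maxHeartbeats 1000000 in
/-- If `f` is a Bloch function whose Schwarzian is `o((1 - ‖z‖²)⁻²)`, then its pre-Schwarzian is
`o((1 - ‖z‖)⁻¹)`. -/
theorem exists_preSchwarzian_le_of_schwarzian_small {f : ℂ → ℂ}
    (hf : DifferentiableOn ℂ f (ball 0 1)) (hf0 : ∀ z ∈ ball (0 : ℂ) 1, deriv f z ≠ 0)
    {M : ℝ} (hM : ∀ z ∈ ball (0 : ℂ) 1, (1 - ‖z‖) * ‖deriv f z‖ ≤ M)
    {φ : ℂ → ℂ} (hφdef : φ = fun z => deriv (deriv f) z / deriv f z)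
    (hφ : DifferentiableOn ℂ φ (ball 0 1))
    (hS : ∀ ε > 0, ∃ ρ < 1, ∀ z : ℂ, ρ < ‖z‖ → ‖z‖ < 1 →
      (1 - ‖z‖ ^ 2) ^ 2 * ‖deriv φ z - φ z ^ 2 / 2‖ ≤ ε) {ε : ℝ} (hε : 0 < ε) :
    ∃ ρ < 1, ∀ z : ℂ, ρ < ‖z‖ → ‖z‖ < 1 → (1 - ‖z‖) * ‖φ z‖ ≤ ε := by
  obtain ⟨e, he0, heε, he1⟩ : ∃ e : ℝ, 0 < e ∧ 10 * e ≤ ε ∧ e ≤ 1 / 2 := by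
    refine ⟨min (ε / 10) (1 / 2), by positivity, ?_, min_le_right _ _⟩
    linarith [min_le_left (ε / 10) (1 / 2)]
  obtain ⟨ρ₁, hρ₁, hSe⟩ := hS (e / 10) (by positivity)
  obtain ⟨r₀, h9, hre, hρr, hr1⟩ : ∃ r₀ : ℝ, 9 / 10 ≤ r₀ ∧ 1 - r₀ ≤ e / 10 ∧ ρ₁ < r₀ ∧ r₀ < 1 := by
    refine ⟨max (9 / 10) (max (1 - e / 10) ((1 + ρ₁) / 2)), le_max_left _ _, ?_, ?_, ?_⟩
    · linarith [(le_max_left (1 - e / 10) ((1 + ρ₁) / 2)).trans (le_max_right (9 / 10) _)]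
    · linarith [(le_max_right (1 - e / 10) ((1 + ρ₁) / 2)).trans (le_max_right (9 / 10) _)]
    · refine max_lt (by norm_num) (max_lt (by linarith) (by linarith))
  have hf1 : DifferentiableOn ℂ (deriv f) (ball 0 1) := hf.deriv isOpen_ball
  obtain ⟨G, hG⟩ := hφ.isExactOn_ball
  set Y : ℂ → ℂ := fun z => Complex.exp (-(G z) / 2) with hY
  have hYd : ∀ z ∈ ball (0 : ℂ) 1, HasDerivAt Y (-(φ z * Y z / 2)) z := by
    intro z hz
    refine ((hG z hz).fun_neg.div_const 2).cexp.congr_deriv ?_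
    simp only [hY]; ring
  have hconst : ∃ c : ℂ, ∀ z ∈ ball (0 : ℂ) 1, deriv f z * Y z ^ 2 = c := by
    have hd : ∀ z ∈ ball (0 : ℂ) 1, HasDerivAt (fun z => deriv f z * Y z ^ 2) 0 z := by
      intro z hz
      have h1 := (hf1.differentiableAt (isOpen_ball.mem_nhds hz)).hasDerivAt
      refine (h1.fun_mul ((hYd z hz).fun_pow 2)).congr_deriv ?_
      rw [hφdef]
      have := hf0 z hz
      field_simp
      ring
    refine ⟨deriv f 0 * Y 0 ^ 2, fun z hz => ?_⟩
    exact isOpen_ball.is_const_of_deriv_eq_zero (convex_ball _ _).isPreconnected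
      (fun w hw => (hd w hw).differentiableAt.differentiableWithinAt)
      (fun w hw => (hd w hw).deriv) hz (mem_ball_self one_pos)
  obtain ⟨c, hc⟩ := hconst
  have hc0 : 0 < ‖c‖ := by
    rw [norm_pos_iff, ← hc 0 (mem_ball_self one_pos)]
    exact mul_ne_zero (hf0 0 (mem_ball_self one_pos)) (pow_ne_zero _ (Complex.exp_ne_zero _))
  have hM0 : 0 < M := by
    refine lt_of_lt_of_le ?_ (hM 0 (mem_ball_self one_pos))
    have := norm_pos_iff.mpr (hf0 0 (mem_ball_self one_pos))
    simpa using this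
  have hYlow : ∀ z ∈ ball (0 : ℂ) 1, ‖c‖ / M * (1 - ‖z‖) ≤ ‖Y z‖ ^ 2 := by
    intro z hz
    rw [← hc z hz, norm_mul, norm_pow, div_mul_eq_mul_div, div_le_iff₀ hM0]
    calc ‖deriv f z‖ * ‖Y z‖ ^ 2 * (1 - ‖z‖) = ‖Y z‖ ^ 2 * ((1 - ‖z‖) * ‖deriv f z‖) := by ring
      _ ≤ ‖Y z‖ ^ 2 * M := by gcongr; exact hM z hz
  obtain ⟨B, hB⟩ : ∃ B, ∀ z ∈ closedBall (0 : ℂ) r₀, ‖‖Y z‖ ^ 2 * ‖φ z‖ ^ 2‖ ≤ B := by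
    refine (isCompact_closedBall _ _).exists_bound_of_continuousOn ?_
    have hsub : closedBall (0 : ℂ) r₀ ⊆ ball 0 1 := closedBall_subset_ball hr1
    have h1 : ContinuousOn Y (closedBall 0 r₀) := fun z hz =>
      (hYd z (hsub hz)).continuousAt.continuousWithinAt
    exact (h1.norm.pow 2).mul ((hφ.continuousOn.mono hsub).norm.pow 2)
  set C : ℝ := B * (1 - r₀) ^ (-(3 / 2) : ℝ) with hC
  have hlim : Filter.Tendsto (fun r : ℝ => C * M / ‖c‖ * √(1 - r)) (nhds 1) (nhds 0) := by
    have : Continuous fun r : ℝ => C * M / ‖c‖ * √(1 - r) := by fun_prop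
    simpa using this.tendsto 1
  obtain ⟨η, hη, hηe⟩ := Metric.eventually_nhds_iff.mp
    (hlim.eventually_lt_const (show (0 : ℝ) < e ^ 2 by positivity))
  refine ⟨max r₀ (1 - η), max_lt hr1 (by linarith), fun z hz hz1 => ?_⟩
  obtain ⟨hzr, hzη⟩ := max_lt_iff.mp hz
  set r := ‖z‖ with hr
  have hr0 : 0 < r := by linarith
  obtain ⟨ω, hω, hωz⟩ : ∃ ω : ℂ, ‖ω‖ = 1 ∧ (r : ℂ) * ω = z := by
    have hr0' : (r : ℂ) ≠ 0 := by exact_mod_cast hr0.ne'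
    refine ⟨z / r, ?_, by field_simp⟩
    rw [norm_div, Complex.norm_real, Real.norm_of_nonneg hr0.le, ← hr, div_self hr0.ne']
  have hmem : ∀ t ∈ Set.Ico r₀ 1, (t : ℂ) * ω ∈ ball (0 : ℂ) 1 ∧ ‖(t : ℂ) * ω‖ = t := by
    intro t ht
    have : ‖(t : ℂ) * ω‖ = t := by
      simp [hω, abs_of_nonneg (show (0 : ℝ) ≤ t by linarith [ht.1])]
    exact ⟨by rw [mem_ball_zero_iff, this]; exact ht.2, this⟩
  have hanti := riccati_cone_antitone (y := fun t : ℝ => Y (t * ω))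
    (v := fun t : ℝ => ω * φ (t * ω))
    (S := fun t : ℝ => ω ^ 2 * (deriv φ (t * ω) - φ (t * ω) ^ 2 / 2)) h9 he0 (by linarith) hre
    (fun t ht => by
      have h1 : HasDerivAt (fun r : ℝ => (r : ℂ) * ω) ω t := by
        simpa using (hasDerivAt_id (t : ℂ)).comp_ofReal.mul_const ω
      have h2 := (hYd _ (hmem t ht).1).comp t h1
      exact h2.congr_deriv (by ring))
    (fun t ht => hasDerivAt_ray hφ hω (by linarith [ht.1]) ht.2)
    (fun t ht => by
      obtain ⟨h1, h2⟩ := hmem t ht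
      have h3 := hSe (t * ω) (by rw [h2]; linarith [ht.1]) (by rw [h2]; exact ht.2)
      rw [h2] at h3
      simpa [hω] using h3)
  have hle := hanti (Set.left_mem_Ico.mpr hr1) ⟨hzr.le, hz1⟩ hzr.le
  simp only [hωz] at hle
  have h1r : 0 < 1 - r := by linarith
  have h1r0 : 0 < 1 - r₀ := by linarith
  set u : ℂ := (1 - (r : ℂ) ^ 2) * (ω * φ z) with hu
  have hC1 : ‖Y (r₀ * ω)‖ ^ 2 * (‖(1 - (r₀ : ℂ) ^ 2) * (ω * φ (r₀ * ω))‖ ^ 2 -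
      e ^ 2 * ‖4 - (1 - (r₀ : ℂ) ^ 2) * (ω * φ (r₀ * ω))‖ ^ 2) * (1 - r₀) ^ (-(3 / 2) : ℝ) ≤ C := by
    rw [hC]
    gcongr
    have h2 := hB (r₀ * ω) (by
      rw [mem_closedBall_zero_iff, (hmem r₀ (Set.left_mem_Ico.mpr hr1)).2])
    rw [Real.norm_of_nonneg (by positivity)] at h2
    refine le_trans ?_ h2
    gcongr
    have h3 : ‖(1 - (r₀ : ℂ) ^ 2) * (ω * φ (r₀ * ω))‖ ≤ ‖φ (r₀ * ω)‖ := by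
      rw [norm_mul, norm_mul, hω, one_mul,
        show (1 - (r₀ : ℂ) ^ 2) = ((1 - r₀ ^ 2 : ℝ) : ℂ) by push_cast; ring, Complex.norm_real,
        Real.norm_of_nonneg (by nlinarith)]
      have : 1 - r₀ ^ 2 ≤ 1 := by nlinarith
      exact mul_le_of_le_one_left (norm_nonneg _) this
    have h4 : ‖(1 - (r₀ : ℂ) ^ 2) * (ω * φ (r₀ * ω))‖ ^ 2 ≤ ‖φ (r₀ * ω)‖ ^ 2 := by gcongr
    have h5 : 0 ≤ e ^ 2 * ‖4 - (1 - (r₀ : ℂ) ^ 2) * (ω * φ (r₀ * ω))‖ ^ 2 := by positivity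
    linarith
  have hDle : ‖u‖ ^ 2 - e ^ 2 * ‖4 - u‖ ^ 2 ≤ e ^ 2 := by
    by_contra! hcon
    have hDpos : 0 < ‖u‖ ^ 2 - e ^ 2 * ‖4 - u‖ ^ 2 := lt_trans (by positivity) hcon
    have hW : 0 < (1 - r) ^ (-(3 / 2) : ℝ) := Real.rpow_pos_of_pos h1r _
    have h2 : ‖c‖ / M * (1 - r) * (‖u‖ ^ 2 - e ^ 2 * ‖4 - u‖ ^ 2) * (1 - r) ^ (-(3 / 2) : ℝ) ≤
        C := by
      refine le_trans ?_ (hle.trans hC1)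
      gcongr
      exact hYlow z (by rw [mem_ball_zero_iff]; exact hz1)
    have h3 : (1 - r) * (1 - r) ^ (-(3 / 2) : ℝ) * √(1 - r) = 1 := by
      nth_rewrite 1 [← Real.rpow_one (1 - r)]
      rw [Real.sqrt_eq_rpow, ← Real.rpow_add h1r, ← Real.rpow_add h1r]
      norm_num
    have h4 : ‖u‖ ^ 2 - e ^ 2 * ‖4 - u‖ ^ 2 ≤ C * M / ‖c‖ * √(1 - r) := by
      calc ‖u‖ ^ 2 - e ^ 2 * ‖4 - u‖ ^ 2
          = (‖u‖ ^ 2 - e ^ 2 * ‖4 - u‖ ^ 2) *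
            ((1 - r) * (1 - r) ^ (-(3 / 2) : ℝ) * √(1 - r)) := by rw [h3, mul_one]
        _ = (‖c‖ / M * (1 - r) * (‖u‖ ^ 2 - e ^ 2 * ‖4 - u‖ ^ 2) * (1 - r) ^ (-(3 / 2) : ℝ)) *
              (M / ‖c‖ * √(1 - r)) := by field_simp
        _ ≤ C * (M / ‖c‖ * √(1 - r)) := by gcongr
        _ = _ := by ring
    have h5 := hηe (y := r) (by
      rw [Real.dist_eq, abs_lt]; constructor <;> linarith)
    linarith
  have hun : ‖u‖ ≤ ε := by
    have h2 : ‖4 - u‖ ≤ 4 + ‖u‖ := by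
      refine (norm_sub_le _ _).trans_eq ?_
      norm_num
    have h3 : ‖u‖ ^ 2 ≤ (e * (5 + ‖u‖)) ^ 2 := by
      have : ‖4 - u‖ ^ 2 ≤ (4 + ‖u‖) ^ 2 := by gcongr
      have h4 : e ^ 2 * ‖4 - u‖ ^ 2 ≤ e ^ 2 * (4 + ‖u‖) ^ 2 := by gcongr
      have h5 : 0 ≤ e ^ 2 * ‖u‖ := by positivity
      nlinarith [sq_nonneg e]
    have h4 := (pow_le_pow_iff_left₀ (norm_nonneg _) (by positivity) two_ne_zero).mp h3
    have h5 : e * ‖u‖ ≤ 1 / 2 * ‖u‖ := by gcongr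
    linarith
  refine le_trans ?_ hun
  rw [hu, norm_mul, norm_mul, hω, one_mul,
    show (1 - (r : ℂ) ^ 2) = ((1 - r ^ 2 : ℝ) : ℂ) by push_cast; ring, Complex.norm_real,
    Real.norm_of_nonneg (by nlinarith)]
  gcongr
  nlinarith

/-- A Hardy-type inequality along solutions of a Riccati equation. -/
theorem lintegral_riccati_le {v S : ℝ → ℂ} {ρ : ℝ}
    (hv : ∀ r ∈ Set.Ico ρ 1, HasDerivAt v (S r + v r ^ 2 / 2) r)
    (hS : ContinuousOn S (Set.Ico ρ 1))
    (hsmall : ∀ r ∈ Set.Ico ρ 1, (1 - r) * ‖v r‖ ≤ 1 / 4) (hρ : ρ < 1) :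
    ∫⁻ r in Set.Ioo ρ 1, ENNReal.ofReal (‖v r‖ ^ 2) ≤
      ENNReal.ofReal (2 * ((1 - ρ) * ‖v ρ‖ ^ 2)) +
        8 * ∫⁻ r in Set.Ioo ρ 1, ENNReal.ofReal ((1 - r) ^ 2 * ‖S r‖ ^ 2) := by
  have hvc : ContinuousOn v (Set.Ico ρ 1) := fun r hr =>
    (hv r hr).continuousAt.continuousWithinAt
  have hEd : ∀ r ∈ Set.Ico ρ 1, HasDerivAt (fun r : ℝ => (1 - r) * ‖v r‖ ^ 2)
      (-1 * ‖v r‖ ^ 2 + (1 - r) * (2 * inner ℝ (v r) (S r + v r ^ 2 / 2))) r := fun r hr =>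
    ((hasDerivAt_id r).const_sub 1).fun_mul (hv r hr).norm_sq
  have hle : ∀ r ∈ Set.Ico ρ 1,
      -1 * ‖v r‖ ^ 2 + (1 - r) * (2 * inner ℝ (v r) (S r + v r ^ 2 / 2)) ≤
        -(1 / 2 * ‖v r‖ ^ 2) + 4 * ((1 - r) ^ 2 * ‖S r‖ ^ 2) := by
    intro r hr
    have h1 : 0 < 1 - r := by linarith [hr.2]
    have h2 : inner ℝ (v r) (S r + v r ^ 2 / 2) ≤ ‖v r‖ * (‖S r‖ + ‖v r‖ ^ 2 / 2) := by
      refine (real_inner_le_norm _ _).trans ?_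
      gcongr
      refine (norm_add_le _ _).trans_eq ?_
      simp
    have h3 : (1 - r) * (2 * inner ℝ (v r) (S r + v r ^ 2 / 2)) ≤
        (1 - r) * (2 * (‖v r‖ * (‖S r‖ + ‖v r‖ ^ 2 / 2))) := by gcongr
    have h4 : (1 - r) * ‖v r‖ * ‖v r‖ ^ 2 ≤ 1 / 4 * ‖v r‖ ^ 2 := by
      gcongr; exact hsmall r hr
    nlinarith [sq_nonneg (‖v r‖ / 2 - 2 * ((1 - r) * ‖S r‖))]
  have hfin : ∀ R ∈ Set.Ioo ρ 1, ∫⁻ r in Set.Ioc ρ R, ENNReal.ofReal (‖v r‖ ^ 2) ≤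
      ENNReal.ofReal (2 * ((1 - ρ) * ‖v ρ‖ ^ 2)) +
        8 * ∫⁻ r in Set.Ioo ρ 1, ENNReal.ofReal ((1 - r) ^ 2 * ‖S r‖ ^ 2) := by
    intro R hR
    have hsub : Set.Icc ρ R ⊆ Set.Ico ρ 1 := fun r hr => ⟨hr.1, hr.2.trans_lt hR.2⟩
    have hc1 : ContinuousOn (fun r => ‖v r‖ ^ 2) (Set.Icc ρ R) := (hvc.mono hsub).norm.pow 2
    have hc2 : ContinuousOn (fun r : ℝ => (1 - r) ^ 2 * ‖S r‖ ^ 2) (Set.Icc ρ R) :=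
      (by fun_prop : Continuous fun r : ℝ => (1 - r) ^ 2).continuousOn.mul
        ((hS.mono hsub).norm.pow 2)
    have hi1 := hc1.integrableOn_Icc (μ := volume)
    have hi2 := hc2.integrableOn_Icc (μ := volume)
    have hcE : ContinuousOn (fun r : ℝ => (1 - r) * ‖v r‖ ^ 2) (Set.Icc ρ R) := fun r hr =>
      (hEd r (hsub hr)).continuousAt.continuousWithinAt
    have h1 := intervalIntegral.sub_le_integral_of_hasDeriv_right_of_le hR.1.le hcE
      (fun r hr => (hEd r (hsub (Set.Ioo_subset_Icc_self hr))).hasDerivWithinAt)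
      ((hi1.const_mul (1 / 2)).neg.add (hi2.const_mul 4))
      (fun r hr => hle r (hsub (Set.Ioo_subset_Icc_self hr)))
    have hi1' := hi1.mono_set Set.Ioc_subset_Icc_self
    have hi2' := hi2.mono_set Set.Ioc_subset_Icc_self
    have h2 : ∫ r in Set.Ioc ρ R, ‖v r‖ ^ 2 ≤ 2 * ((1 - ρ) * ‖v ρ‖ ^ 2) +
        8 * ∫ r in Set.Ioc ρ R, (1 - r) ^ 2 * ‖S r‖ ^ 2 := by
      rw [intervalIntegral.integral_of_le hR.1.le] at h1
      have h4 : ∫ r in Set.Ioc ρ R, (-(1 / 2 * ‖v r‖ ^ 2) + 4 * ((1 - r) ^ 2 * ‖S r‖ ^ 2)) =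
          -(1 / 2 * ∫ r in Set.Ioc ρ R, ‖v r‖ ^ 2) +
            4 * ∫ r in Set.Ioc ρ R, (1 - r) ^ 2 * ‖S r‖ ^ 2 := by
        rw [← integral_const_mul, ← integral_const_mul, ← integral_neg]
        exact integral_add (hi1'.const_mul (1 / 2)).neg (hi2'.const_mul 4)
      simp only [Pi.add_apply, Pi.neg_apply] at h1
      rw [h4] at h1
      have h3 : 0 ≤ (1 - R) * ‖v R‖ ^ 2 := mul_nonneg (by linarith [hR.2]) (by positivity)
      linarith
    rw [← ofReal_integral_eq_lintegral_ofReal hi1' (.of_forall fun r => by positivity)]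
    refine (ENNReal.ofReal_le_ofReal h2).trans ?_
    refine ENNReal.ofReal_add_le.trans ?_
    gcongr
    rw [ENNReal.ofReal_mul (by norm_num),
      ofReal_integral_eq_lintegral_ofReal hi2' (.of_forall fun r => by positivity)]
    simp only [ENNReal.ofReal_ofNat]
    gcongr 8 * ?_
    exact lintegral_mono_set fun r hr => ⟨hr.1, hr.2.trans_lt hR.2⟩
  obtain ⟨u, hu, hu1, hu2⟩ := exists_seq_strictMono_tendsto' hρ
  have hU : Set.Ioo ρ 1 ⊆ ⋃ n, Set.Ioc ρ (u n) := by
    intro r hr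
    obtain ⟨n, hn⟩ := (hu2.eventually_const_lt hr.2).exists
    exact Set.mem_iUnion.mpr ⟨n, hr.1, hn.le⟩
  refine (lintegral_mono_set hU).trans ?_
  rw [setLIntegral_iUnion_of_directed]
  · exact iSup_le fun n => hfin _ (hu1 n)
  · exact (monotone_nat_of_le_succ fun n =>
      Set.Ioc_subset_Ioc_right (hu.monotone n.le_succ)).directed_le

/-- If `(1 - ‖z‖) ‖φ z‖` is small near the boundary and the Schwarzian built from `φ` has finite
weighted norm, then `φ` is square integrable. -/
theorem lintegral_preSchwarzian_lt_top {φ : ℂ → ℂ} (hφm : Measurable φ)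
    (hφ : DifferentiableOn ℂ φ (ball 0 1)) {ρ : ℝ} (hρ1 : ρ < 1)
    (hsmall : ∀ z : ℂ, ρ < ‖z‖ → ‖z‖ < 1 → (1 - ‖z‖) * ‖φ z‖ ≤ 1 / 4)
    (h : ∫⁻ z in ball (0 : ℂ) 1,
      ENNReal.ofReal ((1 - ‖z‖ ^ 2) ^ 2 * ‖deriv φ z - φ z ^ 2 / 2‖ ^ 2) < ⊤) :
    ∫⁻ z in ball (0 : ℂ) 1, ENNReal.ofReal (‖φ z‖ ^ 2) < ⊤ := by
  obtain ⟨ρ', hρ'2, hρρ', hρ'1⟩ : ∃ ρ' : ℝ, 1 / 2 ≤ ρ' ∧ ρ < ρ' ∧ ρ' < 1 := by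
    refine ⟨max (1 / 2) ((1 + ρ) / 2), le_max_left _ _, ?_, max_lt (by norm_num) (by linarith)⟩
    linarith [le_max_right (1 / 2) ((1 + ρ) / 2)]
  have hdm : Measurable (deriv φ) := measurable_deriv φ
  rw [lintegral_ball_zero_eq_polar (by fun_prop)] at h ⊢
  obtain ⟨K, hK⟩ : ∃ K, ∀ z ∈ closedBall (0 : ℂ) ρ', ‖‖φ z‖ ^ 2‖ ≤ K :=
    (isCompact_closedBall _ _).exists_bound_of_continuousOn
      ((hφ.continuousOn.mono (closedBall_subset_ball hρ'1)).norm.pow 2)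
  have hK' : ∀ z : ℂ, ‖z‖ ≤ ρ' → ‖φ z‖ ^ 2 ≤ K := fun z hz => by
    simpa using hK z (by simpa using hz)
  have hSc : ContinuousOn (fun z => deriv φ z - φ z ^ 2 / 2) (ball 0 1) :=
    (hφ.deriv isOpen_ball).continuousOn.sub ((hφ.continuousOn.pow 2).div_const 2)
  have hray : ∀ θ : ℝ, ∫⁻ r in Set.Ioo 0 1,
      ENNReal.ofReal r * ENNReal.ofReal (‖φ (circleMap 0 r θ)‖ ^ 2) ≤
      (ENNReal.ofReal K + ENNReal.ofReal (2 * K)) + 16 * ∫⁻ r in Set.Ioo 0 1, ENNReal.ofReal r *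
        ENNReal.ofReal ((1 - ‖circleMap 0 r θ‖ ^ 2) ^ 2 *
          ‖deriv φ (circleMap 0 r θ) - φ (circleMap 0 r θ) ^ 2 / 2‖ ^ 2) := by
    intro θ
    obtain ⟨ω, hω, hcm⟩ : ∃ ω : ℂ, ‖ω‖ = 1 ∧ ∀ r : ℝ, circleMap 0 r θ = r * ω :=
      ⟨Complex.exp (θ * Complex.I), Complex.norm_exp_ofReal_mul_I θ, fun r => circleMap_zero r θ⟩
    simp only [hcm]
    have hnorm : ∀ r : ℝ, 0 ≤ r → ‖(r : ℂ) * ω‖ = r := fun r hr => by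
      simp [hω, abs_of_nonneg hr]
    have hsub : ∀ r ∈ Set.Ico ρ' 1, 0 ≤ r := fun r hr => by linarith [hr.1]
    have hH := lintegral_riccati_le (v := fun r : ℝ => ω * φ (r * ω))
      (S := fun r : ℝ => ω ^ 2 * (deriv φ (r * ω) - φ (r * ω) ^ 2 / 2))
      (fun r hr => hasDerivAt_ray hφ hω (hsub r hr) hr.2)
      (continuousOn_const.mul (hSc.comp
        (by fun_prop : Continuous fun r : ℝ => (r : ℂ) * ω).continuousOn
        fun r hr => by rw [mem_ball_zero_iff, hnorm r (hsub r hr)]; exact hr.2))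
      (fun r hr => by
        have h1 := hsmall (r * ω) (by rw [hnorm r (hsub r hr)]; linarith [hr.1])
          (by rw [hnorm r (hsub r hr)]; exact hr.2)
        rw [hnorm r (hsub r hr)] at h1
        simpa [hω] using h1) hρ'1
    simp only [norm_mul, norm_pow, hω, one_mul, one_pow] at hH
    have h1 : ∫⁻ r in Set.Ioc 0 ρ', ENNReal.ofReal r * ENNReal.ofReal (‖φ (r * ω)‖ ^ 2) ≤
        ENNReal.ofReal K := by
      calc ∫⁻ r in Set.Ioc 0 ρ', ENNReal.ofReal r * ENNReal.ofReal (‖φ (r * ω)‖ ^ 2)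
          ≤ ∫⁻ r in Set.Ioc 0 ρ', ENNReal.ofReal K := by
            refine setLIntegral_mono measurable_const fun r hr => ?_
            refine (mul_le_of_le_one_left' ?_).trans
              (ENNReal.ofReal_le_ofReal (hK' _ (by rw [hnorm r hr.1.le]; exact hr.2)))
            exact ENNReal.ofReal_le_one.mpr (hr.2.trans hρ'1.le)
        _ ≤ ENNReal.ofReal K := by
            rw [setLIntegral_const, Real.volume_Ioc]
            exact mul_le_of_le_one_right' (ENNReal.ofReal_le_one.mpr (by linarith))
    have h2 : ∫⁻ r in Set.Ioo ρ' 1, ENNReal.ofReal r * ENNReal.ofReal (‖φ (r * ω)‖ ^ 2) ≤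
        ∫⁻ r in Set.Ioo ρ' 1, ENNReal.ofReal (‖φ (r * ω)‖ ^ 2) :=
      setLIntegral_mono (by fun_prop) fun r hr =>
        mul_le_of_le_one_left' (ENNReal.ofReal_le_one.mpr hr.2.le)
    have h3 : ENNReal.ofReal (2 * ((1 - ρ') * ‖φ (ρ' * ω)‖ ^ 2)) ≤ ENNReal.ofReal (2 * K) := by
      refine ENNReal.ofReal_le_ofReal ?_
      have := hK' (ρ' * ω) (hnorm ρ' (by linarith)).le
      nlinarith [sq_nonneg ‖φ (ρ' * ω)‖]
    have h4 : ∫⁻ r in Set.Ioo ρ' 1, ENNReal.ofReal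
          ((1 - r) ^ 2 * ‖deriv φ (r * ω) - φ (r * ω) ^ 2 / 2‖ ^ 2) ≤
        2 * ∫⁻ r in Set.Ioo 0 1, ENNReal.ofReal r * ENNReal.ofReal ((1 - ‖(r : ℂ) * ω‖ ^ 2) ^ 2 *
          ‖deriv φ (r * ω) - φ (r * ω) ^ 2 / 2‖ ^ 2) := by
      rw [← lintegral_const_mul' _ _ (by simp)]
      refine (setLIntegral_mono (by fun_prop) fun r hr => ?_).trans
        (lintegral_mono_set (Set.Ioo_subset_Ioo_left (by linarith : (0 : ℝ) ≤ ρ')))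
      have hr0 : 0 ≤ r := by linarith [hr.1]
      have hr1 := hr.2
      rw [hnorm r hr0, ← ENNReal.ofReal_mul hr0, show (2 : ENNReal) = ENNReal.ofReal 2 by simp,
        ← ENNReal.ofReal_mul (by norm_num)]
      refine ENNReal.ofReal_le_ofReal ?_
      have h5 : 1 - r ≤ 1 - r ^ 2 := by nlinarith
      have h6 : (1 - r) ^ 2 ≤ (1 - r ^ 2) ^ 2 := by gcongr
      have h7 : (1 - r) ^ 2 ≤ 2 * r * (1 - r ^ 2) ^ 2 := by
        have : 1 ≤ 2 * r := by linarith [hr.1]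
        nlinarith [sq_nonneg (1 - r ^ 2)]
      calc _ ≤ 2 * r * (1 - r ^ 2) ^ 2 * ‖deriv φ (r * ω) - φ (r * ω) ^ 2 / 2‖ ^ 2 := by gcongr
        _ = _ := by ring
    have hcov : Set.Ioo (0 : ℝ) 1 ⊆ Set.Ioc 0 ρ' ∪ Set.Ioo ρ' 1 := fun r hr =>
      (le_or_gt r ρ').imp (fun h => ⟨hr.1, h⟩) fun h => ⟨h, hr.2⟩
    refine (lintegral_mono_set hcov).trans ((lintegral_union_le _ _ _).trans ?_)
    refine (add_le_add h1 (h2.trans (hH.trans (add_le_add h3 (mul_le_mul_right h4 8))))).trans_eq ?_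
    rw [← mul_assoc, ← add_assoc]
    norm_num
  refine (lintegral_mono fun θ => hray θ).trans_lt ?_
  rw [lintegral_add_left measurable_const, lintegral_const_mul' _ _ (by simp), setLIntegral_const]
  refine ENNReal.add_lt_top.mpr ⟨ENNReal.mul_lt_top
    (ENNReal.add_lt_top.mpr ⟨ENNReal.ofReal_lt_top, ENNReal.ofReal_lt_top⟩) (by simp), ?_⟩
  exact ENNReal.mul_lt_top (by simp) h

/-- A bounded holomorphic function on the disk is a Bloch function. -/
theorem exists_one_sub_norm_mul_norm_deriv_le {f : ℂ → ℂ}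
    (hf : DifferentiableOn ℂ f (ball (0 : ℂ) 1))
    (hbdd : Bornology.IsBounded (f '' ball (0 : ℂ) 1)) :
    ∃ M, ∀ z ∈ ball (0 : ℂ) 1, (1 - ‖z‖) * ‖deriv f z‖ ≤ M := by
  obtain ⟨C, hC⟩ := hbdd.exists_norm_le
  refine ⟨2 * C, fun z hz => ?_⟩
  have hz1 : ‖z‖ < 1 := by simpa using hz
  have hR : 0 < (1 - ‖z‖) / 2 := by linarith
  have hsub : closedBall z ((1 - ‖z‖) / 2) ⊆ ball 0 1 := by
    refine closedBall_subset_ball' ?_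
    rw [dist_zero_right]; linarith
  have h1 := Complex.norm_deriv_le_of_forall_mem_sphere_norm_le hR
    (hf.diffContOnCl_ball hsub) fun w hw =>
      hC _ (Set.mem_image_of_mem f (hsub (sphere_subset_closedBall hw)))
  rw [le_div_iff₀ hR] at h1
  linarith

/-- The Schwarzian is `φ' - φ² / 2`, where `φ` is the pre-Schwarzian. -/
theorem schwarzian_eq_deriv_preSchwarzian {f : ℂ → ℂ} {U : Set ℂ} (hU : IsOpen U)
    (hf : DifferentiableOn ℂ f U) {z : ℂ} (hz : z ∈ U) (h0 : deriv f z ≠ 0) :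
    schwarzian f z = deriv (fun z => deriv (deriv f) z / deriv f z) z -
      (deriv (deriv f) z / deriv f z) ^ 2 / 2 := by
  have h1 := hf.deriv hU
  have h2 := h1.deriv hU
  rw [schwarzian, deriv_fun_div (h2.differentiableAt (hU.mem_nhds hz))
    (h1.differentiableAt (hU.mem_nhds hz)) h0]
  field_simp
  ring

theorem wp_schwarzian_iff_preSchwarzian (f : ℂ → ℂ)
    (hf : DifferentiableOn ℂ f (ball (0 : ℂ) 1))
    (hinj : Set.InjOn f (ball (0 : ℂ) 1))
    (hbdd : Bornology.IsBounded (f '' ball (0 : ℂ) 1)) :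
    (∫⁻ z in ball (0 : ℂ) 1,
        ENNReal.ofReal ((1 - ‖z‖ ^ 2) ^ 2 * ‖schwarzian f z‖ ^ 2)) < ⊤ ↔
    (∫⁻ z in ball (0 : ℂ) 1,
        ENNReal.ofReal (‖deriv (deriv f) z / deriv f z‖ ^ 2)) < ⊤ := by
  have hf0 : ∀ z ∈ ball (0 : ℂ) 1, deriv f z ≠ 0 := fun z hz =>
    deriv_ne_zero_of_injOn isOpen_ball hf hinj hz
  obtain ⟨φ, hφdef⟩ : ∃ φ : ℂ → ℂ, φ = fun z => deriv (deriv f) z / deriv f z := ⟨_, rfl⟩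
  have hφm : Measurable φ := by
    rw [hφdef]
    exact (measurable_deriv _).div (measurable_deriv _)
  have hφ : DifferentiableOn ℂ φ (ball 0 1) := by
    rw [hφdef]
    exact ((hf.deriv isOpen_ball).deriv isOpen_ball).div (hf.deriv isOpen_ball) hf0
  have hS : ∀ z ∈ ball (0 : ℂ) 1, schwarzian f z = deriv φ z - φ z ^ 2 / 2 := fun z hz => by
    rw [hφdef]
    exact schwarzian_eq_deriv_preSchwarzian isOpen_ball hf hz (hf0 z hz)
  have hSI : ∫⁻ z in ball (0 : ℂ) 1,
      ENNReal.ofReal ((1 - ‖z‖ ^ 2) ^ 2 * ‖schwarzian f z‖ ^ 2) = ∫⁻ z in ball (0 : ℂ) 1,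
      ENNReal.ofReal ((1 - ‖z‖ ^ 2) ^ 2 * ‖deriv φ z - φ z ^ 2 / 2‖ ^ 2) :=
    setLIntegral_congr_fun measurableSet_ball fun z hz => by rw [hS z hz]
  have hφI : ∫⁻ z in ball (0 : ℂ) 1, ENNReal.ofReal (‖deriv (deriv f) z / deriv f z‖ ^ 2) =
      ∫⁻ z in ball (0 : ℂ) 1, ENNReal.ofReal (‖φ z‖ ^ 2) := by rw [hφdef]
  rw [hSI, hφI]
  refine ⟨fun h => ?_, lintegral_schwarzian_lt_top_of_preSchwarzian hφm hφ⟩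
  obtain ⟨M, hM⟩ := exists_one_sub_norm_mul_norm_deriv_le hf hbdd
  have hgm : Measurable fun z => deriv φ z - φ z ^ 2 / 2 :=
    (measurable_deriv φ).sub ((hφm.pow_const 2).div_const 2)
  have hg : DifferentiableOn ℂ (fun z => deriv φ z - φ z ^ 2 / 2) (ball 0 1) :=
    (hφ.deriv isOpen_ball).sub ((hφ.pow 2).div_const 2)
  obtain ⟨ρ, hρ, hsmall⟩ := exists_preSchwarzian_le_of_schwarzian_small hf hf0 hM hφdef hφ
    (fun ε hε => exists_weighted_norm_le_of_lintegral_lt_top hgm hg h hε)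
    (show (0 : ℝ) < 1 / 4 by norm_num)
  exact lintegral_preSchwarzian_lt_top hφm hφ hρ hsmall h
end

section
/- Let φ : S¹ → S¹ be a homeomorphism of the unit circle. The following are equivalent: (i) there is a constant C > 0 such that E(f ∘ φ) ≤ C·E(f) for every continuous f : S¹ → ℂ, i.e., composition by φ is bounded on the homogeneous Sobolev space Ḣ^{1/2}(S¹); (ii) there is a constant k ≥ 1 such that 1/k ≤ |φ(e^{i(α+β)}) − φ(e^{iα})| / |φ(e^{iα}) − φ(e^{i(α−β)})| ≤ k for every α ∈ ℝ and every β ∈ ℝ that is not an integer multiple of 2π, i.e., φ is quasisymmetric (Vodopyanov; Nag–Sullivan). -/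
/-!
STATEMENT 3 (Vodopyanov; Nag–Sullivan): a homeomorphism `φ` of the unit circle induces a
bounded composition operator on the homogeneous Sobolev space `Ḣ^{1/2}(S¹)` (measured via
the Douglas energy) if and only if `φ` is quasisymmetric.
-/

open MeasureTheory Metric Real

/-- Arclength measure on the unit circle, as the pushforward of Lebesgue measure on
`[0, 2π)` under `θ ↦ e^{iθ}`. -/
noncomputable def circleMeasure : Measure ℂ :=
  Measure.map (fun θ : ℝ => Complex.exp (θ * Complex.I))
    (volume.restrict (Set.Ico 0 (2 * π)))

/-- The Douglas energy `E(u) = ∬_{S¹×S¹} |u(x)−u(y)|²/|x−y|² ds(x) ds(y)`, whose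
finiteness is the finiteness of the homogeneous `Ḣ^{1/2}(S¹)` seminorm of `u`. -/
noncomputable def douglasEnergy (u : ℂ → ℂ) : ENNReal :=
  ∫⁻ x, ∫⁻ y, ENNReal.ofReal (‖u x - u y‖ ^ 2 / ‖x - y‖ ^ 2)
    ∂circleMeasure ∂circleMeasure

/-- A continuous function with values in `2πℤ` is constant. -/
lemma exists_int_forall_eq_of_continuous {f : ℝ → ℝ} (hf : Continuous f)
    (h : ∀ t, ∃ n : ℤ, f t = n * (2 * π)) : ∃ n : ℤ, ∀ t, f t = n * (2 * π) := by
  choose n hn using h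
  have hc : Continuous n := by
    rw [Int.isClosedEmbedding_coe_real.isEmbedding.continuous_iff]
    have : ((↑) : ℤ → ℝ) ∘ n = fun t => f t / (2 * π) := by
      ext t
      simp only [Function.comp_apply, hn t]
      field_simp
    rw [this]
    fun_prop
  exact ⟨n 0, fun t => by rw [hn t, PreconnectedSpace.constant inferInstance hc (x := t) (y := 0)]⟩

lemma exists_int_of_circleExp_eq {s t : ℝ} (h : Circle.exp s = Circle.exp t) :
    ∃ n : ℤ, s - t = n * (2 * π) := by
  obtain ⟨n, hn⟩ := Circle.exp_eq_exp.1 h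
  exact ⟨n, by rw [hn]; ring⟩

/-- Continuous self-maps of the circle lift to the line, with a degree. -/
lemma exists_lift_circle {Φ : Circle → Circle} (hΦ : Continuous Φ) :
    ∃ (H : ℝ → ℝ) (d : ℤ), Continuous H ∧ (∀ t, Circle.exp (H t) = Φ (Circle.exp t)) ∧
      ∀ (n : ℤ) t, H (t + n * (2 * π)) = H t + n * d * (2 * π) := by
  obtain ⟨e₀, he₀⟩ := Circle.exp_surjective (Φ (Circle.exp 0))
  obtain ⟨F, ⟨-, hF⟩, -⟩ := Circle.isCoveringMap_exp.existsUnique_continuousMap_lifts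
    (⟨fun t => Φ (Circle.exp t), by fun_prop⟩ : C(ℝ, Circle)) 0 e₀ he₀
  have hF' : ∀ t, Circle.exp (F t) = Φ (Circle.exp t) := fun t => congrFun hF t
  obtain ⟨d, hd⟩ := exists_int_forall_eq_of_continuous
    (f := fun t => F (t + 2 * π) - F t) (by fun_prop) (fun t => exists_int_of_circleExp_eq (by
      rw [hF', hF', Circle.exp_add, Circle.exp_two_pi, mul_one]))
  refine ⟨F, d, F.continuous, hF', fun n => ?_⟩
  induction n with
  | zero => simp
  | succ k ih =>
    intro t
    have h1 := hd (t + k * (2 * π))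
    have h2 := ih t
    push_cast at *
    rw [show t + (k + 1) * (2 * π) = t + k * (2 * π) + 2 * π by ring]
    linarith
  | pred k ih =>
    intro t
    have h1 := hd (t + (-(k : ℝ) - 1) * (2 * π))
    have h2 := ih t
    push_cast at *
    rw [show t + (-(k : ℝ) - 1) * (2 * π) + 2 * π = t + -k * (2 * π) by ring] at h1
    linarith

lemma coe_circleExp_eq (t : ℝ) : (Circle.exp t : ℂ) = Complex.exp (t * Complex.I) :=
  Circle.coe_exp t

/-- A homeomorphism of the circle lifts to a homeomorphism of the line, after a reflection if it
reverses the orientation. -/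
lemma exists_strictMono_lift (φ : ℂ → ℂ)
    (hbij : Set.BijOn φ (sphere (0 : ℂ) 1) (sphere (0 : ℂ) 1))
    (hcont : ContinuousOn φ (sphere (0 : ℂ) 1)) :
    ∃ H : ℝ → ℝ, Continuous H ∧ StrictMono H ∧ (∀ t, H (t + 2 * π) = H t + 2 * π) ∧
      ((∀ t : ℝ, φ (Complex.exp (t * Complex.I)) = Complex.exp (H t * Complex.I)) ∨
        ∀ t : ℝ, φ (Complex.exp (t * Complex.I)) = Complex.exp ((-H t : ℝ) * Complex.I)) := by
  have hmem : ∀ z : Circle, (z : ℂ) ∈ sphere (0 : ℂ) 1 := fun z => by simp [Circle.norm_coe]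
  let Φ : Circle → Circle := fun z => ⟨φ z, by
    have := hbij.mapsTo (hmem z)
    simpa [Submonoid.unitSphere] using this⟩
  have hΦc : Continuous Φ := by
    refine Continuous.subtype_mk ?_ _
    exact hcont.comp_continuous continuous_subtype_val hmem
  have hΦb : Function.Bijective Φ := by
    constructor
    · intro z w h
      exact Subtype.ext (hbij.injOn (hmem z) (hmem w) (congrArg Subtype.val h))
    · intro w
      obtain ⟨z, hz, hzw⟩ := hbij.surjOn (hmem w)
      exact ⟨⟨z, by simpa [Submonoid.unitSphere] using hz⟩, Subtype.ext hzw⟩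
  let e := Continuous.homeoOfEquivCompactToT2 (f := Equiv.ofBijective Φ hΦb) hΦc
  obtain ⟨H, d, hH, hHe, hHd⟩ := exists_lift_circle hΦc
  obtain ⟨K, d', hK, hKe, hKd⟩ := exists_lift_circle e.symm.continuous
  obtain ⟨m, hm⟩ := exists_int_forall_eq_of_continuous (f := fun t => K (H t) - t) (by fun_prop)
    (fun t => exists_int_of_circleExp_eq (by
      rw [hKe, hHe]
      exact e.symm_apply_apply _))
  have hinj : Function.Injective H := fun s t h => by
    have h1 := hm s
    have h2 := hm t
    simp only [h] at h1 h2
    linarith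
  have hdd : d * d' = 1 := by
    have h1 := hm (0 + (1 : ℤ) * (2 * π))
    have h2 := hm 0
    have h3 := hHd 1 0
    have h4 := hKd (1 * d) (H 0)
    push_cast at *
    simp only [h3, h4] at h1
    have : ((d : ℝ) * d' - 1) * (2 * π) = 0 := by linarith
    have h5 : (d : ℝ) * d' - 1 = 0 := (mul_eq_zero.1 this).resolve_right (by positivity)
    have h6 : ((d * d' : ℤ) : ℝ) = (1 : ℤ) := by push_cast; linarith
    exact_mod_cast h6
  have hφ : ∀ t : ℝ, φ (Complex.exp (t * Complex.I)) = Complex.exp (H t * Complex.I) := fun t => by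
    have := congrArg Subtype.val (hHe t)
    rw [← coe_circleExp_eq, ← coe_circleExp_eq]
    exact this.symm
  have hH1 : ∀ t, H (t + 2 * π) = H t + d * (2 * π) := fun t => by
    have := hHd 1 t
    push_cast at this
    simpa using this
  rcases hH.strictMono_of_inj hinj with hmono | hanti
  · refine ⟨H, hH, hmono, fun t => ?_, Or.inl hφ⟩
    have hlt : H 0 < H (0 + 2 * π) := hmono (by positivity)
    rcases Int.eq_one_or_neg_one_of_mul_eq_one hdd with rfl | rfl
    · simpa using hH1 t
    · rw [hH1] at hlt
      push_cast at hlt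
      linarith [pi_pos]
  · refine ⟨fun t => -H t, hH.neg, fun s t h => neg_lt_neg (hanti h), fun t => ?_, Or.inr ?_⟩
    · have hlt : H (0 + 2 * π) < H 0 := hanti (by positivity)
      rcases Int.eq_one_or_neg_one_of_mul_eq_one hdd with rfl | rfl
      · rw [hH1] at hlt
        push_cast at hlt
        linarith [pi_pos]
      · simp only [hH1]
        push_cast
        ring
    · simpa using hφ

/-- Chord length in terms of angles. -/
lemma norm_exp_sub_exp (s t : ℝ) :
    ‖Complex.exp (s * Complex.I) - Complex.exp (t * Complex.I)‖ = 2 * |sin ((s - t) / 2)| := by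
  have h : Complex.exp (s * Complex.I) - Complex.exp (t * Complex.I) =
      Complex.exp (t * Complex.I) * (Complex.exp (Complex.I * ((s - t : ℝ) : ℂ)) - 1) := by
    rw [mul_sub, ← Complex.exp_add, mul_one]
    congr 2
    push_cast
    ring
  rw [h, norm_mul, Complex.norm_exp_ofReal_mul_I, one_mul, Complex.norm_exp_I_mul_ofReal_sub_one,
    norm_mul]
  simp

lemma lintegral_circleMeasure (g : ℂ → ENNReal) :
    ∫⁻ x, g x ∂circleMeasure =
      ∫⁻ θ in Set.Ico 0 (2 * π), g (Complex.exp ((θ : ℝ) * Complex.I)) := by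
  have hinj : Set.InjOn (fun θ : ℝ => Complex.exp (θ * Complex.I)) (Set.Ico 0 (2 * π)) := by
    intro s hs t ht h
    have h' : Circle.exp s = Circle.exp t := Subtype.ext (by simpa [coe_circleExp_eq] using h)
    obtain ⟨n, hn⟩ := exists_int_of_circleExp_eq h'
    have h1 : ((n : ℤ) : ℝ) < (1 : ℤ) := by
      have : (n : ℝ) * (2 * π) < 1 * (2 * π) := by rw [← hn]; linarith [hs.2, ht.1]
      simpa using lt_of_mul_lt_mul_right this (by positivity)
    have h2 : ((-1 : ℤ) : ℝ) < n := by
      have : (-1 : ℝ) * (2 * π) < n * (2 * π) := by rw [← hn]; linarith [ht.2, hs.1]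
      simpa using lt_of_mul_lt_mul_right this (by positivity)
    have h3 : n = 0 := by
      have := Int.cast_lt.1 h1
      have := Int.cast_lt.1 h2
      omega
    rw [h3] at hn
    simp at hn
    linarith
  have hemb := ContinuousOn.measurableEmbedding (f := fun θ : ℝ => Complex.exp (θ * Complex.I))
    (measurableSet_Ico (a := (0 : ℝ)) (b := 2 * π)) (by fun_prop) hinj
  have hmap : circleMeasure = Measure.map
      ((Set.Ico 0 (2 * π)).domRestrict (fun θ : ℝ => Complex.exp (θ * Complex.I)))
      (Measure.comap ((↑) : Set.Ico (0 : ℝ) (2 * π) → ℝ) volume) := by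
    rw [circleMeasure, ← map_comap_subtype_coe measurableSet_Ico, Measure.map_map (by fun_prop)
      measurable_subtype_coe]
    rfl
  rw [hmap, hemb.lintegral_map, ← map_comap_subtype_coe measurableSet_Ico,
    (MeasurableEmbedding.subtype_coe measurableSet_Ico).lintegral_map]
  rfl

/-- The Douglas energy of a function of the angle. -/
noncomputable def angularEnergy (p : ℝ → ℂ) : ENNReal :=
  ∫⁻ s in Set.Ico 0 (2 * π), ∫⁻ t in Set.Ico 0 (2 * π),
    ENNReal.ofReal (‖p s - p t‖ ^ 2 /
      ‖Complex.exp ((s : ℝ) * Complex.I) - Complex.exp ((t : ℝ) * Complex.I)‖ ^ 2)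

lemma douglasEnergy_eq_angularEnergy (u : ℂ → ℂ) :
    douglasEnergy u = angularEnergy (fun t => u (Complex.exp (t * Complex.I))) := by
  simp only [douglasEnergy, angularEnergy, lintegral_circleMeasure]

lemma exp_periodic : Function.Periodic (fun t : ℝ => Complex.exp (t * Complex.I)) (2 * π) := by
  intro t
  have := Complex.exp_periodic (t * Complex.I)
  push_cast
  rw [add_mul]
  exact this

lemma setLIntegral_Ico_add_two_pi {p : ℝ → ENNReal} (hp : Function.Periodic p (2 * π)) (a : ℝ) :
    ∫⁻ t in Set.Ico a (a + 2 * π), p t = ∫⁻ t in Set.Ico 0 (2 * π), p t := by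
  have h := (isAddFundamentalDomain_Ioc two_pi_pos a).setLIntegral_eq
    (isAddFundamentalDomain_Ioc two_pi_pos 0) p (by
      rintro ⟨g, hg⟩ x
      obtain ⟨n, rfl⟩ := AddSubgroup.mem_zmultiples_iff.1 hg
      change p (n • (2 * π) + x) = p x
      rw [add_comm]
      exact hp.zsmul n x)
  rw [setLIntegral_congr Ico_ae_eq_Ioc, h, zero_add, setLIntegral_congr Ico_ae_eq_Ioc]

lemma setLIntegral_Ico_add_six_pi {p : ℝ → ENNReal} (hp : Function.Periodic p (2 * π)) (a : ℝ) :
    ∫⁻ t in Set.Ico a (a + 6 * π), p t = 3 * ∫⁻ t in Set.Ico 0 (2 * π), p t := by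
  have hpi := pi_pos
  rw [show a + 6 * π = a + 2 * π + 2 * π + 2 * π by ring,
    ← Set.Ico_union_Ico_eq_Ico (show a ≤ a + 2 * π by linarith)
      (show a + 2 * π ≤ a + 2 * π + 2 * π + 2 * π by linarith),
    lintegral_union measurableSet_Ico Set.Ico_disjoint_Ico_same,
    ← Set.Ico_union_Ico_eq_Ico (show a + 2 * π ≤ a + 2 * π + 2 * π by linarith)
      (show a + 2 * π + 2 * π ≤ a + 2 * π + 2 * π + 2 * π by linarith),
    lintegral_union measurableSet_Ico Set.Ico_disjoint_Ico_same]
  simp only [setLIntegral_Ico_add_two_pi hp]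
  ring

lemma setLIntegral_Ico_neg {p : ℝ → ENNReal} (hp : Function.Periodic p (2 * π)) :
    ∫⁻ t in Set.Ico 0 (2 * π), p (-t) = ∫⁻ t in Set.Ico 0 (2 * π), p t := by
  have h := (Measure.measurePreserving_neg (volume : Measure ℝ)).setLIntegral_comp_preimage_emb
    (MeasurableEquiv.neg ℝ).measurableEmbedding p (Set.Ioc (-(2 * π)) 0)
  have hs : (Neg.neg : ℝ → ℝ) ⁻¹' Set.Ioc (-(2 * π)) 0 = Set.Ico 0 (2 * π) := by
    ext x
    simp only [Set.mem_preimage, Set.mem_Ioc, Set.mem_Ico]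
    constructor <;> rintro ⟨h1, h2⟩ <;> constructor <;> linarith
  rw [hs] at h
  rw [h, ← setLIntegral_congr Ico_ae_eq_Ioc, ← setLIntegral_Ico_add_two_pi hp (-(2 * π))]
  simp

lemma setLIntegral_Ico_comp_add (p : ℝ → ENNReal) (a b c : ℝ) :
    ∫⁻ t in Set.Ico a b, p (c + t) = ∫⁻ t in Set.Ico (c + a) (c + b), p t := by
  have h := (measurePreserving_add_left (volume : Measure ℝ) c).setLIntegral_comp_preimage_emb
    (MeasurableEquiv.addLeft c).measurableEmbedding p (Set.Ico (c + a) (c + b))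
  rw [← h]
  congr 2
  ext x
  simp

lemma angularEnergy_comp_neg {p : ℝ → ℂ} (hp : Function.Periodic p (2 * π)) :
    angularEnergy (fun t => p (-t)) = angularEnergy p := by
  have hchord : ∀ s t : ℝ, ‖Complex.exp (s * Complex.I) - Complex.exp (t * Complex.I)‖ =
      ‖Complex.exp ((-s : ℝ) * Complex.I) - Complex.exp ((-t : ℝ) * Complex.I)‖ := fun s t => by
    rw [norm_exp_sub_exp, norm_exp_sub_exp, ← abs_neg, ← sin_neg]
    congr 3
    ring
  have hk : ∀ s : ℝ, Function.Periodic (fun t : ℝ => ENNReal.ofReal (‖p s - p t‖ ^ 2 /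
      ‖Complex.exp ((s : ℝ) * Complex.I) - Complex.exp ((t : ℝ) * Complex.I)‖ ^ 2)) (2 * π) :=
    fun s t => by
      have h1 := exp_periodic t
      simp only at h1 ⊢
      rw [hp t, h1]
  have hk' : Function.Periodic (fun s : ℝ => ∫⁻ t in Set.Ico 0 (2 * π),
      ENNReal.ofReal (‖p s - p t‖ ^ 2 /
      ‖Complex.exp ((s : ℝ) * Complex.I) - Complex.exp ((t : ℝ) * Complex.I)‖ ^ 2)) (2 * π) :=
    fun s => by
      have h1 := exp_periodic s
      simp only at h1 ⊢
      rw [hp s, h1]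
  unfold angularEnergy
  rw [← setLIntegral_Ico_neg hk']
  refine lintegral_congr fun s => ?_
  rw [← setLIntegral_Ico_neg (hk (-s))]
  exact lintegral_congr fun t => by rw [hchord s t]

lemma integral_exp_int_mul_I {n : ℤ} (hn : n ≠ 0) :
    ∫ θ in (0 : ℝ)..2 * π, Complex.exp (n * Complex.I * θ) = 0 := by
  have hc : (n : ℂ) * Complex.I ≠ 0 := mul_ne_zero (Int.cast_ne_zero.2 hn) Complex.I_ne_zero
  rw [integral_exp_mul_complex hc]
  have : Complex.exp (n * Complex.I * ((2 * π : ℝ) : ℂ)) = 1 := by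
    rw [Complex.exp_eq_one_iff]
    exact ⟨n, by push_cast; ring⟩
  rw [this]
  simp

/-- The Parseval identity for polynomials on the unit circle. -/
lemma lintegral_norm_sq_sum_pow (K : ℕ) (c : ℕ → ℂ) :
    ∫⁻ θ in Set.Ico 0 (2 * π),
      ENNReal.ofReal (‖∑ i ∈ Finset.range K, c i * Complex.exp ((θ : ℝ) * Complex.I) ^ i‖ ^ 2) =
      ENNReal.ofReal (2 * π * ∑ i ∈ Finset.range K, ‖c i‖ ^ 2) := by
  have hcont : Continuous fun θ : ℝ =>
      ‖∑ i ∈ Finset.range K, c i * Complex.exp ((θ : ℝ) * Complex.I) ^ i‖ ^ 2 := by fun_prop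
  rw [setLIntegral_congr Ico_ae_eq_Ioc, ← ofReal_integral_eq_lintegral_ofReal
    (hcont.integrableOn_Ioc) (ae_of_all _ fun θ => by positivity),
    ← intervalIntegral.integral_of_le two_pi_pos.le]
  congr 1
  rw [← Complex.ofReal_inj, ← intervalIntegral.integral_ofReal]
  have hexp : ∀ θ : ℝ, (((‖∑ i ∈ Finset.range K,
      c i * Complex.exp ((θ : ℝ) * Complex.I) ^ i‖ ^ 2 : ℝ)) : ℂ) =
      ∑ i ∈ Finset.range K, ∑ j ∈ Finset.range K, c i * (starRingEnd ℂ) (c j) *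
        Complex.exp (((i : ℤ) - (j : ℤ) : ℤ) * Complex.I * θ) := by
    intro θ
    rw [Complex.ofReal_pow, ← Complex.mul_conj', map_sum, Finset.sum_mul_sum]
    refine Finset.sum_congr rfl fun i _ => Finset.sum_congr rfl fun j _ => ?_
    rw [map_mul, map_pow, ← Complex.exp_conj, ← Complex.exp_nat_mul, ← Complex.exp_nat_mul]
    rw [mul_mul_mul_comm, ← Complex.exp_add]
    congr 2
    simp
    ring
  simp only [hexp]
  rw [intervalIntegral.integral_finsetSum
    fun i _ => Continuous.intervalIntegrable (by fun_prop) _ _]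
  push_cast
  rw [Finset.mul_sum]
  refine Finset.sum_congr rfl fun i hi => ?_
  rw [intervalIntegral.integral_finsetSum
    fun i _ => Continuous.intervalIntegrable (by fun_prop) _ _, Finset.sum_eq_single i]
  · simp [← Complex.mul_conj']
    ring
  · intro j _ hj
    rw [intervalIntegral.integral_const_mul]
    have := integral_exp_int_mul_I (n := (i : ℤ) - (j : ℤ)) (by omega)
    push_cast at this
    rw [this, mul_zero]
  · exact fun h => absurd hi h

lemma sum_mul_pow_sub_pow (N : ℕ) (a : ℕ → ℂ) (x y : ℂ) :
    ∑ n ∈ Finset.range N, a n * x ^ (n + 1) - ∑ n ∈ Finset.range N, a n * y ^ (n + 1) =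
      (∑ i ∈ Finset.range N, (∑ j ∈ Finset.range (N - i), a (i + j) * x ^ j) * y ^ i) *
        (x - y) := by
  have h := Finset.sum_range_diag_flip N (fun i j => a (i + j) * x ^ j * y ^ i)
  simp only [Finset.sum_mul (s := Finset.range (_ - _))]
  rw [← h, ← Finset.sum_sub_distrib, Finset.sum_mul]
  refine Finset.sum_congr rfl fun n _ => ?_
  have hg := (Commute.all y x).geom_sum₂_mul (n + 1)
  rw [← mul_sub, ← neg_sub (y ^ (n + 1)), ← hg, ← neg_sub y x, mul_neg, mul_neg, Finset.sum_mul,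
    Finset.mul_sum, Finset.sum_mul]
  congr 1
  refine Finset.sum_congr rfl fun i hi => ?_
  have : i ≤ n := by simpa [Nat.lt_succ_iff] using hi
  rw [show i + (n - i) = n by omega, show n + 1 - 1 - i = n - i by omega]
  ring

lemma douglasEnergy_polynomial_le (N : ℕ) (a : ℕ → ℂ) :
    douglasEnergy (fun z => ∑ n ∈ Finset.range N, a n * z ^ (n + 1)) ≤
      ENNReal.ofReal (4 * π ^ 2 * ∑ n ∈ Finset.range N, (n + 1) * ‖a n‖ ^ 2) := by
  rw [douglasEnergy_eq_angularEnergy, angularEnergy]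
  set e : ℝ → ℂ := fun t => Complex.exp (t * Complex.I) with he
  calc _ ≤ ∫⁻ s in Set.Ico 0 (2 * π), ∫⁻ t in Set.Ico 0 (2 * π), ENNReal.ofReal
        (‖∑ i ∈ Finset.range N, (∑ j ∈ Finset.range (N - i), a (i + j) * e s ^ j) *
          e t ^ i‖ ^ 2) := by
        refine lintegral_mono fun s => lintegral_mono fun t => ENNReal.ofReal_le_ofReal ?_
        change ‖∑ n ∈ Finset.range N, a n * e s ^ (n + 1) -
          ∑ n ∈ Finset.range N, a n * e t ^ (n + 1)‖ ^ 2 / ‖e s - e t‖ ^ 2 ≤ _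
        rw [sum_mul_pow_sub_pow, norm_mul, mul_pow]
        exact div_le_of_le_mul₀ (by positivity) (by positivity) le_rfl
    _ = ∫⁻ s in Set.Ico 0 (2 * π), ENNReal.ofReal (2 * π * ∑ i ∈ Finset.range N,
          ‖∑ j ∈ Finset.range (N - i), a (i + j) * e s ^ j‖ ^ 2) := by
        simp only [he, lintegral_norm_sq_sum_pow]
    _ = ∑ i ∈ Finset.range N, ENNReal.ofReal (2 * π) * ∫⁻ s in Set.Ico 0 (2 * π),
          ENNReal.ofReal (‖∑ j ∈ Finset.range (N - i), a (i + j) * e s ^ j‖ ^ 2) := by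
        have : ∀ s, ENNReal.ofReal (2 * π * ∑ i ∈ Finset.range N,
            ‖∑ j ∈ Finset.range (N - i), a (i + j) * e s ^ j‖ ^ 2) =
            ∑ i ∈ Finset.range N, ENNReal.ofReal (2 * π) *
            ENNReal.ofReal (‖∑ j ∈ Finset.range (N - i), a (i + j) * e s ^ j‖ ^ 2) := fun s => by
          rw [ENNReal.ofReal_mul two_pi_pos.le,
            ENNReal.ofReal_sum_of_nonneg fun i _ => by positivity, Finset.mul_sum]
        simp only [this]
        rw [lintegral_finsetSum _ fun i _ => by fun_prop]
        exact Finset.sum_congr rfl fun i _ => lintegral_const_mul _ (by fun_prop)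
    _ = ENNReal.ofReal (4 * π ^ 2 * ∑ i ∈ Finset.range N, ∑ j ∈ Finset.range (N - i),
          ‖a (i + j)‖ ^ 2) := by
        simp only [he, lintegral_norm_sq_sum_pow]
        rw [Finset.mul_sum, ENNReal.ofReal_sum_of_nonneg fun i _ => by positivity]
        refine Finset.sum_congr rfl fun i _ => ?_
        rw [← ENNReal.ofReal_mul two_pi_pos.le]
        congr 1
        ring
    _ = _ := by
        rw [← Finset.sum_range_diag_flip N (fun i j => ‖a (i + j)‖ ^ 2)]
        congr 2
        refine Finset.sum_congr rfl fun n _ => ?_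
        rw [Finset.sum_congr rfl (g := fun _ => ‖a n‖ ^ 2)]
        · simp
        · intro i hi
          have : i ≤ n := by simpa [Nat.lt_succ_iff] using hi
          rw [show i + (n - i) = n by omega]

lemma norm_pow_sub_one_le {u : ℂ} (hu : ‖u‖ = 1) (n : ℕ) : ‖u ^ n - 1‖ ≤ n * ‖u - 1‖ := by
  induction n with
  | zero => simp
  | succ n ih =>
    have : u ^ (n + 1) - 1 = u * (u ^ n - 1) + (u - 1) := by ring
    rw [this]
    calc _ ≤ ‖u * (u ^ n - 1)‖ + ‖u - 1‖ := norm_add_le _ _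
      _ ≤ _ := by rw [norm_mul, hu]; push_cast; linarith

/-- Abel summation bound for blocks of the logarithmic series. -/
lemma norm_sum_pow_div_mul_le {u : ℂ} (hu : ‖u‖ = 1) {M N : ℕ} (hMN : M ≤ N) :
    ‖∑ n ∈ Finset.Ico M N, u ^ (n + 1) / ((n : ℂ) + 1)‖ * ‖u - 1‖ ≤ 2 / ((M : ℝ) + 1) := by
  have key : ‖(1 - u) * ∑ n ∈ Finset.Ico M N, u ^ (n + 1) / ((n : ℂ) + 1) +
      u ^ (N + 1) / ((N : ℂ) + 1)‖ ≤ 2 / ((M : ℝ) + 1) - 1 / ((N : ℝ) + 1) := by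
    induction N, hMN using Nat.le_induction with
    | base =>
      have : ‖(M : ℂ) + 1‖ = M + 1 := by exact_mod_cast Complex.norm_natCast (M + 1)
      simp [hu, this]
      apply le_of_eq
      ring
    | succ N hMN ih =>
      rw [Finset.sum_Ico_succ_top hMN]
      have h1 : (N : ℂ) + 1 ≠ 0 := by exact_mod_cast (Nat.succ_ne_zero N)
      have h2 : (N : ℂ) + 1 + 1 ≠ 0 := by exact_mod_cast (Nat.succ_ne_zero (N + 1))
      have hr1 : (0 : ℝ) < N + 1 := by positivity
      have hr2 : (0 : ℝ) < N + 1 + 1 := by positivity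
      have e1 : (1 - u) * (∑ n ∈ Finset.Ico M N, u ^ (n + 1) / ((n : ℂ) + 1) +
          u ^ (N + 1) / ((N : ℂ) + 1)) + u ^ (N + 1 + 1) / (((N + 1 : ℕ) : ℂ) + 1) =
          ((1 - u) * ∑ n ∈ Finset.Ico M N, u ^ (n + 1) / ((n : ℂ) + 1) +
            u ^ (N + 1) / ((N : ℂ) + 1)) -
            ((1 / ((N : ℝ) + 1) - 1 / ((N : ℝ) + 1 + 1) : ℝ) : ℂ) * u ^ (N + 1 + 1) := by
        push_cast
        field_simp
        ring
      rw [e1]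
      have h3 : 0 ≤ 1 / ((N : ℝ) + 1) - 1 / ((N : ℝ) + 1 + 1) := by
        rw [sub_nonneg]
        exact one_div_le_one_div_of_le hr1 (by linarith)
      calc _ ≤ _ + _ := norm_sub_le _ _
        _ ≤ (2 / ((M : ℝ) + 1) - 1 / ((N : ℝ) + 1)) +
            (1 / ((N : ℝ) + 1) - 1 / ((N : ℝ) + 1 + 1)) := by
          gcongr
          rw [norm_mul, norm_pow, hu, Complex.norm_real, Real.norm_of_nonneg h3]
          simp
        _ = _ := by push_cast; ring
  have hN : ‖u ^ (N + 1) / ((N : ℂ) + 1)‖ = 1 / ((N : ℝ) + 1) := by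
    have : ‖(N : ℂ) + 1‖ = N + 1 := by exact_mod_cast Complex.norm_natCast (N + 1)
    rw [norm_div, norm_pow, hu, this, one_pow]
  rw [norm_sub_rev u 1, mul_comm, ← norm_mul]
  have := norm_sub_le ((1 - u) * ∑ n ∈ Finset.Ico M N, u ^ (n + 1) / ((n : ℂ) + 1) +
      u ^ (N + 1) / ((N : ℂ) + 1)) (u ^ (N + 1) / ((N : ℂ) + 1))
  rw [add_sub_cancel_right] at this
  linarith

lemma log_le_sum_Ico_one_div (M N : ℕ) :
    log (((N : ℝ) + 1) / (M + 1)) ≤ ∑ n ∈ Finset.Ico M N, 1 / ((n : ℝ) + 1) := by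
  rcases le_total N M with h | h
  · rw [Finset.Ico_eq_empty_of_le h, Finset.sum_empty]
    apply log_nonpos (by positivity)
    rw [div_le_one (by positivity)]
    have : (N : ℝ) ≤ M := by exact_mod_cast h
    linarith
  · induction N, h using Nat.le_induction with
    | base => simp [div_self (show (M : ℝ) + 1 ≠ 0 by positivity)]
    | succ N hMN ih =>
      rw [Finset.sum_Ico_succ_top hMN]
      have h1 : (0 : ℝ) < N + 1 := by positivity
      have h2 : (((N + 1 : ℕ) : ℝ) + 1) / (M + 1) =
          (((N : ℝ) + 1) / (M + 1)) * (1 + 1 / ((N : ℝ) + 1)) := by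
        push_cast
        field_simp
      rw [h2, log_mul (by positivity) (by positivity)]
      have := log_le_sub_one_of_pos (show 0 < 1 + 1 / ((N : ℝ) + 1) by positivity)
      linarith

/-- Logarithmic test functions: nearly constant at scale `ε` around `z₀`, bounded beyond
scale `L`, and of energy comparable to the oscillation `S`. -/
lemma exists_log_test_function {z₀ : ℂ} (hz₀ : ‖z₀‖ = 1) {ε L : ℝ} (hε : 0 < ε) (hL : 0 < L)
    (hL2 : L ≤ 2) :
    ∃ (f : ℂ → ℂ) (S : ℝ), Continuous f ∧ 0 ≤ S ∧
      douglasEnergy f ≤ ENNReal.ofReal (4 * π ^ 2 * S) ∧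
      (∀ z, ‖z‖ = 1 → ‖z - z₀‖ ≤ ε → ‖f z - S‖ ≤ 1) ∧
      (∀ z, ‖z‖ = 1 → L ≤ ‖z - z₀‖ → ‖f z‖ ≤ 2) ∧ L / ε ≤ 3 * exp S := by
  set M := ⌊1 / L⌋₊ with hM
  set N := ⌊1 / ε⌋₊ with hN
  set w := (starRingEnd ℂ) z₀ with hw
  have hw1 : ‖w‖ = 1 := by rw [hw, Complex.norm_conj, hz₀]
  have hwz : w * z₀ = 1 := by rw [hw, Complex.conj_mul', hz₀]; norm_num
  have hdist : ∀ z, ‖w * z - 1‖ = ‖z - z₀‖ := fun z => by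
    rw [← hwz, ← mul_sub, norm_mul, hw1, one_mul]
  set S : ℝ := ∑ n ∈ Finset.Ico M N, 1 / ((n : ℝ) + 1) with hS
  set a : ℕ → ℂ := fun n => if M ≤ n then w ^ (n + 1) / ((n : ℂ) + 1) else 0 with ha
  have hnorm : ∀ n : ℕ, ‖(n : ℂ) + 1‖ = n + 1 := fun n => by
    exact_mod_cast Complex.norm_natCast (n + 1)
  have hf : ∀ z, ∑ n ∈ Finset.range N, a n * z ^ (n + 1) =
      ∑ n ∈ Finset.Ico M N, (w * z) ^ (n + 1) / ((n : ℂ) + 1) := fun z => by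
    have : Finset.Ico M N = (Finset.range N).filter (fun n => M ≤ n) := by
      ext n; simp [and_comm]
    rw [this, Finset.sum_filter]
    refine Finset.sum_congr rfl fun n _ => ?_
    simp only [ha]
    split_ifs
    · rw [mul_pow]; ring
    · simp
  have hSE : ∑ n ∈ Finset.range N, ((n : ℝ) + 1) * ‖a n‖ ^ 2 = S := by
    have : Finset.Ico M N = (Finset.range N).filter (fun n => M ≤ n) := by
      ext n; simp [and_comm]
    rw [hS, this, Finset.sum_filter]
    refine Finset.sum_congr rfl fun n _ => ?_
    simp only [ha]
    split_ifs
    · rw [norm_div, norm_pow, hw1, hnorm]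
      have : (n : ℝ) + 1 ≠ 0 := by positivity
      field_simp
      simp
    · simp
  refine ⟨fun z => ∑ n ∈ Finset.range N, a n * z ^ (n + 1), S, by fun_prop,
    Finset.sum_nonneg fun n _ => by positivity, ?_, ?_, ?_, ?_⟩
  · rw [← hSE]
    exact douglasEnergy_polynomial_le N a
  · intro z hz hzε
    have hu : ‖w * z‖ = 1 := by rw [norm_mul, hw1, hz, one_mul]
    simp only [hf, hS]
    push_cast
    rw [← Finset.sum_sub_distrib]
    calc _ ≤ ∑ n ∈ Finset.Ico M N, ‖z - z₀‖ := by
          refine norm_sum_le_of_le _ fun n _ => ?_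
          rw [← sub_div, norm_div, hnorm, div_le_iff₀ (by positivity)]
          have := norm_pow_sub_one_le hu (n + 1)
          rw [hdist] at this
          push_cast at this
          linarith
      _ ≤ N * ε := by
          rw [Finset.sum_const, Nat.card_Ico, nsmul_eq_mul]
          gcongr
          exact Nat.sub_le _ _
      _ ≤ 1 := by
          have : (N : ℝ) ≤ 1 / ε := Nat.floor_le (by positivity)
          rwa [le_div_iff₀ hε] at this
  · intro z hz hzL
    have hu : ‖w * z‖ = 1 := by rw [norm_mul, hw1, hz, one_mul]
    simp only [hf]
    rcases le_total N M with h | h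
    · rw [Finset.Ico_eq_empty_of_le h]; simp
    have h1 := norm_sum_pow_div_mul_le hu h
    rw [hdist, le_div_iff₀ (by positivity)] at h1
    have h2 : 1 ≤ ‖z - z₀‖ * (M + 1) := by
      have : 1 / L < M + 1 := Nat.lt_floor_add_one _
      rw [div_lt_iff₀ hL] at this
      nlinarith
    nlinarith [norm_nonneg (∑ n ∈ Finset.Ico M N, (w * z) ^ (n + 1) / ((n : ℂ) + 1))]
  · have h1 : 1 / ε < N + 1 := Nat.lt_floor_add_one _
    have h2 : (M : ℝ) ≤ 1 / L := Nat.floor_le (by positivity)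
    have h3 : ((N : ℝ) + 1) / (M + 1) ≤ exp S :=
      (log_le_iff_le_exp (by positivity)).1 (log_le_sum_Ico_one_div M N)
    rw [div_le_iff₀ (by positivity)] at h3
    have h4 : ((M : ℝ) + 1) * L ≤ 3 := by
      rw [le_div_iff₀ hL] at h2
      linarith
    calc L / ε = L * (1 / ε) := by ring
      _ ≤ L * (exp S * (M + 1)) := by gcongr; linarith
      _ = exp S * ((M + 1) * L) := by ring
      _ ≤ exp S * 3 := by gcongr
      _ = 3 * exp S := by ring

lemma angularEnergy_eq_translate {p : ℝ → ℂ} (hp : Function.Periodic p (2 * π)) (c : ℝ) :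
    angularEnergy p = ∫⁻ s in Set.Ico c (c + 2 * π), ∫⁻ t in Set.Ico c (c + 2 * π),
    ENNReal.ofReal (‖p s - p t‖ ^ 2 /
      ‖Complex.exp ((s : ℝ) * Complex.I) - Complex.exp ((t : ℝ) * Complex.I)‖ ^ 2) := by
  have hk : ∀ s : ℝ, Function.Periodic (fun t : ℝ => ENNReal.ofReal (‖p s - p t‖ ^ 2 /
      ‖Complex.exp ((s : ℝ) * Complex.I) - Complex.exp ((t : ℝ) * Complex.I)‖ ^ 2)) (2 * π) :=
    fun s t => by
      have h1 := exp_periodic t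
      simp only at h1 ⊢
      rw [hp t, h1]
  have hk' : Function.Periodic (fun s : ℝ => ∫⁻ t in Set.Ico c (c + 2 * π),
      ENNReal.ofReal (‖p s - p t‖ ^ 2 /
      ‖Complex.exp ((s : ℝ) * Complex.I) - Complex.exp ((t : ℝ) * Complex.I)‖ ^ 2)) (2 * π) :=
    fun s => by
      have h1 := exp_periodic s
      simp only at h1 ⊢
      rw [hp s, h1]
  rw [setLIntegral_Ico_add_two_pi hk' c]
  exact lintegral_congr fun s => (setLIntegral_Ico_add_two_pi (hk s) c).symm

lemma norm_exp_sub_exp_le (s t : ℝ) :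
    ‖Complex.exp (s * Complex.I) - Complex.exp (t * Complex.I)‖ ≤ |s - t| := by
  rw [norm_exp_sub_exp]
  have := abs_sin_le_abs (x := (s - t) / 2)
  rw [abs_div, abs_two] at this
  linarith

lemma abs_sin_half_le_abs_sin_half {x y : ℝ} (hxy : |x| ≤ |y|) (hy : |y| ≤ π) :
    |sin (x / 2)| ≤ |sin (y / 2)| := by
  have key : ∀ z : ℝ, |z| ≤ π → |sin (z / 2)| = sin (|z| / 2) := fun z hz => by
    have h0 : 0 ≤ sin (|z| / 2) :=
      sin_nonneg_of_nonneg_of_le_pi (by positivity) (by linarith [abs_nonneg z])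
    rcases abs_cases z with ⟨h, -⟩ | ⟨h, -⟩
    · rw [h] at h0 ⊢
      exact abs_of_nonneg h0
    · rw [h] at h0 ⊢
      rw [← abs_neg, ← sin_neg, show -(z / 2) = -z / 2 by ring]
      exact abs_of_nonneg h0
  rw [key x (hxy.trans hy), key y hy]
  exact sin_le_sin_of_le_of_le_pi_div_two (by linarith [abs_nonneg x, pi_pos]) (by linarith)
    (by linarith)

lemma map_add_int_mul_two_pi {H : ℝ → ℝ} (hper : ∀ t, H (t + 2 * π) = H t + 2 * π) (n : ℤ)
    (t : ℝ) : H (t + n * (2 * π)) = H t + n * (2 * π) := by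
  have hp : Function.Periodic (fun t => H t - t) (2 * π) := fun t => by
    simp only [hper t]; ring
  have := hp.int_mul n t
  linarith

lemma exists_translate_mem_Ico (a : ℝ) : ∃ n : ℤ, a + n * (2 * π) ∈ Set.Ico 0 (2 * π) := by
  obtain ⟨n, hn, -⟩ := existsUnique_add_zsmul_mem_Ico two_pi_pos a 0
  exact ⟨n, by simpa using hn⟩

/-- Uniform continuity of a circle lift, at a prescribed scale. -/
lemma exists_forall_abs_sub_le {H : ℝ → ℝ} (hH : Continuous H)
    (hper : ∀ t, H (t + 2 * π) = H t + 2 * π) :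
    ∃ b : ℝ, 0 < b ∧ b ≤ 1 ∧ ∀ s t, |s - t| ≤ 2 * b → |H s - H t| ≤ π := by
  have huc := (isCompact_Icc (a := -(2 * π)) (b := 4 * π)).uniformContinuousOn_of_continuous
    hH.continuousOn
  obtain ⟨δ, hδ, h⟩ := Metric.uniformContinuousOn_iff.1 huc π pi_pos
  refine ⟨min 1 (δ / 4), by positivity, min_le_left _ _, fun s t hst => ?_⟩
  obtain ⟨n, hn⟩ := exists_translate_mem_Ico t
  have h1 : |s - t| < δ := by linarith [min_le_right 1 (δ / 4)]
  have h2 : |s - t| ≤ 2 := by linarith [min_le_left 1 (δ / 4)]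
  have h3 := abs_le.1 h2
  have hpi := pi_gt_three
  have := h (s + n * (2 * π)) ⟨by linarith [hn.1], by linarith [hn.2]⟩
    (t + n * (2 * π)) ⟨by linarith [hn.1], by linarith [hn.2]⟩
    (by rw [Real.dist_eq]; simpa using h1)
  rw [Real.dist_eq, map_add_int_mul_two_pi hper, map_add_int_mul_two_pi hper,
    add_sub_add_right_eq_sub] at this
  exact this.le

/-- Points separated by the function `p` contribute to the energy. -/
lemma ofReal_le_angularEnergy {p : ℝ → ℂ} (hp : Function.Periodic p (2 * π)) {a β D : ℝ}
    (hβ0 : β ≠ 0) (hβ1 : |β| ≤ 1) (hD : 0 ≤ D)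
    (hsep : ∀ s ∈ Set.uIcc (a - β) a, ∀ t ∈ Set.uIcc (a + β) (a + 2 * β), D ≤ ‖p s - p t‖) :
    ENNReal.ofReal (D ^ 2 / 9) ≤ angularEnergy p := by
  have hβ := abs_pos.2 hβ0
  have hpi := pi_gt_three
  have hle := abs_le.1 hβ1
  have hA : Set.uIoc (a - β) a ⊆ Set.Ico (a - 3) (a - 3 + 2 * π) := fun s hs => by
    rcases Set.mem_uIoc.1 hs with h | h <;> constructor <;> linarith [h.1, h.2]
  have hB : Set.uIoc (a + β) (a + 2 * β) ⊆ Set.Ico (a - 3) (a - 3 + 2 * π) := fun s hs => by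
    rcases Set.mem_uIoc.1 hs with h | h <;> constructor <;> linarith [h.1, h.2]
  rw [angularEnergy_eq_translate hp (a - 3)]
  calc ENNReal.ofReal (D ^ 2 / 9)
      = ∫⁻ s in Set.uIoc (a - β) a, ∫⁻ t in Set.uIoc (a + β) (a + 2 * β),
          ENNReal.ofReal (D ^ 2 / (3 * |β|) ^ 2) := by
        simp only [lintegral_const, Measure.restrict_apply_univ, Real.volume_uIoc]
        rw [← ENNReal.ofReal_mul (by positivity), ← ENNReal.ofReal_mul (by positivity)]
        congr 1
        rw [show a + 2 * β - (a + β) = β by ring, show a - (a - β) = β by ring]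
        field_simp
        norm_num
    _ ≤ ∫⁻ s in Set.uIoc (a - β) a, ∫⁻ t in Set.uIoc (a + β) (a + 2 * β),
          ENNReal.ofReal (‖p s - p t‖ ^ 2 /
      ‖Complex.exp ((s : ℝ) * Complex.I) - Complex.exp ((t : ℝ) * Complex.I)‖ ^ 2) := by
        refine setLIntegral_mono' measurableSet_uIoc fun s hs =>
          setLIntegral_mono' measurableSet_uIoc fun t ht => ENNReal.ofReal_le_ofReal ?_
        have h1 := hsep s (Set.uIoc_subset_uIcc hs) t (Set.uIoc_subset_uIcc ht)
        have hst : |s - t| ≤ 3 * |β| := by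
          rcases lt_or_gt_of_ne hβ0 with h | h
          · rw [abs_of_neg h]
            rcases Set.mem_uIoc.1 hs with h1 | h1 <;> rcases Set.mem_uIoc.1 ht with h2 | h2 <;>
              rw [abs_le] <;> constructor <;> linarith [h1.1, h1.2, h2.1, h2.2]
          · rw [abs_of_pos h]
            rcases Set.mem_uIoc.1 hs with h1 | h1 <;> rcases Set.mem_uIoc.1 ht with h2 | h2 <;>
              rw [abs_le] <;> constructor <;> linarith [h1.1, h1.2, h2.1, h2.2]
        have hchord := (norm_exp_sub_exp_le s t).trans hst
        have hpos : 0 < ‖Complex.exp (s * Complex.I) - Complex.exp (t * Complex.I)‖ := by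
          rw [norm_exp_sub_exp]
          have : sin ((s - t) / 2) ≠ 0 := by
            have h3 := abs_le.1 hst
            rcases lt_or_gt_of_ne hβ0 with h | h
            · apply ne_of_gt
              rw [abs_of_neg h] at h3
              refine sin_pos_of_pos_of_lt_pi ?_ (by linarith)
              rcases Set.mem_uIoc.1 hs with h1 | h1 <;> rcases Set.mem_uIoc.1 ht with h2 | h2 <;>
                linarith [h1.1, h1.2, h2.1, h2.2]
            · apply ne_of_lt
              rw [abs_of_pos h] at h3
              refine sin_neg_of_neg_of_neg_pi_lt ?_ (by linarith)
              rcases Set.mem_uIoc.1 hs with h1 | h1 <;> rcases Set.mem_uIoc.1 ht with h2 | h2 <;>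
                linarith [h1.1, h1.2, h2.1, h2.2]
          positivity
        gcongr
    _ ≤ _ := (lintegral_mono fun s => lintegral_mono_set hB).trans (lintegral_mono_set hA)

/-- A bounded composition operator forces the three-point condition at small scales. -/
lemma exists_ratio_bound_of_bounded {φ : ℂ → ℂ} {H : ℝ → ℝ} {b C : ℝ}
    (hb1 : b ≤ 1) (hC : 0 < C)
    (hnorm : ∀ t : ℝ, ‖φ (Complex.exp (t * Complex.I))‖ = 1)
    (hchord : ∀ s t : ℝ, ‖φ (Complex.exp (s * Complex.I)) - φ (Complex.exp (t * Complex.I))‖ =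
      2 * |sin ((H s - H t) / 2)|)
    (hmono : StrictMono H) (hb : ∀ s t, |s - t| ≤ 2 * b → |H s - H t| ≤ π)
    (hbdd : ∀ f : ℂ → ℂ, ContinuousOn f (sphere (0 : ℂ) 1) →
        douglasEnergy (f ∘ φ) ≤ ENNReal.ofReal C * douglasEnergy f) :
    ∃ K : ℝ, 0 < K ∧ ∀ α β : ℝ, β ≠ 0 → |β| ≤ b →
      ‖φ (Complex.exp ((α + β : ℝ) * Complex.I)) - φ (Complex.exp (α * Complex.I))‖ ≤
        K * ‖φ (Complex.exp ((α - β : ℝ) * Complex.I)) - φ (Complex.exp (α * Complex.I))‖ := by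
  set h : ℝ → ℂ := fun t => φ (Complex.exp (t * Complex.I)) with hh
  refine ⟨3 * exp (6 + 36 * π ^ 2 * C), by positivity, fun α β hβ0 hβb => ?_⟩
  have hpos : ∀ s t : ℝ, s ≠ t → |s - t| ≤ 2 * b → 0 < ‖h s - h t‖ := fun s t hst hstb => by
    rw [hh, hchord]
    have h1 := hb s t hstb
    have h2 : H s - H t ≠ 0 := sub_ne_zero.2 (hmono.injective.ne hst)
    have h3 : sin ((H s - H t) / 2) ≠ 0 := by
      have := abs_le.1 h1
      rcases lt_or_gt_of_ne h2 with h4 | h4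
      · exact (sin_neg_of_neg_of_neg_pi_lt (by linarith) (by linarith)).ne
      · exact (sin_pos_of_pos_of_lt_pi (by linarith) (by linarith)).ne'
    positivity
  have hmon : ∀ s t : ℝ, |H s - H α| ≤ |H t - H α| → |t - α| ≤ 2 * b →
      ‖h s - h α‖ ≤ ‖h t - h α‖ := fun s t hst htb => by
    rw [hh, hchord, hchord]
    have := abs_sin_half_le_abs_sin_half hst (hb t α htb)
    linarith
  have hb0 := abs_nonneg β
  have hε : 0 < ‖h (α - β) - h α‖ := hpos _ _ (by simpa using hβ0) (by
    rw [show α - β - α = -β by ring, abs_neg]; linarith)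
  have hL : 0 < ‖h (α + β) - h α‖ := hpos _ _ (by simpa using hβ0) (by
    rw [show α + β - α = β by ring]; linarith)
  have hL2 : ‖h (α + β) - h α‖ ≤ 2 := (norm_sub_le _ _).trans (by
    rw [hh, hnorm, hnorm]; norm_num)
  obtain ⟨f, S, hf, hS, hE, hnear, hfar, hratio⟩ := exists_log_test_function (hnorm α) hε hL hL2
  have hle : ENNReal.ofReal ((max 0 (S - 3)) ^ 2 / 9) ≤
      ENNReal.ofReal (C * (4 * π ^ 2 * S)) := by
    calc _ ≤ angularEnergy (fun t => f (h t)) := by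
          refine ofReal_le_angularEnergy (a := α) (β := β) (fun t => ?_) hβ0 (hβb.trans hb1)
            (le_max_left _ _) fun s hs t ht => ?_
          · have := exp_periodic t
            simp only [hh] at this ⊢
            rw [this]
          · refine max_le (norm_nonneg _) ?_
            have h1 := hnear (h s) (hnorm s) (hmon _ _ (by
              rcases Set.mem_uIcc.1 hs with h1 | h1
              · have h2 := hmono.monotone h1.1
                have h3 := hmono.monotone h1.2
                rw [abs_of_nonpos (by linarith), abs_of_nonpos (by linarith)]
                linarith
              · have h2 := hmono.monotone h1.1
                have h3 := hmono.monotone h1.2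
                rw [abs_of_nonneg (by linarith), abs_of_nonneg (by linarith)]
                linarith) (by rw [show α - β - α = -β by ring, abs_neg]; linarith))
            have h2 := hfar (h t) (hnorm t) (hmon _ _ (by
              rcases lt_or_gt_of_ne hβ0 with h0 | h0
              · have h1 : t ≤ α + β := by
                  rcases Set.mem_uIcc.1 ht with h1 | h1 <;> linarith [h1.1, h1.2]
                have h2 := hmono.monotone h1
                have h3 : H (α + β) < H α := hmono (by linarith)
                rw [abs_of_nonpos (by linarith), abs_of_nonpos (by linarith)]
                linarith
              · have h1 : α + β ≤ t := by
                  rcases Set.mem_uIcc.1 ht with h1 | h1 <;> linarith [h1.1, h1.2]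
                have h2 := hmono.monotone h1
                have h3 : H α < H (α + β) := hmono (by linarith)
                rw [abs_of_nonneg (by linarith), abs_of_nonneg (by linarith)]
                linarith) (by
              have h5 := abs_le.1 hβb
              rcases Set.mem_uIcc.1 ht with h1 | h1 <;> rw [abs_le] <;> constructor <;>
                linarith [h1.1, h1.2]))
            have h3 : ‖(S : ℂ)‖ = S := by rw [Complex.norm_real, Real.norm_of_nonneg hS]
            have h4 : (S : ℂ) = (f (h s) - f (h t)) - (f (h s) - S) + f (h t) := by ring
            have h5 := (norm_add_le ((f (h s) - f (h t)) - (f (h s) - S)) (f (h t)))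
            have h6 := norm_sub_le (f (h s) - f (h t)) (f (h s) - S)
            rw [← h4, h3] at h5
            linarith
      _ = douglasEnergy (f ∘ φ) := by rw [douglasEnergy_eq_angularEnergy]; rfl
      _ ≤ ENNReal.ofReal C * douglasEnergy f := hbdd f hf.continuousOn
      _ ≤ ENNReal.ofReal C * ENNReal.ofReal (4 * π ^ 2 * S) := by gcongr
      _ = _ := by rw [ENNReal.ofReal_mul hC.le]
  rw [ENNReal.ofReal_le_ofReal_iff (by positivity)] at hle
  have hS' : S ≤ 6 + 36 * π ^ 2 * C := by
    have h0 : 0 < 36 * π ^ 2 * C := by positivity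
    by_contra! hlt
    rw [max_eq_right (by linarith)] at hle
    nlinarith
  rw [div_le_iff₀ hε] at hratio
  refine hratio.trans ?_
  gcongr

/-- A dyadic Hardy inequality for finite sequences. -/
lemma sum_mul_norm_sub_sq_le {z : ℕ → ℂ} {c : ℕ → ℝ} (hc0 : ∀ n, 0 ≤ c n)
    (hc : ∀ n, c (n + 1) = 2 * c n) (N : ℕ) :
    ∑ n ∈ Finset.range N, c n * ‖z N - z n‖ ^ 2 ≤
      12 * ∑ n ∈ Finset.range N, c n * ‖z (n + 1) - z n‖ ^ 2 := by
  have h1 : ∀ n, c n * ‖z N - z n‖ ^ 2 ≤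
      3 / 4 * (c (n + 1) * ‖z N - z (n + 1)‖ ^ 2) + 3 * (c n * ‖z (n + 1) - z n‖ ^ 2) := by
    intro n
    have h2 : ‖z N - z n‖ ≤ ‖z N - z (n + 1)‖ + ‖z (n + 1) - z n‖ :=
      norm_sub_le_norm_sub_add_norm_sub _ _ _
    have h3 : ‖z N - z n‖ ^ 2 ≤
        3 / 2 * ‖z N - z (n + 1)‖ ^ 2 + 3 * ‖z (n + 1) - z n‖ ^ 2 := by
      nlinarith [norm_nonneg (z N - z n), sq_nonneg (‖z N - z (n + 1)‖ - 2 * ‖z (n + 1) - z n‖)]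
    rw [hc n]
    nlinarith [mul_le_mul_of_nonneg_left h3 (hc0 n)]
  have h2 : ∑ n ∈ Finset.range N, c (n + 1) * ‖z N - z (n + 1)‖ ^ 2 ≤
      ∑ n ∈ Finset.range N, c n * ‖z N - z n‖ ^ 2 := by
    have h3 := Finset.sum_range_succ (fun n => c n * ‖z N - z n‖ ^ 2) N
    have h4 := Finset.sum_range_succ' (fun n => c n * ‖z N - z n‖ ^ 2) N
    have h5 : 0 ≤ c 0 * ‖z N - z 0‖ ^ 2 := mul_nonneg (hc0 0) (by positivity)
    simp only [sub_self, norm_zero] at h3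
    norm_num at h3
    linarith
  have h3 := Finset.sum_le_sum fun n (_ : n ∈ Finset.range N) => h1 n
  rw [Finset.sum_add_distrib, ← Finset.mul_sum, ← Finset.mul_sum] at h3
  linarith

lemma tsum_mul_norm_sub_sq_le {z : ℕ → ℂ} {w : ℂ} (hz : Filter.Tendsto z Filter.atTop (nhds w))
    {c : ℕ → ℝ} (hc0 : ∀ n, 0 ≤ c n) (hc : ∀ n, c (n + 1) = 2 * c n) :
    ∑' n, ENNReal.ofReal (c n) * ENNReal.ofReal (‖w - z n‖ ^ 2) ≤
      12 * ∑' n, ENNReal.ofReal (c n) * ENNReal.ofReal (‖z (n + 1) - z n‖ ^ 2) := by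
  refine ENNReal.tsum_le_of_sum_range_le fun K => ?_
  have hconv : ∀ (u : ℕ → ℂ) (m : ℕ), ∑ n ∈ Finset.range m,
      ENNReal.ofReal (c n) * ENNReal.ofReal (‖u n‖ ^ 2) =
      ENNReal.ofReal (∑ n ∈ Finset.range m, c n * ‖u n‖ ^ 2) := fun u m => by
    rw [ENNReal.ofReal_sum_of_nonneg fun n _ => mul_nonneg (hc0 n) (by positivity)]
    exact Finset.sum_congr rfl fun n _ => (ENNReal.ofReal_mul (hc0 n)).symm
  rw [hconv (fun n => w - z n)]
  have hlim : Filter.Tendsto (fun N => ENNReal.ofReal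
      (∑ n ∈ Finset.range K, c n * ‖z N - z n‖ ^ 2)) Filter.atTop
      (nhds (ENNReal.ofReal (∑ n ∈ Finset.range K, c n * ‖w - z n‖ ^ 2))) := by
    refine ENNReal.tendsto_ofReal (tendsto_finsetSum _ fun n _ => ?_)
    exact (((hz.sub_const _).norm).pow 2).const_mul _
  refine le_of_tendsto hlim ?_
  filter_upwards [Filter.eventually_ge_atTop K] with N hN
  calc _ ≤ ENNReal.ofReal (∑ n ∈ Finset.range N, c n * ‖z N - z n‖ ^ 2) := by
        refine ENNReal.ofReal_le_ofReal (Finset.sum_le_sum_of_subset_of_nonneg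
          (Finset.range_mono hN) fun n _ _ => mul_nonneg (hc0 n) (by positivity))
    _ ≤ ENNReal.ofReal (12 * ∑ n ∈ Finset.range N, c n * ‖z (n + 1) - z n‖ ^ 2) :=
        ENNReal.ofReal_le_ofReal (sum_mul_norm_sub_sq_le hc0 hc N)
    _ = 12 * ∑ n ∈ Finset.range N,
          ENNReal.ofReal (c n) * ENNReal.ofReal (‖z (n + 1) - z n‖ ^ 2) := by
        rw [ENNReal.ofReal_mul (by norm_num), hconv (fun n => z (n + 1) - z n)]
        norm_num
    _ ≤ _ := by
        gcongr
        exact ENNReal.sum_le_tsum _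

/-- Summing inverse squares of a geometrically decaying sequence above a threshold. -/
lemma sum_ite_inv_sq_le {l : ℕ → ℝ} {lam δ : ℝ} (hl : ∀ n, 0 < l n) (hlam0 : 0 ≤ lam)
    (hlam : lam < 1) (hdecay : ∀ n, l (n + 1) ≤ lam * l n) (hδ : 0 < δ) (N : ℕ) :
    ∑ n ∈ Finset.range N, (if δ ≤ l n then 1 / l n ^ 2 else 0) ≤
      1 / ((1 - lam ^ 2) * δ ^ 2) := by
  have hlam2 : 0 < 1 - lam ^ 2 := by nlinarith
  have hanti : Antitone l := antitone_nat_of_succ_le fun n => (hdecay n).trans (by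
    nlinarith [hl n])
  have hfull : ∀ N, ∑ n ∈ Finset.range (N + 1), 1 / l n ^ 2 ≤
      1 / ((1 - lam ^ 2) * l N ^ 2) := by
    intro N
    induction N with
    | zero =>
      have h0 := hl 0
      simp only [zero_add, Finset.range_one, Finset.sum_singleton]
      refine one_div_le_one_div_of_le (by positivity) ?_
      nlinarith [sq_nonneg lam, sq_nonneg (l 0)]
    | succ N ih =>
      have h0 := hl N
      have h1 := hl (N + 1)
      rw [Finset.sum_range_succ]
      have h2 : l (N + 1) ^ 2 ≤ lam ^ 2 * l N ^ 2 := by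
        rw [← mul_pow]
        exact pow_le_pow_left₀ h1.le (hdecay N) 2
      have h3 : 1 / ((1 - lam ^ 2) * l N ^ 2) ≤ lam ^ 2 / ((1 - lam ^ 2) * l (N + 1) ^ 2) := by
        rw [div_le_div_iff₀ (by positivity) (by positivity)]
        nlinarith
      have h4 : lam ^ 2 / ((1 - lam ^ 2) * l (N + 1) ^ 2) + 1 / l (N + 1) ^ 2 =
          1 / ((1 - lam ^ 2) * l (N + 1) ^ 2) := by
        field_simp
        ring
      linarith
  induction N with
  | zero => simp; positivity
  | succ N ih =>
    by_cases h : δ ≤ l N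
    · calc _ = ∑ n ∈ Finset.range (N + 1), 1 / l n ^ 2 := by
            refine Finset.sum_congr rfl fun n hn => if_pos (h.trans (hanti ?_))
            simpa [Nat.lt_succ_iff] using hn
        _ ≤ _ := hfull N
        _ ≤ _ := by gcongr
    · rw [Finset.sum_range_succ, if_neg h, add_zero]
      exact ih

/-- The mean of a function over `[a, b]`. -/
noncomputable def intervalMean (F : ℝ → ℂ) (a b : ℝ) : ℂ :=
  ((b - a)⁻¹ : ℝ) • ∫ u in a..b, F u

/-- The mean square oscillation of a function over `[c, d]`. -/
noncomputable def meanSqOsc (F : ℝ → ℂ) (c d : ℝ) : ENNReal :=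
  ENNReal.ofReal (1 / (d - c) ^ 2) *
    ∫⁻ u in Set.Ioc c d, ∫⁻ v in Set.Ioc c d, ENNReal.ofReal (‖F u - F v‖ ^ 2)

lemma sq_integral_le {G : ℝ → ℝ} (hG : Continuous G) {a b : ℝ} (hab : a < b) :
    (∫ u in a..b, G u) ^ 2 ≤ (b - a) * ∫ u in a..b, G u ^ 2 := by
  set m := (∫ u in a..b, G u) / (b - a) with hm
  have hba : 0 < b - a := sub_pos.2 hab
  have h0 : 0 ≤ ∫ u in a..b, (G u - m) ^ 2 :=
    intervalIntegral.integral_nonneg hab.le fun u _ => sq_nonneg _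
  have h1 : ∫ u in a..b, (G u - m) ^ 2 =
      (∫ u in a..b, G u ^ 2) - 2 * m * (∫ u in a..b, G u) + m ^ 2 * (b - a) := by
    have : ∀ u, (G u - m) ^ 2 = G u ^ 2 - 2 * m * G u + m ^ 2 := fun u => by ring
    simp only [this]
    rw [intervalIntegral.integral_add (Continuous.intervalIntegrable (by fun_prop) _ _)
      (Continuous.intervalIntegrable (by fun_prop) _ _),
      intervalIntegral.integral_sub (Continuous.intervalIntegrable (by fun_prop) _ _)
      (Continuous.intervalIntegrable (by fun_prop) _ _), intervalIntegral.integral_const_mul,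
      intervalIntegral.integral_const]
    simp [mul_comm]
  have h2 : ∫ u in a..b, G u = m * (b - a) := by rw [hm]; field_simp
  rw [h2] at h1 ⊢
  nlinarith

lemma ofReal_norm_intervalMean_sub_sq_le {F : ℝ → ℂ} (hF : Continuous F) {a b : ℝ} (hab : a < b)
    (z : ℂ) : ENNReal.ofReal (‖intervalMean F a b - z‖ ^ 2) ≤
      ENNReal.ofReal (1 / (b - a)) * ∫⁻ u in Set.Ioc a b, ENNReal.ofReal (‖F u - z‖ ^ 2) := by
  have hba : 0 < b - a := sub_pos.2 hab
  have hcont : Continuous fun u => ‖F u - z‖ ^ 2 := by fun_prop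
  rw [← ofReal_integral_eq_lintegral_ofReal hcont.integrableOn_Ioc
    (ae_of_all _ fun u => by positivity), ← ENNReal.ofReal_mul (by positivity),
    ← intervalIntegral.integral_of_le hab.le]
  apply ENNReal.ofReal_le_ofReal
  have h1 : intervalMean F a b - z = ((b - a)⁻¹ : ℝ) • ∫ u in a..b, (F u - z) := by
    rw [intervalIntegral.integral_sub (Continuous.intervalIntegrable (by fun_prop) _ _)
      (Continuous.intervalIntegrable (by fun_prop) _ _), intervalIntegral.integral_const,
      smul_sub, smul_smul, inv_mul_cancel₀ hba.ne', one_smul, intervalMean]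
  rw [h1, norm_smul, Real.norm_of_nonneg (by positivity), mul_pow]
  have h2 : ‖∫ u in a..b, (F u - z)‖ ≤ ∫ u in a..b, ‖F u - z‖ :=
    intervalIntegral.norm_integral_le_integral_norm hab.le
  have h3 := sq_integral_le (G := fun u => ‖F u - z‖) (by fun_prop) hab
  have h4 := (pow_le_pow_left₀ (norm_nonneg _) h2 2).trans h3
  calc _ ≤ (b - a)⁻¹ ^ 2 * ((b - a) * ∫ u in a..b, ‖F u - z‖ ^ 2) := by gcongr
    _ = _ := by field_simp

lemma ofReal_norm_intervalMean_sub_intervalMean_sq_le {F : ℝ → ℂ} (hF : Continuous F)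
    {a b a' b' c d K : ℝ} (hab : a < b) (hab' : a' < b') (hca : c ≤ a) (hbd : b ≤ d)
    (hca' : c ≤ a') (hbd' : b' ≤ d) (hK : d - c ≤ K * (b - a)) (hK' : d - c ≤ K * (b' - a')) :
    ENNReal.ofReal (‖intervalMean F a b - intervalMean F a' b'‖ ^ 2) ≤
      ENNReal.ofReal (K ^ 2) * meanSqOsc F c d := by
  have hba : 0 < b - a := sub_pos.2 hab
  have hba' : 0 < b' - a' := sub_pos.2 hab'
  have hdc : 0 < d - c := by linarith
  have hKc : ∀ x : ℝ, 0 < x → d - c ≤ K * x → 1 / x ≤ K / (d - c) := fun x hx h => by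
    rw [div_le_div_iff₀ hx hdc]
    linarith
  calc _ ≤ ENNReal.ofReal (1 / (b - a)) * ∫⁻ u in Set.Ioc a b,
        ENNReal.ofReal (‖F u - intervalMean F a' b'‖ ^ 2) :=
        ofReal_norm_intervalMean_sub_sq_le hF hab _
    _ ≤ ENNReal.ofReal (1 / (b - a)) * ∫⁻ u in Set.Ioc a b,
        (ENNReal.ofReal (1 / (b' - a')) * ∫⁻ v in Set.Ioc a' b',
          ENNReal.ofReal (‖F u - F v‖ ^ 2)) := by
        gcongr with u
        rw [norm_sub_rev]
        simp only [norm_sub_rev (F u)]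
        exact ofReal_norm_intervalMean_sub_sq_le hF hab' _
    _ ≤ ENNReal.ofReal (K / (d - c)) * ∫⁻ u in Set.Ioc c d,
        (ENNReal.ofReal (K / (d - c)) * ∫⁻ v in Set.Ioc c d,
          ENNReal.ofReal (‖F u - F v‖ ^ 2)) := by
        refine mul_le_mul' (ENNReal.ofReal_le_ofReal (hKc _ hba hK))
          ((lintegral_mono_set (Set.Ioc_subset_Ioc hca hbd)).trans (lintegral_mono fun u => ?_))
        exact mul_le_mul' (ENNReal.ofReal_le_ofReal (hKc _ hba' hK'))
          (lintegral_mono_set (Set.Ioc_subset_Ioc hca' hbd'))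
    _ = _ := by
        have hK0 : 0 ≤ K / (d - c) := (by positivity : (0 : ℝ) ≤ 1 / (b - a)).trans (hKc _ hba hK)
        rw [lintegral_const_mul' _ _ ENNReal.ofReal_ne_top, ← mul_assoc, meanSqOsc, ← mul_assoc,
          ← ENNReal.ofReal_mul hK0, ← ENNReal.ofReal_mul (by positivity)]
        congr 2
        field_simp

lemma continuous_intervalMean {F : ℝ → ℂ} {a b : ℝ → ℝ} (hF : Continuous F)
    (ha : Continuous a) (hb : Continuous b) (hab : ∀ x, a x < b x) :
    Continuous fun x => intervalMean F (a x) (b x) := by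
  have hprim : Continuous fun x => ∫ u in (0 : ℝ)..x, F u :=
    intervalIntegral.continuous_primitive (fun _ _ => hF.intervalIntegrable _ _) 0
  have h : ∀ x, intervalMean F (a x) (b x) =
      ((b x - a x)⁻¹ : ℝ) • ((∫ u in (0 : ℝ)..b x, F u) - ∫ u in (0 : ℝ)..a x, F u) := fun x => by
    rw [intervalIntegral.integral_interval_sub_left (hF.intervalIntegrable _ _)
      (hF.intervalIntegrable _ _), intervalMean]
  simp only [h]
  refine Continuous.smul (Continuous.inv₀ (hb.sub ha) fun x => ?_)
    ((hprim.comp hb).sub (hprim.comp ha))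
  exact (sub_pos.2 (hab x)).ne'

lemma tendsto_intervalMean {F : ℝ → ℂ} (hF : Continuous F) {a b : ℕ → ℝ} {x : ℝ}
    (ha : Filter.Tendsto a Filter.atTop (nhds x)) (hb : Filter.Tendsto b Filter.atTop (nhds x))
    (hab : ∀ n, a n < b n) :
    Filter.Tendsto (fun n => intervalMean F (a n) (b n)) Filter.atTop (nhds (F x)) := by
  rw [Metric.tendsto_atTop]
  intro ε hε
  obtain ⟨δ, hδ, hFδ⟩ := Metric.continuousAt_iff.1 hF.continuousAt (ε / 2) (by positivity)
  obtain ⟨N₁, hN₁⟩ := Metric.tendsto_atTop.1 ha δ hδ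
  obtain ⟨N₂, hN₂⟩ := Metric.tendsto_atTop.1 hb δ hδ
  refine ⟨max N₁ N₂, fun n hn => ?_⟩
  have h1 := hN₁ n (le_of_max_le_left hn)
  have h2 := hN₂ n (le_of_max_le_right hn)
  have hba : 0 < b n - a n := sub_pos.2 (hab n)
  have h3 : intervalMean F (a n) (b n) - F x =
      ((b n - a n)⁻¹ : ℝ) • ∫ u in a n..b n, (F u - F x) := by
    rw [intervalIntegral.integral_sub (hF.intervalIntegrable _ _)
      (continuous_const.intervalIntegrable _ _), intervalIntegral.integral_const,
      smul_sub, smul_smul, inv_mul_cancel₀ hba.ne', one_smul, intervalMean]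
  have h4 : ‖∫ u in a n..b n, (F u - F x)‖ ≤ ε / 2 * |b n - a n| := by
    refine intervalIntegral.norm_integral_le_of_norm_le_const fun u hu => ?_
    rw [Set.uIoc_of_le (hab n).le] at hu
    rw [← dist_eq_norm]
    refine (hFδ ?_).le
    rw [Real.dist_eq, abs_lt] at *
    constructor <;> linarith [hu.1, hu.2]
  rw [dist_eq_norm, h3, norm_smul, Real.norm_of_nonneg (by positivity)]
  rw [abs_of_pos hba] at h4
  calc _ ≤ (b n - a n)⁻¹ * (ε / 2 * (b n - a n)) := by gcongr
    _ = ε / 2 := by field_simp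
    _ < ε := by linarith

/-- A lift of a circle homeomorphism satisfying the quasisymmetry condition with constant `M`. -/
structure IsQuasisymmetricLift (H : ℝ → ℝ) (M : ℝ) : Prop where
  continuous : Continuous H
  strictMono : StrictMono H
  map_add_two_pi : ∀ t, H (t + 2 * π) = H t + 2 * π
  pos : 0 < M
  right_le : ∀ x r, 0 < r → r ≤ 2 * π → H (x + r) - H x ≤ M * (H x - H (x - r))
  left_le : ∀ x r, 0 < r → r ≤ 2 * π → H x - H (x - r) ≤ M * (H (x + r) - H x)

/-- The radii `2π / 2 ^ n`. -/
noncomputable def dyadicRadius (n : ℕ) : ℝ := 2 * π / 2 ^ n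

lemma dyadicRadius_pos (n : ℕ) : 0 < dyadicRadius n := by
  have := pi_pos
  unfold dyadicRadius
  positivity

lemma dyadicRadius_succ (n : ℕ) : dyadicRadius (n + 1) = dyadicRadius n / 2 := by
  unfold dyadicRadius
  rw [pow_succ]
  field_simp

lemma dyadicRadius_zero : dyadicRadius 0 = 2 * π := by simp [dyadicRadius]

lemma dyadicRadius_le (n : ℕ) : dyadicRadius n ≤ 2 * π := by
  unfold dyadicRadius
  exact div_le_self two_pi_pos.le (one_le_pow₀ (by norm_num))

lemma tendsto_dyadicRadius : Filter.Tendsto dyadicRadius Filter.atTop (nhds 0) := by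
  have h := (tendsto_pow_atTop_nhds_zero_of_lt_one (r := (1 / 2 : ℝ)) (by norm_num)
    (by norm_num)).const_mul (2 * π)
  rw [mul_zero] at h
  refine h.congr fun n => ?_
  rw [dyadicRadius, one_div, inv_pow]
  rfl

lemma exists_dyadicRadius_lt {τ : ℝ} (hτ : 0 < τ) (hτπ : τ ≤ π) :
    ∃ n, dyadicRadius (n + 2) < τ ∧ τ ≤ dyadicRadius (n + 1) := by
  classical
  have hex : ∃ n, dyadicRadius (n + 2) < τ := by
    have h := (tendsto_dyadicRadius.comp (Filter.tendsto_add_atTop_nat 2)).eventually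
      (gt_mem_nhds hτ)
    exact h.exists
  refine ⟨Nat.find hex, Nat.find_spec hex, ?_⟩
  cases h : Nat.find hex with
  | zero =>
    rw [zero_add, dyadicRadius_succ, dyadicRadius_zero]
    linarith
  | succ m =>
    have := Nat.find_min hex (m := m) (by omega)
    exact not_lt.1 this

namespace IsQuasisymmetricLift

variable {H : ℝ → ℝ} {M : ℝ}

lemma doubling (hH : IsQuasisymmetricLift H M) (x : ℝ) {r : ℝ} (hr : 0 < r) (hr' : r ≤ 2 * π) :
    H (x + 2 * r) - H (x - 2 * r) ≤ (1 + M) * (H (x + r) - H (x - r)) := by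
  have h1 := hH.right_le (x + r) r hr hr'
  have h2 := hH.left_le (x - r) r hr hr'
  rw [show x + r + r = x + 2 * r by ring, show x + r - r = x by ring] at h1
  rw [show x - r - r = x - 2 * r by ring, show x - r + r = x by ring] at h2
  linarith

lemma decay (hH : IsQuasisymmetricLift H M) (x : ℝ) {r : ℝ} (hr : 0 < r) (hr' : r ≤ 2 * π) :
    H (x + r / 2) - H (x - r / 2) ≤ M / (1 + M) * (H (x + r) - H (x - r)) := by
  have hM := hH.pos
  have h1 := hH.left_le (x + r / 2) (r / 2) (by linarith) (by linarith)
  have h2 := hH.right_le (x - r / 2) (r / 2) (by linarith) (by linarith)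
  rw [show x + r / 2 + r / 2 = x + r by ring, show x + r / 2 - r / 2 = x by ring] at h1
  rw [show x - r / 2 - r / 2 = x - r by ring, show x - r / 2 + r / 2 = x by ring] at h2
  rw [div_mul_eq_mul_div, le_div_iff₀ (by linarith)]
  linarith

lemma surjective (hH : IsQuasisymmetricLift H M) : Function.Surjective H := by
  intro u
  obtain ⟨n, hn⟩ := exists_translate_mem_Ico (u - H 0)
  have h0 := map_add_int_mul_two_pi hH.map_add_two_pi (-n) 0
  have h1 := hH.map_add_two_pi (0 + (-n : ℤ) * (2 * π))
  push_cast at h0 h1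
  have := intermediate_value_Icc (show (0 + -(n : ℝ) * (2 * π)) ≤ 0 + -n * (2 * π) + 2 * π by
    linarith [pi_pos]) hH.continuous.continuousOn
  obtain ⟨y, -, hy⟩ := this (show u ∈ Set.Icc _ _ from
    ⟨by linarith [hn.1], by linarith [hn.2]⟩)
  exact ⟨y, hy⟩

end IsQuasisymmetricLift

/-- The weight with which a pair of points enters the mean oscillation at scale `n`. -/
noncomputable def dyadicKernel (H : ℝ → ℝ) (n : ℕ) (x : ℝ) (p : ℝ × ℝ) : ENNReal :=
  {q : ℝ × ℝ × ℝ | q.2.1 ∈ Set.Ioc (H (q.1 - dyadicRadius n)) (H (q.1 + dyadicRadius n)) ∧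
    q.2.2 ∈ Set.Ioc (H (q.1 - dyadicRadius n)) (H (q.1 + dyadicRadius n))}.indicator
    (fun q => ENNReal.ofReal (1 / (dyadicRadius n *
      (H (q.1 + dyadicRadius n) - H (q.1 - dyadicRadius n)) ^ 2))) (x, p)

lemma measurable_dyadicKernel {H : ℝ → ℝ} (hH : Continuous H) (n : ℕ) :
    Measurable (Function.uncurry (dyadicKernel H n)) := by
  have hm := hH.measurable
  have h : Measurable fun q : ℝ × ℝ × ℝ => dyadicKernel H n q.1 q.2 := by
    unfold dyadicKernel
    refine Measurable.indicator (by fun_prop) ?_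
    have hlo : Measurable fun q : ℝ × ℝ × ℝ => H (q.1 - dyadicRadius n) := by fun_prop
    have hhi : Measurable fun q : ℝ × ℝ × ℝ => H (q.1 + dyadicRadius n) := by fun_prop
    have hu : Measurable fun q : ℝ × ℝ × ℝ => q.2.1 := by fun_prop
    have hv : Measurable fun q : ℝ × ℝ × ℝ => q.2.2 := by fun_prop
    exact ((measurableSet_lt hlo hu).inter (measurableSet_le hu hhi)).inter
      ((measurableSet_lt hlo hv).inter (measurableSet_le hv hhi))
  exact h

lemma IsQuasisymmetricLift.tsum_lintegral_dyadicKernel_le {H : ℝ → ℝ} {M : ℝ}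
    (hH : IsQuasisymmetricLift H M) :
    ∃ C : ℝ, 0 < C ∧ ∀ p : ℝ × ℝ, p.1 ≠ p.2 →
      ∑' n, ∫⁻ x, dyadicKernel H n x p ≤ ENNReal.ofReal (C / (p.1 - p.2) ^ 2) := by
  have hM := hH.pos
  set lam := M / (1 + M) with hlam
  have hlam0 : 0 ≤ lam := by positivity
  have hlam1 : lam < 1 := by rw [hlam, div_lt_one (by positivity)]; linarith
  have hlam2 : 0 < 1 - lam ^ 2 := by nlinarith
  refine ⟨2 * (1 + M) ^ 4 / (1 - lam ^ 2), by positivity, fun p hp => ?_⟩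
  obtain ⟨u, v⟩ := p
  simp only at hp ⊢
  obtain ⟨y, rfl⟩ := hH.surjective u
  set δ := |H y - v| / (1 + M) with hδ
  have hδ0 : 0 < δ := div_pos (abs_pos.2 (sub_ne_zero.2 hp)) (by positivity)
  set l : ℕ → ℝ := fun n => H (y + dyadicRadius n) - H (y - dyadicRadius n) with hl
  have hl0 : ∀ n, 0 < l n := fun n => sub_pos.2 (hH.strictMono (by
    linarith [dyadicRadius_pos n]))
  have hdec : ∀ n, l (n + 1) ≤ lam * l n := fun n => by
    have := hH.decay y (dyadicRadius_pos n) (dyadicRadius_le n)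
    rw [← dyadicRadius_succ] at this
    exact this
  have hterm : ∀ n, ∫⁻ x, dyadicKernel H n x (H y, v) ≤
      ENNReal.ofReal (2 * (1 + M) ^ 2 * (if δ ≤ l n then 1 / l n ^ 2 else 0)) := by
    intro n
    set r := dyadicRadius n with hr
    have hr0 : 0 < r := dyadicRadius_pos n
    have hr2 : r ≤ 2 * π := dyadicRadius_le n
    calc ∫⁻ x, dyadicKernel H n x (H y, v)
        ≤ ∫⁻ x, (Set.Ico (y - r) (y + r)).indicator (fun _ => ENNReal.ofReal
            ((1 + M) ^ 2 / r * (if δ ≤ l n then 1 / l n ^ 2 else 0))) x := by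
          refine lintegral_mono fun x => ?_
          unfold dyadicKernel
          by_cases hx : H y ∈ Set.Ioc (H (x - r)) (H (x + r)) ∧ v ∈ Set.Ioc (H (x - r)) (H (x + r))
          swap
          · rw [Set.indicator_of_notMem (by exact hx)]
            simp
          rw [Set.indicator_of_mem (by exact hx)]
          simp only [← hr]
          obtain ⟨⟨h1, h2⟩, h3, h4⟩ := hx
          have h5 := hH.strictMono.lt_iff_lt.1 h1
          have h6 := hH.strictMono.le_iff_le.1 h2
          rw [Set.indicator_of_mem (show x ∈ Set.Ico (y - r) (y + r) from
            ⟨by linarith, by linarith⟩)]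
          have hmono := hH.strictMono.monotone
          have hx0 : 0 < H (x + r) - H (x - r) := sub_pos.2 (hH.strictMono (by linarith))
          have h7 : H (x + r) - H (x - r) ≤ (1 + M) * l n := by
            refine le_trans ?_ (hH.doubling y hr0 hr2)
            exact sub_le_sub (hmono (by linarith)) (hmono (by linarith))
          have h8 : l n ≤ (1 + M) * (H (x + r) - H (x - r)) := by
            refine le_trans ?_ (hH.doubling x hr0 hr2)
            exact sub_le_sub (hmono (by linarith)) (hmono (by linarith))
          have h9 : δ ≤ l n := by
            rw [hδ, div_le_iff₀ (by positivity), abs_le]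
            constructor <;> linarith
          rw [if_pos h9]
          apply ENNReal.ofReal_le_ofReal
          have hln := hl0 n
          rw [div_mul_div_comm, mul_one, div_le_div_iff₀ (by positivity) (by positivity)]
          have := pow_le_pow_left₀ hln.le h8 2
          rw [mul_pow] at this
          nlinarith
      _ = _ := by
          rw [lintegral_indicator measurableSet_Ico, setLIntegral_const, Real.volume_Ico,
            mul_comm, ← ENNReal.ofReal_mul (by linarith)]
          congr 1
          field_simp
          ring
  refine (ENNReal.tsum_le_tsum hterm).trans (ENNReal.tsum_le_of_sum_range_le fun N => ?_)
  rw [← ENNReal.ofReal_sum_of_nonneg fun n _ => by positivity, ← Finset.mul_sum]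
  apply ENNReal.ofReal_le_ofReal
  calc _ ≤ 2 * (1 + M) ^ 2 * (1 / ((1 - lam ^ 2) * δ ^ 2)) := by
        gcongr
        exact sum_ite_inv_sq_le hl0 hlam0 hlam1 hdec hδ0 N
    _ = _ := by
        rw [hδ, div_pow |H y - v|, sq_abs]
        have : H y - v ≠ 0 := sub_ne_zero.2 hp
        field_simp

lemma ofReal_mul_meanSqOsc_eq_lintegral {F : ℝ → ℂ} {H : ℝ → ℝ} (hF : Continuous F)
    {x : ℝ} {n : ℕ} {I : Set ℝ}
    (hsub : Set.Ioc (H (x - dyadicRadius n)) (H (x + dyadicRadius n)) ⊆ I) :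
    ENNReal.ofReal (1 / dyadicRadius n) *
        meanSqOsc F (H (x - dyadicRadius n)) (H (x + dyadicRadius n)) =
      ∫⁻ p, dyadicKernel H n x p * ENNReal.ofReal (‖F p.1 - F p.2‖ ^ 2)
        ∂((volume.restrict I).prod (volume.restrict I)) := by
  have hr := dyadicRadius_pos n
  set r := dyadicRadius n with hr'
  set J := Set.Ioc (H (x - r)) (H (x + r)) with hJ
  have hmeas : Measurable fun p : ℝ × ℝ => ENNReal.ofReal (‖F p.1 - F p.2‖ ^ 2) :=
    ENNReal.measurable_ofReal.comp (Continuous.measurable (by fun_prop))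
  have hker : ∀ p : ℝ × ℝ, dyadicKernel H n x p * ENNReal.ofReal (‖F p.1 - F p.2‖ ^ 2) =
      (J ×ˢ J).indicator (fun p => ENNReal.ofReal (1 / (r * (H (x + r) - H (x - r)) ^ 2)) *
        ENNReal.ofReal (‖F p.1 - F p.2‖ ^ 2)) p := by
    intro p
    unfold dyadicKernel
    by_cases hp : p.1 ∈ J ∧ p.2 ∈ J
    · rw [Set.indicator_of_mem (by exact hp), Set.indicator_of_mem (by exact hp)]
    · rw [Set.indicator_of_notMem (by exact hp), Set.indicator_of_notMem (by exact hp), zero_mul]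
  simp only [hker]
  rw [lintegral_indicator (measurableSet_Ioc.prod measurableSet_Ioc), Measure.prod_restrict,
    Measure.restrict_restrict (measurableSet_Ioc.prod measurableSet_Ioc),
    Set.inter_eq_left.2 (Set.prod_mono hsub hsub), lintegral_const_mul _ hmeas,
    ← Measure.prod_restrict, lintegral_prod _ hmeas.aemeasurable, meanSqOsc, ← mul_assoc,
    ← ENNReal.ofReal_mul (by positivity)]
  congr 2
  rw [div_mul_div_comm, one_mul]

lemma IsQuasisymmetricLift.tsum_lintegral_meanSqOsc_le {H : ℝ → ℝ} {M : ℝ}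
    (hH : IsQuasisymmetricLift H M) :
    ∃ C : ℝ, 0 < C ∧ ∀ F : ℝ → ℂ, Continuous F → Function.Periodic F (2 * π) →
      ∑' n, ∫⁻ x in Set.Ico 0 (2 * π), ENNReal.ofReal (1 / dyadicRadius n) *
        meanSqOsc F (H (x - dyadicRadius n)) (H (x + dyadicRadius n)) ≤
      ENNReal.ofReal C * angularEnergy F := by
  obtain ⟨C, hC, hker⟩ := hH.tsum_lintegral_dyadicKernel_le
  refine ⟨9 * C, by positivity, fun F hF hper => ?_⟩
  set I := Set.Ico (H 0 - 2 * π) (H 0 - 2 * π + 6 * π) with hI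
  set μ := (volume.restrict I).prod (volume.restrict I) with hμ
  have hpi := pi_pos
  have hsub : ∀ n, ∀ x ∈ Set.Ico 0 (2 * π),
      Set.Ioc (H (x - dyadicRadius n)) (H (x + dyadicRadius n)) ⊆ I := by
    intro n x hx v hv
    have hr := dyadicRadius_le n
    have h1 := hH.map_add_two_pi (-(2 * π))
    have h2 := hH.map_add_two_pi 0
    have h3 := hH.map_add_two_pi (0 + 2 * π)
    rw [neg_add_cancel] at h1
    have h4 : H (-(2 * π)) ≤ H (x - dyadicRadius n) :=
      hH.strictMono.monotone (by linarith [hx.1])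
    have h5 : H (x + dyadicRadius n) < H (0 + 2 * π + 2 * π) := hH.strictMono (by linarith [hx.2])
    exact ⟨by linarith [hv.1], by linarith [hv.2]⟩
  have hmeasF : Measurable fun p : ℝ × ℝ => ENNReal.ofReal (‖F p.1 - F p.2‖ ^ 2) :=
    ENNReal.measurable_ofReal.comp (Continuous.measurable (by fun_prop))
  have hmeas := fun n => measurable_dyadicKernel hH.continuous n
  set e : ℝ → ℝ → ENNReal := fun s t => ENNReal.ofReal (‖F s - F t‖ ^ 2 /
      ‖Complex.exp ((s : ℝ) * Complex.I) - Complex.exp ((t : ℝ) * Complex.I)‖ ^ 2) with he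
  have hk : ∀ s : ℝ, Function.Periodic (e s) (2 * π) := fun s t => by
    have h1 := exp_periodic t
    simp only [he] at h1 ⊢
    rw [hper t, h1]
  have hk' : Function.Periodic (fun s : ℝ => ∫⁻ t in Set.Ico 0 (2 * π), e s t) (2 * π) :=
    fun s => by
      have h1 := exp_periodic s
      simp only [he] at h1 ⊢
      rw [hper s, h1]
  have hpoint : ∀ p : ℝ × ℝ, (∑' n, ∫⁻ x, dyadicKernel H n x p) *
      ENNReal.ofReal (‖F p.1 - F p.2‖ ^ 2) ≤ ENNReal.ofReal C * e p.1 p.2 := by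
    intro p
    by_cases hFp : F p.1 = F p.2
    · simp [hFp]
    have hp : p.1 ≠ p.2 := fun h => hFp (by rw [h])
    have hchord : 0 < ‖Complex.exp (p.1 * Complex.I) - Complex.exp (p.2 * Complex.I)‖ := by
      rw [norm_pos_iff, sub_ne_zero]
      intro h
      obtain ⟨m, hm⟩ := exists_int_of_circleExp_eq (s := p.1) (t := p.2)
        (Subtype.ext (by simpa [coe_circleExp_eq] using h))
      refine hFp ?_
      rw [show p.1 = p.2 + m * (2 * π) by linarith]
      exact hper.int_mul m p.2
    refine (mul_le_mul_left (hker p hp) _).trans ?_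
    rw [← ENNReal.ofReal_mul (by positivity), ← ENNReal.ofReal_mul hC.le]
    apply ENNReal.ofReal_le_ofReal
    rw [div_mul_eq_mul_div, mul_div_assoc]
    refine mul_le_mul_of_nonneg_left (div_le_div_of_nonneg_left (by positivity) (by positivity) ?_)
      hC.le
    rw [← sq_abs (p.1 - p.2)]
    exact pow_le_pow_left₀ hchord.le (norm_exp_sub_exp_le _ _) 2
  calc _ = ∑' n, ∫⁻ x in Set.Ico 0 (2 * π),
        ∫⁻ p, dyadicKernel H n x p * ENNReal.ofReal (‖F p.1 - F p.2‖ ^ 2) ∂μ := by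
        refine tsum_congr fun n => setLIntegral_congr_fun measurableSet_Ico fun x hx => ?_
        exact ofReal_mul_meanSqOsc_eq_lintegral hF (hsub n x hx)
    _ = ∑' n, ∫⁻ p, (∫⁻ x in Set.Ico 0 (2 * π),
        dyadicKernel H n x p * ENNReal.ofReal (‖F p.1 - F p.2‖ ^ 2)) ∂μ := by
        refine tsum_congr fun n => lintegral_lintegral_swap ?_
        exact ((hmeas n).mul (hmeasF.comp measurable_snd)).aemeasurable
    _ ≤ ∑' n, ∫⁻ p, (∫⁻ x, dyadicKernel H n x p) *
          ENNReal.ofReal (‖F p.1 - F p.2‖ ^ 2) ∂μ := by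
        refine ENNReal.tsum_le_tsum fun n => lintegral_mono fun p => ?_
        rw [← lintegral_mul_const' _ _ ENNReal.ofReal_ne_top]
        exact setLIntegral_le_lintegral _ _
    _ = ∫⁻ p, ∑' n, (∫⁻ x, dyadicKernel H n x p) *
          ENNReal.ofReal (‖F p.1 - F p.2‖ ^ 2) ∂μ := by
        refine (lintegral_tsum fun n => ?_).symm
        exact ((hmeas n).lintegral_prod_left'.mul hmeasF).aemeasurable
    _ ≤ ∫⁻ p, ENNReal.ofReal C * e p.1 p.2 ∂μ := by
        refine lintegral_mono fun p => ?_
        rw [ENNReal.tsum_mul_right]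
        exact hpoint p
    _ = ENNReal.ofReal C * ∫⁻ s in I, ∫⁻ t in I, e s t := by
        have hme : Measurable fun p : ℝ × ℝ => e p.1 p.2 := by
          simp only [he]
          exact ENNReal.measurable_ofReal.comp (Measurable.div
            (Continuous.measurable (by fun_prop)) (Continuous.measurable (by fun_prop)))
        rw [lintegral_const_mul _ hme, lintegral_prod _ hme.aemeasurable]
    _ = _ := by
        simp only [hI, setLIntegral_Ico_add_six_pi (hk _)]
        rw [lintegral_const_mul' _ _ (by norm_num), setLIntegral_Ico_add_six_pi hk',
          ENNReal.ofReal_mul (by norm_num), angularEnergy, ENNReal.ofReal_ofNat]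
        ring

/-- The energy is controlled by dyadic averages of squared differences. -/
lemma angularEnergy_le_tsum {g : ℝ → ℂ} (hg : Continuous g)
    (hper : Function.Periodic g (2 * π)) :
    angularEnergy g ≤ ∑' n, ENNReal.ofReal (4 * π ^ 2 / dyadicRadius n ^ 2) *
      ∫⁻ x in Set.Ico 0 (2 * π), ∫⁻ τ in Set.Icc (-dyadicRadius (n + 1)) (dyadicRadius (n + 1)),
        ENNReal.ofReal (‖g (x + τ) - g x‖ ^ 2) := by
  have hpi := pi_pos
  set I : ℕ → Set ℝ := fun n => Set.Icc (-dyadicRadius (n + 1)) (dyadicRadius (n + 1)) with hI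
  have hcontg : Continuous fun p : ℝ × ℝ => ‖g (p.1 + p.2) - g p.1‖ ^ 2 := by fun_prop
  have hmeas : Measurable fun p : ℝ × ℝ => ENNReal.ofReal (‖g (p.1 + p.2) - g p.1‖ ^ 2) :=
    ENNReal.measurable_ofReal.comp hcontg.measurable
  have hk : ∀ s : ℝ, Function.Periodic (fun t : ℝ => ENNReal.ofReal (‖g s - g t‖ ^ 2 /
      ‖Complex.exp ((s : ℝ) * Complex.I) - Complex.exp ((t : ℝ) * Complex.I)‖ ^ 2)) (2 * π) :=
    fun s t => by
      have h1 := exp_periodic t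
      simp only at h1 ⊢
      rw [hper t, h1]
  have hpoint : ∀ x, ∀ τ ∈ Set.Ico (-π) π, ENNReal.ofReal (‖g x - g (x + τ)‖ ^ 2 /
      ‖Complex.exp ((x : ℝ) * Complex.I) - Complex.exp ((x + τ : ℝ) * Complex.I)‖ ^ 2) ≤
      ∑' n, ENNReal.ofReal (4 * π ^ 2 / dyadicRadius n ^ 2) *
        (I n).indicator (fun τ => ENNReal.ofReal (‖g (x + τ) - g x‖ ^ 2)) τ := by
    intro x τ hτ
    by_cases hτ0 : τ = 0
    · simp [hτ0]
    have habs : |τ| ≤ π := abs_le.2 ⟨hτ.1, hτ.2.le⟩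
    obtain ⟨n, hn1, hn2⟩ := exists_dyadicRadius_lt (abs_pos.2 hτ0) habs
    refine le_trans ?_ (ENNReal.le_tsum n)
    rw [Set.indicator_of_mem (show τ ∈ I n from abs_le.1 hn2),
      ← ENNReal.ofReal_mul (by positivity)]
    apply ENNReal.ofReal_le_ofReal
    have hr := dyadicRadius_pos n
    rw [dyadicRadius_succ, dyadicRadius_succ] at hn1
    have hchord : dyadicRadius n / (2 * π) ≤
        ‖Complex.exp ((x : ℝ) * Complex.I) - Complex.exp ((x + τ : ℝ) * Complex.I)‖ := by
      rw [norm_exp_sub_exp, show (x - (x + τ)) / 2 = -(τ / 2) by ring, sin_neg, abs_neg]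
      have h1 := mul_abs_le_abs_sin (x := τ / 2) (by rw [abs_div, abs_two]; linarith)
      rw [abs_div, abs_two] at h1
      calc dyadicRadius n / (2 * π) = 2 * (2 / π * ((dyadicRadius n / 2 / 2) / 2)) := by
            field_simp
        _ ≤ 2 * (2 / π * (|τ| / 2)) := by gcongr
        _ ≤ _ := by linarith
    rw [norm_sub_rev (g x)]
    calc _ ≤ ‖g (x + τ) - g x‖ ^ 2 / (dyadicRadius n / (2 * π)) ^ 2 := by
          refine div_le_div_of_nonneg_left (by positivity) (by positivity) ?_
          exact pow_le_pow_left₀ (by positivity) hchord 2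
      _ = _ := by
          field_simp
          ring
  calc angularEnergy g = ∫⁻ x in Set.Ico 0 (2 * π), ∫⁻ τ in Set.Ico (-π) π,
        ENNReal.ofReal (‖g x - g (x + τ)‖ ^ 2 /
      ‖Complex.exp ((x : ℝ) * Complex.I) - Complex.exp ((x + τ : ℝ) * Complex.I)‖ ^ 2) := by
        refine lintegral_congr fun x => ?_
        rw [setLIntegral_Ico_comp_add (fun t => ENNReal.ofReal (‖g x - g t‖ ^ 2 /
      ‖Complex.exp ((x : ℝ) * Complex.I) - Complex.exp ((t : ℝ) * Complex.I)‖ ^ 2)),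
          show x + π = x + -π + 2 * π by ring, setLIntegral_Ico_add_two_pi (hk x)]
    _ ≤ ∫⁻ x in Set.Ico 0 (2 * π), ∫⁻ τ,
        ∑' n, ENNReal.ofReal (4 * π ^ 2 / dyadicRadius n ^ 2) *
          (I n).indicator (fun τ => ENNReal.ofReal (‖g (x + τ) - g x‖ ^ 2)) τ := by
        refine lintegral_mono fun x => ?_
        exact (setLIntegral_mono' measurableSet_Ico (hpoint x)).trans
          (setLIntegral_le_lintegral _ _)
    _ = ∫⁻ x in Set.Ico 0 (2 * π), ∑' n, ENNReal.ofReal (4 * π ^ 2 / dyadicRadius n ^ 2) *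
          ∫⁻ τ in I n, ENNReal.ofReal (‖g (x + τ) - g x‖ ^ 2) := by
        refine lintegral_congr fun x => ?_
        have hcx : Continuous fun τ => ‖g (x + τ) - g x‖ ^ 2 := by fun_prop
        have hx : Measurable fun τ => ENNReal.ofReal (‖g (x + τ) - g x‖ ^ 2) :=
          ENNReal.measurable_ofReal.comp hcx.measurable
        rw [lintegral_tsum fun n =>
          ((hx.indicator measurableSet_Icc).const_mul _).aemeasurable]
        refine tsum_congr fun n => ?_
        rw [lintegral_const_mul' _ _ ENNReal.ofReal_ne_top, lintegral_indicator measurableSet_Icc]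
    _ = _ := by
        rw [lintegral_tsum fun n => (hmeas.lintegral_prod_right'.const_mul _).aemeasurable]
        exact tsum_congr fun n => lintegral_const_mul' _ _ ENNReal.ofReal_ne_top

lemma lintegral_lintegral_add_le {B D : ℝ → ENNReal} (hB : Measurable B)
    (hper : Function.Periodic B (2 * π)) {r : ℝ} :
    ∫⁻ x in Set.Ico 0 (2 * π), ∫⁻ τ in Set.Icc (-r) r, (B (x + τ) + (B x + D x)) =
      ENNReal.ofReal (2 * r) * (2 * (∫⁻ x in Set.Ico 0 (2 * π), B x) +
        ∫⁻ x in Set.Ico 0 (2 * π), D x) := by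
  have h1 : ∀ x, ∫⁻ τ in Set.Icc (-r) r, (B (x + τ) + (B x + D x)) =
      (∫⁻ τ in Set.Icc (-r) r, B (x + τ)) + ENNReal.ofReal (2 * r) * (B x + D x) := fun x => by
    rw [lintegral_add_left (by fun_prop), setLIntegral_const, Real.volume_Icc, mul_comm]
    ring_nf
  have hB2 : Measurable fun p : ℝ × ℝ => B (p.1 + p.2) := by fun_prop
  have h2 : ∫⁻ x in Set.Ico 0 (2 * π), ∫⁻ τ in Set.Icc (-r) r, B (x + τ) =
      ENNReal.ofReal (2 * r) * ∫⁻ x in Set.Ico 0 (2 * π), B x := by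
    rw [lintegral_lintegral_swap hB2.aemeasurable]
    have h3 : ∀ τ, ∫⁻ x in Set.Ico 0 (2 * π), B (x + τ) = ∫⁻ x in Set.Ico 0 (2 * π), B x :=
      fun τ => by
        simp only [add_comm _ τ]
        rw [setLIntegral_Ico_comp_add, add_zero, setLIntegral_Ico_add_two_pi hper]
    simp only [h3]
    rw [setLIntegral_const, Real.volume_Icc, mul_comm]
    ring_nf
  simp only [h1]
  rw [lintegral_add_left hB2.lintegral_prod_right', h2,
    lintegral_const_mul' _ _ ENNReal.ofReal_ne_top, lintegral_add_left hB]
  ring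

/-- Squared distance from a function to its mean over the `n`th quasisymmetric interval. -/
noncomputable def sqDistMean (F : ℝ → ℂ) (H : ℝ → ℝ) (n : ℕ) (x : ℝ) : ENNReal :=
  ENNReal.ofReal (‖F (H x) -
    intervalMean F (H (x - dyadicRadius n)) (H (x + dyadicRadius n))‖ ^ 2)

lemma intervalMean_add_two_pi {F : ℝ → ℂ} (hper : Function.Periodic F (2 * π)) (a b : ℝ) :
    intervalMean F (a + 2 * π) (b + 2 * π) = intervalMean F a b := by
  have h : ∫ u in a + 2 * π..b + 2 * π, F u = ∫ u in a..b, F u := by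
    rw [← intervalIntegral.integral_comp_add_right]
    exact intervalIntegral.integral_congr fun u _ => hper u
  rw [intervalMean, h, add_sub_add_right_eq_sub, intervalMean]

namespace IsQuasisymmetricLift

variable {H : ℝ → ℝ} {M : ℝ}

lemma sqDistMean_periodic (hH : IsQuasisymmetricLift H M) {F : ℝ → ℂ}
    (hper : Function.Periodic F (2 * π)) (n : ℕ) :
    Function.Periodic (sqDistMean F H n) (2 * π) := fun x => by
  unfold sqDistMean
  rw [hH.map_add_two_pi, hper, add_sub_right_comm, hH.map_add_two_pi, add_right_comm,
    hH.map_add_two_pi, intervalMean_add_two_pi hper]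

lemma continuous_mean (hH : IsQuasisymmetricLift H M) {F : ℝ → ℂ} (hF : Continuous F) (n : ℕ) :
    Continuous fun x => intervalMean F (H (x - dyadicRadius n)) (H (x + dyadicRadius n)) := by
  have hc := hH.continuous
  exact continuous_intervalMean hF (by fun_prop) (by fun_prop)
    fun x => hH.strictMono (by linarith [dyadicRadius_pos n])

lemma measurable_sqDistMean (hH : IsQuasisymmetricLift H M) {F : ℝ → ℂ} (hF : Continuous F)
    (n : ℕ) : Measurable (sqDistMean F H n) := by
  have h1 := hH.continuous_mean hF n
  have h2 := hH.continuous
  exact ENNReal.measurable_ofReal.comp (Continuous.measurable (by fun_prop))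

lemma mean_sub_mean_sq_le (hH : IsQuasisymmetricLift H M) {F : ℝ → ℂ} (hF : Continuous F)
    (n : ℕ) (x : ℝ) {τ : ℝ} (hτ : |τ| ≤ dyadicRadius (n + 1)) :
    ENNReal.ofReal (‖intervalMean F (H (x + τ - dyadicRadius (n + 1)))
        (H (x + τ + dyadicRadius (n + 1))) -
      intervalMean F (H (x - dyadicRadius (n + 1))) (H (x + dyadicRadius (n + 1)))‖ ^ 2) ≤
    ENNReal.ofReal (((1 + M) ^ 2) ^ 2) *
      meanSqOsc F (H (x - dyadicRadius n)) (H (x + dyadicRadius n)) := by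
  have hM := hH.pos
  have hmono := hH.strictMono.monotone
  have hr := dyadicRadius_pos (n + 1)
  have hr1 := dyadicRadius_le (n + 1)
  have hr2 := dyadicRadius_le n
  have hrs := dyadicRadius_succ n
  set r := dyadicRadius (n + 1)
  have hrn : dyadicRadius n = 2 * r := by linarith
  rw [hrn] at hr2 ⊢
  obtain ⟨hτ1, hτ2⟩ := abs_le.1 hτ
  have h1 := hH.doubling x hr hr1
  have h2 := hH.doubling (x + τ) hr hr1
  have h3 := hH.doubling (x + τ) (r := 2 * r) (by linarith) hr2
  have h4 : H (x + 2 * r) ≤ H (x + τ + 2 * (2 * r)) := hmono (by linarith)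
  have h5 : H (x + τ - 2 * (2 * r)) ≤ H (x - 2 * r) := hmono (by linarith)
  have h6 : H (x - r) < H (x + r) := hH.strictMono (by linarith)
  refine ofReal_norm_intervalMean_sub_intervalMean_sq_le hF (hH.strictMono (by linarith)) h6
    (hmono (by linarith)) (hmono (by linarith)) (hmono (by linarith)) (hmono (by linarith)) ?_ ?_
  · nlinarith [mul_le_mul_of_nonneg_left h2 (by linarith : 0 ≤ 1 + M)]
  · nlinarith [mul_pos hM (sub_pos.2 h6), mul_pos hM (mul_pos hM (sub_pos.2 h6))]

lemma sq_sub_le (hH : IsQuasisymmetricLift H M) {F : ℝ → ℂ} (hF : Continuous F)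
    (n : ℕ) (x : ℝ) {τ : ℝ} (hτ : |τ| ≤ dyadicRadius (n + 1)) :
    ENNReal.ofReal (‖F (H (x + τ)) - F (H x)‖ ^ 2) ≤
      3 * (sqDistMean F H (n + 1) (x + τ) + (sqDistMean F H (n + 1) x +
        ENNReal.ofReal (((1 + M) ^ 2) ^ 2) *
          meanSqOsc F (H (x - dyadicRadius n)) (H (x + dyadicRadius n)))) := by
  refine le_trans ?_ (mul_le_mul_right (add_le_add_right (add_le_add_right
    (hH.mean_sub_mean_sq_le hF n x hτ) _) _) _)
  unfold sqDistMean
  rw [← ENNReal.ofReal_add (by positivity) (by positivity),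
    ← ENNReal.ofReal_add (by positivity) (by positivity),
    ← ENNReal.ofReal_ofNat, ← ENNReal.ofReal_mul (by norm_num)]
  apply ENNReal.ofReal_le_ofReal
  generalize intervalMean F (H (x + τ - dyadicRadius (n + 1)))
        (H (x + τ + dyadicRadius (n + 1))) = z
  generalize intervalMean F (H (x - dyadicRadius (n + 1))) (H (x + dyadicRadius (n + 1))) = w
  have h : ‖F (H (x + τ)) - F (H x)‖ ≤ ‖F (H (x + τ)) - z‖ + ‖F (H x) - w‖ + ‖z - w‖ := by
    calc _ = ‖(F (H (x + τ)) - z) - (F (H x) - w) + (z - w)‖ := by congr 1; ring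
      _ ≤ _ := (norm_add_le _ _).trans (add_le_add_left (norm_sub_le _ _) _)
  refine (pow_le_pow_left₀ (norm_nonneg _) h 2).trans ?_
  nlinarith [sq_nonneg (‖F (H (x + τ)) - z‖ - ‖F (H x) - w‖),
    sq_nonneg (‖F (H (x + τ)) - z‖ - ‖z - w‖), sq_nonneg (‖F (H x) - w‖ - ‖z - w‖)]

lemma tsum_lintegral_sqDistMean_le (hH : IsQuasisymmetricLift H M) {F : ℝ → ℂ}
    (hF : Continuous F) :
    ∑' n, ∫⁻ x in Set.Ico 0 (2 * π),
        ENNReal.ofReal (1 / dyadicRadius n) * sqDistMean F H n x ≤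
      12 * (ENNReal.ofReal (((1 + M) ^ 2) ^ 2) * ∑' n, ∫⁻ x in Set.Ico 0 (2 * π),
        ENNReal.ofReal (1 / dyadicRadius n) *
          meanSqOsc F (H (x - dyadicRadius n)) (H (x + dyadicRadius n))) := by
  set G : ℕ → ℝ → ℂ := fun n x =>
    intervalMean F (H (x - dyadicRadius n)) (H (x + dyadicRadius n)) with hG
  have hGc : ∀ n, Continuous (G n) := fun n => hH.continuous_mean hF n
  have hGm : ∀ n, Measurable fun x => ENNReal.ofReal (‖G (n + 1) x - G n x‖ ^ 2) := fun n => by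
    have h1 := hGc n
    have h2 := hGc (n + 1)
    exact ENNReal.measurable_ofReal.comp (Continuous.measurable (by fun_prop))
  have hlim : ∀ x, Filter.Tendsto (fun n => G n x) Filter.atTop (nhds (F (H x))) := fun x => by
    refine tendsto_intervalMean hF ?_ ?_ fun n => hH.strictMono (by
      linarith [dyadicRadius_pos n])
    · have := (hH.continuous.tendsto (x - 0)).comp (tendsto_dyadicRadius.const_sub x)
      rwa [sub_zero] at this
    · have := (hH.continuous.tendsto (x + 0)).comp (tendsto_dyadicRadius.const_add x)
      rwa [add_zero] at this
  have hdiff : ∀ n x, ENNReal.ofReal (‖G (n + 1) x - G n x‖ ^ 2) ≤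
      ENNReal.ofReal (((1 + M) ^ 2) ^ 2) *
        meanSqOsc F (H (x - dyadicRadius n)) (H (x + dyadicRadius n)) := fun n x => by
    have hM := hH.pos
    have hmono := hH.strictMono.monotone
    have hr := dyadicRadius_pos (n + 1)
    have hrs := dyadicRadius_succ n
    have h1 := hH.doubling x hr (dyadicRadius_le _)
    have h6 : H (x - dyadicRadius (n + 1)) < H (x + dyadicRadius (n + 1)) :=
      hH.strictMono (by linarith)
    have h7 : H (x - dyadicRadius n) < H (x + dyadicRadius n) :=
      hH.strictMono (by linarith)
    rw [show 2 * dyadicRadius (n + 1) = dyadicRadius n by linarith] at h1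
    refine ofReal_norm_intervalMean_sub_intervalMean_sq_le hF h6 h7 (hmono (by linarith))
      (hmono (by linarith)) le_rfl le_rfl ?_ ?_
    · nlinarith [mul_pos hM (sub_pos.2 h6), mul_pos hM (mul_pos hM (sub_pos.2 h6))]
    · nlinarith [mul_pos hM (sub_pos.2 h7), mul_pos hM (mul_pos hM (sub_pos.2 h7))]
  calc _ = ∫⁻ x in Set.Ico 0 (2 * π), ∑' n,
        ENNReal.ofReal (1 / dyadicRadius n) * sqDistMean F H n x :=
        (lintegral_tsum fun n => ((hH.measurable_sqDistMean hF n).const_mul _).aemeasurable).symm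
    _ ≤ ∫⁻ x in Set.Ico 0 (2 * π), 12 * ∑' n, ENNReal.ofReal (1 / dyadicRadius n) *
          ENNReal.ofReal (‖G (n + 1) x - G n x‖ ^ 2) := by
        refine lintegral_mono fun x => tsum_mul_norm_sub_sq_le (hlim x)
          (fun n => (one_div_pos.2 (dyadicRadius_pos n)).le) fun n => ?_
        have := dyadicRadius_pos n
        rw [dyadicRadius_succ]
        field_simp
    _ = 12 * ∑' n, ∫⁻ x in Set.Ico 0 (2 * π), ENNReal.ofReal (1 / dyadicRadius n) *
          ENNReal.ofReal (‖G (n + 1) x - G n x‖ ^ 2) := by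
        rw [lintegral_const_mul' _ _ (by norm_num),
          lintegral_tsum fun n => ((hGm n).const_mul _).aemeasurable]
    _ ≤ _ := by
        refine mul_le_mul_right ?_ _
        rw [← ENNReal.tsum_mul_left]
        refine ENNReal.tsum_le_tsum fun n => ?_
        rw [← lintegral_const_mul' _ _ ENNReal.ofReal_ne_top]
        refine lintegral_mono fun x => ?_
        rw [mul_left_comm]
        exact mul_le_mul_right (hdiff n x) _

/-- Composition with a quasisymmetric lift is bounded for the energy. -/
theorem exists_angularEnergy_comp_le (hH : IsQuasisymmetricLift H M) :
    ∃ C : ℝ, 0 < C ∧ ∀ F : ℝ → ℂ, Continuous F → Function.Periodic F (2 * π) →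
      angularEnergy (F ∘ H) ≤ ENNReal.ofReal C * angularEnergy F := by
  obtain ⟨C, hC, hosc⟩ := hH.tsum_lintegral_meanSqOsc_le
  have hM := hH.pos
  have hpi := pi_pos
  set A := ((1 + M) ^ 2) ^ 2 with hA
  have hA0 : 0 < A := by positivity
  refine ⟨12 * π ^ 2 * (2 * (12 * (A * C)) + A * C), by positivity, fun F hF hper => ?_⟩
  have hperg : Function.Periodic (F ∘ H) (2 * π) := fun x => by
    simp only [Function.comp, hH.map_add_two_pi, hper (H x)]
  set c : ℕ → ENNReal := fun n => ENNReal.ofReal (1 / dyadicRadius n) with hc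
  set D : ℕ → ℝ → ENNReal := fun n x =>
    meanSqOsc F (H (x - dyadicRadius n)) (H (x + dyadicRadius n)) with hD
  have hD' : ∑' n, c n * ∫⁻ x in Set.Ico 0 (2 * π), D n x ≤
      ENNReal.ofReal C * angularEnergy F := by
    refine le_trans (le_of_eq (tsum_congr fun n => ?_)) (hosc F hF hper)
    exact (lintegral_const_mul' _ _ ENNReal.ofReal_ne_top).symm
  have hB : ∑' n, c n * ∫⁻ x in Set.Ico 0 (2 * π), sqDistMean F H n x ≤
      12 * (ENNReal.ofReal A * (ENNReal.ofReal C * angularEnergy F)) := by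
    refine le_trans (le_of_eq (tsum_congr fun n => ?_))
      ((hH.tsum_lintegral_sqDistMean_le hF).trans (by gcongr; exact hosc F hF hper))
    exact (lintegral_const_mul' _ _ ENNReal.ofReal_ne_top).symm
  have hB' : ∑' n, c n * ∫⁻ x in Set.Ico 0 (2 * π), sqDistMean F H (n + 1) x ≤
      ∑' n, c n * ∫⁻ x in Set.Ico 0 (2 * π), sqDistMean F H n x := by
    rw [tsum_eq_zero_add' (f := fun n => c n * ∫⁻ x in Set.Ico 0 (2 * π),
      sqDistMean F H n x) ENNReal.summable]
    refine le_trans (ENNReal.tsum_le_tsum fun n => ?_) le_add_self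
    refine mul_le_mul_left (ENNReal.ofReal_le_ofReal ?_) _
    have := dyadicRadius_pos n
    rw [dyadicRadius_succ]
    exact one_div_le_one_div_of_le (by positivity) (by linarith)
  have hterm : ∀ n, ENNReal.ofReal (4 * π ^ 2 / dyadicRadius n ^ 2) *
      ∫⁻ x in Set.Ico 0 (2 * π), ∫⁻ τ in Set.Icc (-dyadicRadius (n + 1)) (dyadicRadius (n + 1)),
        ENNReal.ofReal (‖(F ∘ H) (x + τ) - (F ∘ H) x‖ ^ 2) ≤
      ENNReal.ofReal (12 * π ^ 2) * (2 * (c n * ∫⁻ x in Set.Ico 0 (2 * π),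
        sqDistMean F H (n + 1) x) +
        ENNReal.ofReal A * (c n * ∫⁻ x in Set.Ico 0 (2 * π), D n x)) := by
    intro n
    have hr := dyadicRadius_pos n
    calc _ ≤ ENNReal.ofReal (4 * π ^ 2 / dyadicRadius n ^ 2) *
          ∫⁻ x in Set.Ico 0 (2 * π),
            ∫⁻ τ in Set.Icc (-dyadicRadius (n + 1)) (dyadicRadius (n + 1)),
          3 * (sqDistMean F H (n + 1) (x + τ) + (sqDistMean F H (n + 1) x +
            ENNReal.ofReal A * D n x)) := by
          refine mul_le_mul_right (lintegral_mono fun x =>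
            setLIntegral_mono' measurableSet_Icc fun τ hτ => ?_) _
          exact hH.sq_sub_le hF n x (abs_le.2 hτ)
      _ = ENNReal.ofReal (4 * π ^ 2 / dyadicRadius n ^ 2) *
          (3 * (ENNReal.ofReal (2 * dyadicRadius (n + 1)) *
            (2 * (∫⁻ x in Set.Ico 0 (2 * π), sqDistMean F H (n + 1) x) +
            ENNReal.ofReal A * ∫⁻ x in Set.Ico 0 (2 * π), D n x))) := by
          simp only [lintegral_const_mul' _ _ (show (3 : ENNReal) ≠ ⊤ by norm_num)]
          rw [lintegral_lintegral_add_le (D := fun x => ENNReal.ofReal A * D n x)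
            (hH.measurable_sqDistMean hF (n + 1))
            (hH.sqDistMean_periodic hper (n + 1)), lintegral_const_mul' _ _ ENNReal.ofReal_ne_top]
      _ = _ := by
          have h3 : ENNReal.ofReal (4 * π ^ 2 / dyadicRadius n ^ 2) * 3 *
              ENNReal.ofReal (2 * dyadicRadius (n + 1)) = ENNReal.ofReal (12 * π ^ 2) * c n := by
            rw [hc, ← ENNReal.ofReal_ofNat, ← ENNReal.ofReal_mul (by positivity),
              ← ENNReal.ofReal_mul (by positivity), ← ENNReal.ofReal_mul (by positivity),
              dyadicRadius_succ]
            congr 1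
            field_simp
            ring
          rw [← mul_assoc, ← mul_assoc, h3]
          ring
  calc angularEnergy (F ∘ H) ≤ _ := angularEnergy_le_tsum (hF.comp hH.continuous) hperg
    _ ≤ _ := ENNReal.tsum_le_tsum hterm
    _ = ENNReal.ofReal (12 * π ^ 2) * (2 * (∑' n, c n * ∫⁻ x in Set.Ico 0 (2 * π),
        sqDistMean F H (n + 1) x) +
        ENNReal.ofReal A * ∑' n, c n * ∫⁻ x in Set.Ico 0 (2 * π), D n x) := by
        rw [ENNReal.tsum_mul_left, ENNReal.tsum_add, ENNReal.tsum_mul_left, ENNReal.tsum_mul_left]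
    _ ≤ ENNReal.ofReal (12 * π ^ 2) *
        (2 * (12 * (ENNReal.ofReal A * (ENNReal.ofReal C * angularEnergy F))) +
        ENNReal.ofReal A * (ENNReal.ofReal C * angularEnergy F)) := by
        gcongr
        exact hB'.trans hB
    _ = _ := by
        rw [ENNReal.ofReal_mul (by positivity : 0 ≤ 12 * π ^ 2), ENNReal.ofReal_add (by positivity)
          (by positivity), ENNReal.ofReal_mul (by norm_num : (0 : ℝ) ≤ 2),
          ENNReal.ofReal_mul (q := A * C) (by norm_num : (0 : ℝ) ≤ 12), ENNReal.ofReal_mul hA0.le,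
          ENNReal.ofReal_ofNat, ENNReal.ofReal_ofNat]
        ring

end IsQuasisymmetricLift

lemma two_div_pi_mul_abs_le {x : ℝ} (hx : |x| ≤ π) : 2 / π * |x| ≤ 2 * |sin (x / 2)| := by
  have h := mul_abs_le_abs_sin (x := x / 2) (by rw [abs_div, abs_two]; linarith)
  rw [abs_div, abs_two] at h
  linarith

lemma two_mul_abs_sin_half_le (x : ℝ) : 2 * |sin (x / 2)| ≤ |x| := by
  have h := abs_sin_le_abs (x := x / 2)
  rw [abs_div, abs_two] at h
  linarith

/-- A lift displaces by a uniformly positive amount at a fixed scale. -/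
lemma exists_pos_le_sub {H : ℝ → ℝ} (hH : Continuous H) (hmono : StrictMono H)
    (hper : ∀ t, H (t + 2 * π) = H t + 2 * π) {b : ℝ} (hb : 0 < b) :
    ∃ m, 0 < m ∧ ∀ x, m ≤ H (x + b) - H x := by
  obtain ⟨x₀, -, hx₀⟩ := (isCompact_Icc (a := (0 : ℝ)) (b := 2 * π)).exists_isMinOn
    (Set.nonempty_Icc.2 two_pi_pos.le)
    (f := fun x => H (x + b) - H x) (by fun_prop)
  refine ⟨H (x₀ + b) - H x₀, sub_pos.2 (hmono (by linarith)), fun x => ?_⟩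
  obtain ⟨n, hn⟩ := exists_translate_mem_Ico x
  have h := isMinOn_iff.1 hx₀ _ (Set.Ico_subset_Icc_self hn)
  rw [add_right_comm, map_add_int_mul_two_pi hper, map_add_int_mul_two_pi hper] at h
  linarith

lemma exists_isQuasisymmetricLift {H : ℝ → ℝ} (hH : Continuous H) (hmono : StrictMono H)
    (hper : ∀ t, H (t + 2 * π) = H t + 2 * π) {k : ℝ} (hk : 0 < k)
    (hratio : ∀ α β : ℝ, (∀ n : ℤ, β ≠ n * (2 * π)) →
      2 * |sin ((H (α + β) - H α) / 2)| ≤ k * (2 * |sin ((H α - H (α - β)) / 2)|)) :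
    ∃ M, IsQuasisymmetricLift H M := by
  obtain ⟨b, hb0, hb1, hb⟩ := exists_forall_abs_sub_le hH hper
  obtain ⟨m, hm0, hm⟩ := exists_pos_le_sub hH hmono hper hb0
  have hpi := pi_gt_three
  have hmon := hmono.monotone
  have hne : ∀ r : ℝ, r ≠ 0 → |r| ≤ 1 → ∀ n : ℤ, r ≠ n * (2 * π) := by
    rintro r hr0 hr1 n rfl
    rw [abs_mul, abs_of_pos two_pi_pos] at hr1
    have hn : n ≠ 0 := by
      rintro rfl
      simp at hr0
    have : (1 : ℝ) ≤ |(n : ℝ)| := by exact_mod_cast Int.one_le_abs hn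
    nlinarith
  have hM1 : 0 < k * (π / 2) := by positivity
  have hM2 : 0 < 2 * π / m := by positivity
  have hsmall : ∀ x r : ℝ, r ≠ 0 → |r| ≤ b →
      |H (x + r) - H x| ≤ k * (π / 2) * |H x - H (x - r)| := by
    intro x r hr0 hrb
    have h1 := hb (x + r) x (by rw [add_sub_cancel_left]; linarith)
    have h3 := two_div_pi_mul_abs_le h1
    have h4 := two_mul_abs_sin_half_le (H x - H (x - r))
    have h5 := hratio x r (hne r hr0 (hrb.trans hb1))
    have h6 := h3.trans (h5.trans (mul_le_mul_of_nonneg_left h4 hk.le))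
    calc _ = π / 2 * (2 / π * |H (x + r) - H x|) := by field_simp
      _ ≤ π / 2 * (k * |H x - H (x - r)|) := by gcongr
      _ = _ := by ring
  have hlarge : ∀ z w : ℝ, z ≤ 2 * π → m ≤ w → z ≤ (k * (π / 2) + 2 * π / m) * w := by
    intro z w hz hw
    have h1 : 2 * π = 2 * π / m * m := by field_simp
    have h2 : 2 * π / m * m ≤ 2 * π / m * w := by gcongr
    nlinarith [mul_pos hM1 (hm0.trans_le hw)]
  refine ⟨k * (π / 2) + 2 * π / m, hH, hmono, hper, by positivity, fun x r hr hr' => ?_,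
    fun x r hr hr' => ?_⟩
  · have hw : 0 < H x - H (x - r) := sub_pos.2 (hmono (by linarith))
    rcases le_total r b with hrb | hrb
    · have h := hsmall x r hr.ne' (by rwa [abs_of_pos hr])
      rw [abs_of_pos (sub_pos.2 (hmono (by linarith))), abs_of_pos hw] at h
      nlinarith [mul_pos hM2 hw]
    · have h1 := hm (x - b)
      rw [sub_add_cancel] at h1
      have h2 : H (x - r) ≤ H (x - b) := hmon (by linarith)
      have h3 : H (x + r) ≤ H (x + 2 * π) := hmon (by linarith)
      rw [hper] at h3
      exact hlarge _ _ (by linarith) (by linarith)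
  · have hw : 0 < H (x + r) - H x := sub_pos.2 (hmono (by linarith))
    rcases le_total r b with hrb | hrb
    · have h := hsmall x (-r) (neg_ne_zero.2 hr.ne') (by rwa [abs_neg, abs_of_pos hr])
      rw [← sub_eq_add_neg, sub_neg_eq_add, abs_sub_comm, abs_sub_comm (H x) (H (x + r)),
        abs_of_pos (sub_pos.2 (hmono (by linarith))), abs_of_pos hw] at h
      nlinarith [mul_pos hM2 hw]
    · have h1 := hm x
      have h2 : H (x + b) ≤ H (x + r) := hmon (by linarith)
      have h3 : H (x - 2 * π) ≤ H (x - r) := hmon (by linarith)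
      have h4 := hper (x - 2 * π)
      rw [sub_add_cancel] at h4
      exact hlarge _ _ (by linarith) (by linarith)

/-- Points at a definite distance have images at a definite distance. -/
lemma abs_sin_half_ge {H : ℝ → ℝ} (hmono : StrictMono H)
    (hper : ∀ t, H (t + 2 * π) = H t + 2 * π) {b m : ℝ} (hbπ : b ≤ π) (hm0 : 0 < m)
    (hm : ∀ x, m ≤ H (x + b) - H x) {α β : ℝ} (hβ : b ≤ |β|) (hβ' : |β| ≤ π) :
    0 < sin (m / 2) ∧ sin (m / 2) ≤ |sin ((H (α + β) - H α) / 2)| := by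
  have key : ∀ x r : ℝ, b ≤ r → r ≤ π →
      0 < sin (m / 2) ∧ sin (m / 2) ≤ sin ((H (x + r) - H x) / 2) := by
    intro x r hr hr'
    have hmon := hmono.monotone
    have h1 : H (x + b) ≤ H (x + r) := hmon (by linarith)
    have h2 : H (x + r) ≤ H (x + 2 * π - b) := hmon (by linarith)
    have h3 := hm (x + 2 * π - b)
    rw [sub_add_cancel, hper] at h3
    have h4 := hm x
    have h5 : m / 2 ≤ π / 2 := by linarith
    refine ⟨sin_pos_of_pos_of_lt_pi (by positivity) (by linarith [pi_pos]), ?_⟩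
    rcases le_total ((H (x + r) - H x) / 2) (π / 2) with h | h
    · exact sin_le_sin_of_le_of_le_pi_div_two (by linarith [pi_pos]) h (by linarith)
    · rw [← sin_pi_sub ((H (x + r) - H x) / 2)]
      exact sin_le_sin_of_le_of_le_pi_div_two (by linarith [pi_pos]) (by linarith) (by linarith)
  rcases abs_cases β with ⟨h, -⟩ | ⟨h, -⟩
  · rw [h] at hβ hβ'
    exact (key α β hβ hβ').imp_right fun h1 => h1.trans (le_abs_self _)
  · rw [h] at hβ hβ'
    refine (key (α + β) (-β) hβ hβ').imp_right fun h1 => h1.trans ?_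
    rw [add_neg_cancel_right, ← neg_sub (H (α + β)), neg_div, sin_neg]
    exact neg_le_abs _

lemma exists_translate_abs_le (β : ℝ) : ∃ n : ℤ, |β + n * (2 * π)| ≤ π := by
  obtain ⟨n, hn⟩ := exists_translate_mem_Ico (β + π)
  exact ⟨n, abs_le.2 ⟨by linarith [hn.1], by linarith [hn.2]⟩⟩

/-- A bounded composition operator forces the three-point condition at all scales. -/
lemma exists_global_ratio_bound_of_bounded {φ : ℂ → ℂ} {H : ℝ → ℝ} {C : ℝ} (hC : 0 < C)
    (hH : Continuous H) (hmono : StrictMono H) (hper : ∀ t, H (t + 2 * π) = H t + 2 * π)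
    (hnorm : ∀ t : ℝ, ‖φ (Complex.exp (t * Complex.I))‖ = 1)
    (hchord : ∀ s t : ℝ, ‖φ (Complex.exp (s * Complex.I)) - φ (Complex.exp (t * Complex.I))‖ =
      2 * |sin ((H s - H t) / 2)|)
    (hbdd : ∀ f : ℂ → ℂ, ContinuousOn f (sphere (0 : ℂ) 1) →
        douglasEnergy (f ∘ φ) ≤ ENNReal.ofReal C * douglasEnergy f) :
    ∃ k : ℝ, 1 ≤ k ∧ ∀ α β : ℝ, (∀ n : ℤ, β ≠ n * (2 * π)) →
      ‖φ (Complex.exp ((α + β : ℝ) * Complex.I)) - φ (Complex.exp (α * Complex.I))‖ ≤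
        k * ‖φ (Complex.exp ((α - β : ℝ) * Complex.I)) - φ (Complex.exp (α * Complex.I))‖ := by
  obtain ⟨b, hb0, hb1, hb⟩ := exists_forall_abs_sub_le hH hper
  obtain ⟨m, hm0, hm⟩ := exists_pos_le_sub hH hmono hper hb0
  obtain ⟨K, hK0, hK⟩ := exists_ratio_bound_of_bounded hb1 hC hnorm hchord hmono hb hbdd
  have hpi := pi_gt_three
  have hsin := (abs_sin_half_ge hmono hper (by linarith : b ≤ π) hm0 hm (α := 0) (β := π)
    (by rw [abs_of_pos pi_pos]; linarith) (by rw [abs_of_pos pi_pos])).1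
  refine ⟨1 + K + 1 / sin (m / 2), by linarith [one_div_pos.2 hsin], fun α β hβ => ?_⟩
  obtain ⟨n, hn⟩ := exists_translate_abs_le β
  set γ := β + n * (2 * π) with hγ
  have hγ0 : γ ≠ 0 := fun h => hβ (-n) (by push_cast; linarith)
  have hplus : Complex.exp ((α + β : ℝ) * Complex.I) = Complex.exp ((α + γ : ℝ) * Complex.I) := by
    rw [hγ, ← add_assoc]
    exact (exp_periodic.int_mul n (α + β)).symm
  have hminus : Complex.exp ((α - β : ℝ) * Complex.I) = Complex.exp ((α - γ : ℝ) * Complex.I) := by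
    rw [hγ, ← sub_sub]
    exact (exp_periodic.sub_int_mul_eq n).symm
  rw [hplus, hminus]
  have hN := norm_nonneg
    (φ (Complex.exp ((α - γ : ℝ) * Complex.I)) - φ (Complex.exp (α * Complex.I)))
  rcases le_total |γ| b with h | h
  · refine (hK α γ hγ0 h).trans (mul_le_mul_of_nonneg_right ?_ hN)
    linarith [one_div_pos.2 hsin]
  · have h1 := (abs_sin_half_ge hmono hper (by linarith : b ≤ π) hm0 hm (α := α) (β := -γ)
      (by rwa [abs_neg]) (by rwa [abs_neg])).2
    rw [← sub_eq_add_neg] at h1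
    refine le_trans ?_ (mul_le_mul_of_nonneg_right
      (by linarith : 1 / sin (m / 2) ≤ 1 + K + 1 / sin (m / 2)) hN)
    rw [hchord, hchord]
    have h2 : |sin ((H (α + γ) - H α) / 2)| ≤ 1 := abs_sin_le_one _
    calc _ ≤ 2 * 1 := by gcongr
      _ = 1 / sin (m / 2) * (2 * sin (m / 2)) := by field_simp
      _ ≤ _ := by gcongr

theorem composition_bounded_on_Hhalf_iff_quasisymmetric (φ : ℂ → ℂ)
    (hbij : Set.BijOn φ (sphere (0 : ℂ) 1) (sphere (0 : ℂ) 1))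
    (hcont : ContinuousOn φ (sphere (0 : ℂ) 1)) :
    (∃ C : ℝ, 0 < C ∧ ∀ f : ℂ → ℂ, ContinuousOn f (sphere (0 : ℂ) 1) →
        douglasEnergy (f ∘ φ) ≤ ENNReal.ofReal C * douglasEnergy f) ↔
    (∃ k : ℝ, 1 ≤ k ∧ ∀ α β : ℝ, (∀ n : ℤ, β ≠ n * (2 * π)) →
        1 / k ≤
            ‖φ (Complex.exp ((α + β) * Complex.I)) - φ (Complex.exp (α * Complex.I))‖ /
              ‖φ (Complex.exp (α * Complex.I)) - φ (Complex.exp ((α - β) * Complex.I))‖ ∧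
          ‖φ (Complex.exp ((α + β) * Complex.I)) - φ (Complex.exp (α * Complex.I))‖ /
              ‖φ (Complex.exp (α * Complex.I)) - φ (Complex.exp ((α - β) * Complex.I))‖
            ≤ k) := by
  obtain ⟨H, hH, hmono, hper, hlift⟩ := exists_strictMono_lift φ hbij hcont
  have hmem : ∀ t : ℝ, Complex.exp (t * Complex.I) ∈ sphere (0 : ℂ) 1 := fun t => by
    rw [mem_sphere_zero_iff_norm, Complex.norm_exp_ofReal_mul_I]
  have hnorm : ∀ t : ℝ, ‖φ (Complex.exp (t * Complex.I))‖ = 1 := fun t =>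
    mem_sphere_zero_iff_norm.1 (hbij.mapsTo (hmem t))
  have hchord : ∀ s t : ℝ, ‖φ (Complex.exp (s * Complex.I)) - φ (Complex.exp (t * Complex.I))‖ =
      2 * |sin ((H s - H t) / 2)| := by
    intro s t
    rcases hlift with h | h
    · rw [h, h, norm_exp_sub_exp]
    · rw [h, h, norm_exp_sub_exp, ← abs_neg, ← sin_neg]
      congr 3
      ring
  constructor
  · rintro ⟨C, hC, hbdd⟩
    obtain ⟨k, hk1, hk⟩ := exists_global_ratio_bound_of_bounded hC hH hmono hper hnorm hchord hbdd
    refine ⟨k, hk1, fun α β hβ => ?_⟩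
    have hk0 : 0 < k := by linarith
    have h1 := hk α β hβ
    have h2 := hk α (-β) fun n h => hβ (-n) (by push_cast; linarith)
    rw [← sub_eq_add_neg, sub_neg_eq_add] at h2
    rw [norm_sub_rev (φ (Complex.exp (α * Complex.I)))]
    push_cast at h1 h2
    have hpos : 0 < ‖φ (Complex.exp ((α - β) * Complex.I)) - φ (Complex.exp (α * Complex.I))‖ := by
      rw [norm_pos_iff, sub_ne_zero]
      intro h
      have h3 := hbij.injOn (by exact_mod_cast hmem (α - β)) (hmem α) h
      obtain ⟨n, hn⟩ := exists_int_of_circleExp_eq (s := α) (t := α - β)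
        (Subtype.ext (by
          rw [coe_circleExp_eq, coe_circleExp_eq, Complex.ofReal_sub]
          exact h3.symm))
      exact hβ n (by linarith)
    rw [div_le_div_iff₀ hk0 hpos, div_le_iff₀ hpos]
    exact ⟨by linarith, h1⟩
  · rintro ⟨k, hk1, hk⟩
    have hk0 : 0 < k := by linarith
    obtain ⟨M, hM⟩ := exists_isQuasisymmetricLift hH hmono hper hk0 (by
      intro α β hβ
      obtain ⟨h1, h2⟩ := hk α β hβ
      rw [← hchord, ← hchord]
      push_cast
      have hpos : 0 < ‖φ (Complex.exp (α * Complex.I)) -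
          φ (Complex.exp ((α - β) * Complex.I))‖ := by
        refine (norm_nonneg _).lt_of_ne fun h => ?_
        rw [← h, div_zero] at h1
        linarith [one_div_pos.2 hk0]
      exact (div_le_iff₀ hpos).1 h2)
    obtain ⟨C, hC, hbdd⟩ := hM.exists_angularEnergy_comp_le
    refine ⟨C, hC, fun f hf => ?_⟩
    have hF : Continuous fun t : ℝ => f (Complex.exp (t * Complex.I)) :=
      hf.comp_continuous (by fun_prop) hmem
    have hFper : Function.Periodic (fun t : ℝ => f (Complex.exp (t * Complex.I))) (2 * π) :=
      exp_periodic.comp f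
    rw [douglasEnergy_eq_angularEnergy, douglasEnergy_eq_angularEnergy]
    rcases hlift with h | h
    · have h1 : (fun t : ℝ => (f ∘ φ) (Complex.exp (t * Complex.I))) =
          (fun t : ℝ => f (Complex.exp (t * Complex.I))) ∘ H :=
        funext fun t => congrArg f (h t)
      rw [h1]
      exact hbdd _ hF hFper
    · have h1 : (fun t : ℝ => (f ∘ φ) (Complex.exp (t * Complex.I))) =
          (fun t : ℝ => f (Complex.exp ((-t : ℝ) * Complex.I))) ∘ H :=
        funext fun t => congrArg f (h t)
      rw [h1, ← angularEnergy_comp_neg hFper]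
      refine hbdd _ (hF.comp continuous_neg) fun t => ?_
      have h2 := hFper.sub_eq (-t)
      rw [neg_add]
      exact h2
end
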